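/- Let D = Z_3 × Z_{3^n} with n ≥ 1 and let A be an S-ring over D with rad(A) > e. Then A is a proper generalized wreath product: there exist A-subgroups L ≤ U with L ≠ e and U ≠ D such that every basic set of A outside U is a union of L-cosets. Moreover, one can choose L and U so that |U/L| = 1, or |U/L| = 3, or rad(A_U) = e and |L| = 3. -/

import Mathlib

open scoped BigOperators Pointwise Classical

noncomputable section

/-- The group-ring element `X̄ = Σ_{x∈X} x` in `ℤG`. -/
def ind {G : Type*} [Group G] (X : Finset G) : MonoidAlgebra ℤ G :=
  ∑ x ∈ X, MonoidAlgebra.single x 1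

/-- The ℤ-span of the class sums of the members of `S`. -/
def spanA {G : Type*} [Group G] (S : Finset (Finset G)) :
    Submodule ℤ (MonoidAlgebra ℤ G) :=
  Submodule.span ℤ (ind '' (S : Set (Finset G)))

/-- `S` is the partition of basic sets of an S-ring over `G`. -/
structure IsSRing {G : Type*} [Group G] (S : Finset (Finset G)) : Prop where
  cover : ∀ g : G, ∃ X ∈ S, g ∈ X
  disj : ∀ X ∈ S, ∀ Y ∈ S, X ≠ Y → Disjoint X Y
  nonempty : ∀ X ∈ S, X.Nonempty
  one_mem : ({1} : Finset G) ∈ S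
  inv_mem : ∀ X ∈ S, X.image (·⁻¹) ∈ S
  mul_closed : ∀ a ∈ spanA S, ∀ b ∈ spanA S, a * b ∈ spanA S

/-- `X` is an `A`-set: its class sum lies in the span of the basic class sums. -/
def IsASet {G : Type*} [Group G] (S : Finset (Finset G)) (X : Finset G) : Prop :=
  ind X ∈ spanA S

/-- The finset underlying a subgroup of a finite group. -/
def subgroupFinset {G : Type*} [Group G] [Fintype G] (H : Subgroup G) : Finset G :=
  Finset.univ.filter (· ∈ H)

/-- `H` is an `A`-subgroup. -/
def IsASubgroup {G : Type*} [Group G] [Fintype G] (S : Finset (Finset G))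
    (H : Subgroup G) : Prop :=
  IsASet S (subgroupFinset H)

/-- The radical `rad(X) = {g : gX = Xg = X}` as a subgroup. -/
def radSubgroup {G : Type*} [Group G] (X : Finset G) : Subgroup G where
  carrier := {g : G | X.image (g * ·) = X ∧ X.image (· * g) = X}
  one_mem' := by
    constructor <;> · simp only [one_mul, mul_one]; exact Finset.image_id
  mul_mem' := by
    rintro a b ⟨ha1, ha2⟩ ⟨hb1, hb2⟩
    constructor
    · have : X.image (a * b * ·) = (X.image (b * ·)).image (a * ·) := by
        rw [Finset.image_image]
        exact Finset.image_congr (fun x _ => by simp [mul_assoc])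
      rw [this, hb1, ha1]
    · have : X.image (· * (a * b)) = (X.image (· * a)).image (· * b) := by
        rw [Finset.image_image]
        exact Finset.image_congr (fun x _ => by simp [mul_assoc])
      rw [this, ha2, hb2]
  inv_mem' := by
    rintro a ⟨ha1, ha2⟩
    constructor
    · have := congrArg (Finset.image (a⁻¹ * ·)) ha1
      rw [Finset.image_image] at this
      have h2 : X.image ((a⁻¹ * ·) ∘ (a * ·)) = X := by
        rw [show ((a⁻¹ * ·) ∘ (a * ·)) = id by funext x; simp, Finset.image_id]
      rw [← this, h2]
    · have := congrArg (Finset.image (· * a⁻¹)) ha2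
      rw [Finset.image_image] at this
      have h2 : X.image ((· * a⁻¹) ∘ (· * a)) = X := by
        rw [show ((· * a⁻¹) ∘ (· * a)) = id by funext x; simp, Finset.image_id]
      rw [← this, h2]

end

instance nePow (a k : ℕ) [NeZero a] : NeZero (a ^ k) := ⟨pow_ne_zero k (NeZero.ne a)⟩

/-- The group `D = ℤ₃ × ℤ_{3^n}` (written multiplicatively). -/
abbrev Dgrp (n : ℕ) := Multiplicative (ZMod 3) × Multiplicative (ZMod (3 ^ n))


set_option linter.all false

/-- relation form of an S-ring -/
structure SR {G : Type*} [CommGroup G] [Fintype G] (r : G → G → Prop) : Prop where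
  refl : ∀ x, r x x
  symm : ∀ {x y}, r x y → r y x
  trans : ∀ {x y z}, r x y → r y z → r x z
  one : ∀ {y}, r 1 y → y = 1
  inv : ∀ {x y}, r x y → r x⁻¹ y⁻¹
  mul : ∀ a b : G → ℤ, (∀ x y, r x y → a x = a y) → (∀ x y, r x y → b x = b y) →
    ∀ g g', r g g' → ∑ x, a x * b (x⁻¹ * g) = ∑ x, a x * b (x⁻¹ * g')

def AS {G : Type*} (r : G → G → Prop) (X : Finset G) : Prop :=
  ∀ x y, r x y → x ∈ X → y ∈ X

noncomputable def cls {G : Type*} [Fintype G] (r : G → G → Prop) (x : G) : Finset G :=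
  Finset.univ.filter (fun y => r x y)

section generic
variable {G : Type*} [CommGroup G] [Fintype G] {r : G → G → Prop}

theorem mem_cls {x y : G} : y ∈ cls r x ↔ r x y := by simp [cls]

theorem SR.self_mem (h : SR r) (x : G) : x ∈ cls r x := mem_cls.2 (h.refl x)

theorem SR.AS_cls (h : SR r) (x : G) : AS r (cls r x) := by
  intro a b hab ha
  exact mem_cls.2 (h.trans (mem_cls.1 ha) hab)

theorem SR.cls_eq (h : SR r) {x y : G} (hxy : r x y) : cls r x = cls r y := by
  ext z; simp only [mem_cls]
  exact ⟨fun k => h.trans (h.symm hxy) k, fun k => h.trans hxy k⟩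

theorem AS.inter {X Y : Finset G} (hX : AS r X) (hY : AS r Y) : AS r (X ∩ Y) := by
  intro a b hab h; rw [Finset.mem_inter] at *; exact ⟨hX a b hab h.1, hY a b hab h.2⟩

theorem AS.union {X Y : Finset G} (hX : AS r X) (hY : AS r Y) : AS r (X ∪ Y) := by
  intro a b hab h; rw [Finset.mem_union] at *
  exact h.imp (hX a b hab) (hY a b hab)

theorem SR.AS_sdiff (h : SR r) {X Y : Finset G} (hX : AS r X) (hY : AS r Y) : AS r (X \ Y) := by
  intro a b hab k; rw [Finset.mem_sdiff] at *
  exact ⟨hX a b hab k.1, fun hb => k.2 (hY b a (h.symm hab) hb)⟩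

theorem SR.mem_iff (h : SR r) {X : Finset G} (hX : AS r X) {x y : G} (hxy : r x y) :
    x ∈ X ↔ y ∈ X := ⟨hX x y hxy, hX y x (h.symm hxy)⟩

theorem SR.one' (h : SR r) {y : G} (k : r y 1) : y = 1 := h.one (h.symm k)

theorem SR.inv_iff (h : SR r) {x y : G} : r x⁻¹ y⁻¹ ↔ r x y :=
  ⟨fun k => by simpa using h.inv k, h.inv⟩

/-- structure constants -/
theorem SR.count (h : SR r) {X Y : Finset G} (hX : AS r X) (hY : AS r Y) {g g' : G}
    (hg : r g g') :
    (X.filter (fun x => x⁻¹ * g ∈ Y)).card = (X.filter (fun x => x⁻¹ * g' ∈ Y)).card := by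
  have key := h.mul (fun x => if x ∈ X then 1 else 0) (fun x => if x ∈ Y then 1 else 0)
    (fun x y hxy => by simp only [h.mem_iff hX hxy]) (fun x y hxy => by simp only [h.mem_iff hY hxy]) g g' hg
  have aux : ∀ g, (∑ x, (if x ∈ X then (1:ℤ) else 0) * (if x⁻¹ * g ∈ Y then 1 else 0))
      = ((X.filter (fun x => x⁻¹ * g ∈ Y)).card : ℤ) := by
    intro g
    rw [Finset.card_filter]
    push_cast
    simp only [Finset.sum_boole, ite_mul, one_mul, zero_mul, Finset.sum_ite_mem, Finset.univ_inter]
  simp only [aux] at key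
  exact_mod_cast key

theorem SR.AS_inv (h : SR r) {X : Finset G} (hX : AS r X) : AS r (X.image (·⁻¹)) := by
  intro a b hab ha
  simp only [Finset.mem_image] at *
  obtain ⟨x, hx, rfl⟩ := ha
  exact ⟨b⁻¹, hX x _ (by simpa using h.inv hab) hx, by simp⟩

/-- product set of closed sets is closed, elementwise form -/
theorem SR.prod (h : SR r) {X Y : Finset G} (hX : AS r X) (hY : AS r Y) {g g' : G}
    (hg : r g g') (k : ∃ x ∈ X, ∃ y ∈ Y, x * y = g) : ∃ x ∈ X, ∃ y ∈ Y, x * y = g' := by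
  obtain ⟨x, hx, y, hy, rfl⟩ := k
  have := h.count hX hY hg
  have h1 : 0 < (X.filter (fun z => z⁻¹ * (x * y) ∈ Y)).card :=
    Finset.card_pos.2 ⟨x, by simp [hx, hy]⟩
  rw [this] at h1
  obtain ⟨z, hz⟩ := Finset.card_pos.1 h1
  simp only [Finset.mem_filter] at hz
  exact ⟨z, hz.1, _, hz.2, by simp⟩

theorem SR.prod_mem (h : SR r) {x y g : G} (hg : r (x * y) g) :
    ∃ x' y', r x x' ∧ r y y' ∧ x' * y' = g := by
  obtain ⟨x', hx, y', hy, e⟩ := h.prod (h.AS_cls x) (h.AS_cls y) hg ⟨x, h.self_mem x, y, h.self_mem y, rfl⟩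
  exact ⟨x', y', mem_cls.1 hx, mem_cls.1 hy, e⟩

/-- overlap numbers -/
noncomputable def ov (X : Finset G) (g : G) : ℕ := (X.filter (fun x => g * x ∈ X)).card

theorem SR.ov_eq (h : SR r) {X : Finset G} (hX : AS r X) {g g' : G} (hg : r g g') :
    ov X g = ov X g' := by
  have := h.count (h.AS_inv hX) hX hg
  have aux : ∀ g, ((X.image (·⁻¹)).filter (fun x => x⁻¹ * g ∈ X)).card = ov X g := by
    intro g
    rw [ov]
    symm
    apply Finset.card_bij (fun x _ => x⁻¹)
    · intro a ha
      simp only [Finset.mem_filter, Finset.mem_image] at *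
      exact ⟨⟨a, ha.1, rfl⟩, by simpa [mul_comm] using ha.2⟩
    · intro a _ b _ hab; simpa using hab
    · intro b hb
      simp only [Finset.mem_filter, Finset.mem_image] at *
      obtain ⟨⟨a, ha, rfl⟩, hb⟩ := hb
      exact ⟨a, ⟨ha, by simpa [mul_comm] using hb⟩, rfl⟩
  rwa [aux, aux] at this

/-- p-power congruence -/
theorem SR.pcount (h : SR r) {X : Finset G} (hX : AS r X) (p : ℕ) [Fact p.Prime] {g g' : G}
    (hg : r g g') :
    ((X.filter (fun x => x ^ p = g)).card : ZMod p) = ((X.filter (fun x => x ^ p = g')).card : ZMod p) := by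
  set F : MonoidAlgebra ℤ G := ∑ x ∈ X, MonoidAlgebra.single x 1 with hF
  have hFc : ∀ g, F.coeff g = if g ∈ X then 1 else 0 := by
    intro g
    simp [hF, MonoidAlgebra.coeff_sum, Finsupp.finsetSum_apply, Finsupp.single_apply]
  have hcl : ∀ k : ℕ, ∀ g g', r g g' → (F ^ (k+1)).coeff g = (F ^ (k+1)).coeff g' := by
    intro k
    induction k with
    | zero =>
      intro g g' hg
      simp only [zero_add, pow_one, hFc, h.mem_iff hX hg]
    | succ k ih =>
      intro g g' hg
      have e : ∀ a b : MonoidAlgebra ℤ G, ∀ g, (a * b).coeff g = ∑ x, a.coeff x * b.coeff (x⁻¹ * g) := by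
        intro a b g
        rw [MonoidAlgebra.coeff_mul_apply_left, Finsupp.sum_fintype]
        intro; simp
      rw [pow_succ, e, e]
      exact h.mul _ _ ih (fun x y hxy => by simp only [hFc, h.mem_iff hX hxy]) g g' hg
  have e2 : ∀ g, (((F ^ p).coeff g : ℤ) : ZMod p) = ((X.filter (fun x => x ^ p = g)).card : ZMod p) := by
    intro g
    have h1 : (MonoidAlgebra.mapRingHom G (Int.castRingHom (ZMod p)) (F ^ p)).coeff g = (((F ^ p).coeff g : ℤ) : ZMod p) := by
      rw [MonoidAlgebra.coeff_mapRingHom]; rfl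
    haveI : CharP (MonoidAlgebra (ZMod p) G) p :=
      charP_of_injective_algebraMap (algebraMap (ZMod p) (MonoidAlgebra (ZMod p) G)).injective p
    rw [← h1, map_pow, hF, map_sum, sum_pow_char]
    simp [MonoidAlgebra.coeff_sum, Finsupp.finsetSum_apply, Finsupp.single_apply, MonoidAlgebra.single_pow]
  rw [← e2, ← e2]
  obtain ⟨k, hk⟩ : ∃ k, p = k + 1 := ⟨p - 1, by have := (Fact.out : p.Prime).pos; omega⟩
  have := hcl k g g' hg
  rw [← hk] at this
  rw [this]

end generic

set_option linter.all false

/-- closed subgroups -/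
def RC {G : Type*} [CommGroup G] (r : G → G → Prop) (H : Subgroup G) : Prop :=
  ∀ x y, r x y → x ∈ H → y ∈ H

section generic
variable {G : Type*} [CommGroup G] [Fintype G] {r : G → G → Prop}

noncomputable def fs (H : Subgroup G) : Finset G := Finset.univ.filter (· ∈ H)

@[simp] theorem mem_fs {H : Subgroup G} {x : G} : x ∈ fs H ↔ x ∈ H := by simp [fs]

theorem RC.AS {H : Subgroup G} (h : RC r H) : AS r (fs H) := by
  intro x y hxy hx; rw [mem_fs] at *; exact h x y hxy hx

theorem card_fs (H : Subgroup G) : (fs H).card = Nat.card H := by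
  rw [fs, Nat.card_eq_fintype_card, Fintype.card_subtype]

theorem SR.pow_aux (h : SR r) (m : ℕ) (hm : m.Coprime (Nat.card G)) :
    ∀ x w, r (x ^ m) w → ∃ z, r x z ∧ z ^ m = w := by
  induction m using Nat.recOnMul with
  | zero =>
    intro x w hw
    have : Nat.card G = 1 := by simpa using hm
    haveI := (Nat.card_eq_one_iff_unique.1 this).1
    exact ⟨x, h.refl x, Subsingleton.elim _ _⟩
  | one => intro x w hw; exact ⟨w, by simpa using hw, by simp⟩
  | prime p hp =>
    intro x w hw
    haveI : Fact p.Prime := ⟨hp⟩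
    have hinj : ∀ z : G, z ^ p = x ^ p → z = x := by
      intro z hz
      exact (Nat.Coprime.pow_left_bijective (G := G) (hm.symm)).1 hz
    have := h.pcount (h.AS_cls x) p hw
    have e : (cls r x).filter (fun z => z ^ p = x ^ p) = {x} := by
      ext z; simp only [Finset.mem_filter, Finset.mem_singleton]
      exact ⟨fun k => hinj z k.2, fun k => by subst k; exact ⟨h.self_mem z, rfl⟩⟩
    rw [e] at this
    by_contra hne
    push Not at hne
    have e2 : (cls r x).filter (fun z => z ^ p = w) = ∅ := by
      ext z; simp only [Finset.mem_filter, Finset.notMem_empty, iff_false, not_and]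
      exact fun k => hne z (mem_cls.1 k)
    rw [e2] at this
    simp at this
  | mul a b iha ihb =>
    intro x w hw
    have ha := Nat.Coprime.coprime_mul_right hm
    have hb := Nat.Coprime.coprime_mul_left hm
    rw [pow_mul] at hw
    obtain ⟨z, hz, e⟩ := ihb hb _ _ hw
    obtain ⟨z', hz', e'⟩ := iha ha _ _ hz
    exact ⟨z', hz', by rw [pow_mul, e', e]⟩

theorem SR.pow (h : SR r) (hG : IsPGroup 3 G) {m : ℕ} (hm : ¬ 3 ∣ m) {x y : G} (hxy : r x y) :
    r (x ^ m) (y ^ m) := by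
  obtain ⟨k, hk⟩ := IsPGroup.iff_card.1 hG
  have hc : ∀ m, ¬ 3 ∣ m → m.Coprime (Nat.card G) := fun m hm => by
    rw [hk]; exact Nat.Coprime.pow_right _ ((Nat.Prime.coprime_iff_not_dvd Nat.prime_three).2 hm).symm
  rcases Nat.eq_zero_or_pos k with h0 | h0
  · subst h0
    have : Nat.card G = 1 := by simpa using hk
    haveI := (Nat.card_eq_one_iff_unique.1 this).1
    rw [Subsingleton.elim (x^m) (y^m)]; exact h.refl _
  obtain ⟨m', hm'⟩ := Nat.exists_mul_mod_eq_one_of_coprime (hc m hm) (by rw [hk]; exact Nat.one_lt_pow (by omega) (by norm_num))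
  have hp : ∀ z : G, (z ^ m) ^ m' = z := by
    intro z
    rw [← pow_mul, ← pow_mod_natCard, hm'.2, pow_one]
  have hm3 : ¬ 3 ∣ m' := by
    intro hd
    have h1 : 3 ∣ Nat.card G := by rw [hk]; exact dvd_pow_self 3 (by omega)
    have := hm'.2
    have h3 : (m * m') % 3 = 1 := by rw [← Nat.mod_mod_of_dvd _ h1, this]
    have : (m * m') % 3 = 0 := Nat.mod_eq_zero_of_dvd (Dvd.dvd.mul_left hd m)
    omega
  have h1 : r ((x ^ m) ^ m') y := by rw [hp]; exact hxy
  obtain ⟨z, hz, e⟩ := h.pow_aux m' (hc m' hm3) _ _ h1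
  have : z = y ^ m := by
    rw [← e, ← pow_mul, mul_comm, pow_mul, hp]
  rwa [this] at hz

/-- stabilizer of a finset -/
def stab (X : Finset G) : Subgroup G where
  carrier := {g | ∀ y, y ∈ X ↔ g * y ∈ X}
  one_mem' := by intro y; simp
  mul_mem' := by
    intro a b ha hb y
    rw [hb y, ha (b * y), mul_assoc]
  inv_mem' := by
    intro a ha y
    rw [ha (a⁻¹ * y)]; simp

theorem mem_stab {X : Finset G} {g : G} : g ∈ stab X ↔ ∀ y, y ∈ X ↔ g * y ∈ X := Iff.rfl

theorem ov_eq_card {X : Finset G} {g : G} : ov X g = X.card ↔ g ∈ stab X := by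
  constructor
  · intro k
    have h1 : X.filter (fun x => g * x ∈ X) = X :=
      Finset.eq_of_subset_of_card_le (Finset.filter_subset _ _) (by rw [ov] at k; omega)
    have h2 : ∀ x ∈ X, g * x ∈ X := by
      intro x hx; rw [← h1] at hx; exact (Finset.mem_filter.1 hx).2
    have h3 : X.image (g * ·) = X := by
      apply Finset.eq_of_subset_of_card_le
      · intro z hz; simp only [Finset.mem_image] at hz; obtain ⟨x, hx, rfl⟩ := hz; exact h2 x hx
      · rw [Finset.card_image_of_injective _ (mul_right_injective g)]
    intro y
    refine ⟨h2 y, fun hy => ?_⟩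
    rw [← h3] at hy
    simp only [Finset.mem_image, mul_right_inj] at hy
    obtain ⟨x, hx, e⟩ := hy
    rwa [← e]
  · intro k
    rw [ov]; congr 1
    apply Finset.filter_true_of_mem
    intro x hx; exact (k x).1 hx

theorem mem_stab_of {X : Finset G} {g : G} (k : ∀ y ∈ X, g * y ∈ X) : g ∈ stab X := by
  rw [← ov_eq_card, ov]; congr 1; exact Finset.filter_true_of_mem k

theorem SR.RC_stab (h : SR r) {X : Finset G} (hX : AS r X) : RC r (stab X) := by
  intro x y hxy hx
  rw [← ov_eq_card] at *
  rw [← hx, h.ov_eq hX hxy]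

theorem SR.RC_closure (h : SR r) {X : Set G} (hX : ∀ x y, r x y → x ∈ X → y ∈ X) :
    RC r (Subgroup.closure X) := by
  intro x y hxy hx
  induction hx using Subgroup.closure_induction generalizing y with
  | mem x hx => exact Subgroup.subset_closure (hX x y hxy hx)
  | one => rw [h.one hxy]; exact one_mem _
  | mul a b _ _ iha ihb =>
    obtain ⟨a', b', ha, hb, rfl⟩ := h.prod_mem hxy
    exact mul_mem (iha a' ha) (ihb b' hb)
  | inv a _ ih =>
    have := ih y⁻¹ (by simpa using h.inv hxy)
    simpa using this

noncomputable def Rad (r : G → G → Prop) (x : G) : Subgroup G := stab (cls r x)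

theorem SR.RC_Rad (h : SR r) (x : G) : RC r (Rad r x) := h.RC_stab (h.AS_cls x)

theorem mem_Rad_of {x g : G} (k : ∀ y, r x y → r x (g * y)) : g ∈ Rad r x :=
  mem_stab_of (fun y hy => mem_cls.2 (k y (mem_cls.1 hy)))

theorem mem_Rad {x g y : G} (hg : g ∈ Rad r x) (hy : r x y) : r x (g * y) :=
  mem_cls.1 ((hg y).1 (mem_cls.2 hy))

theorem SR.mem_Rad' (h : SR r) {x g : G} (hg : g ∈ Rad r x) : r x (g * x) :=
  mem_Rad hg (h.refl x)

theorem SR.Rad_eq (h : SR r) {x y : G} (hxy : r x y) : Rad r x = Rad r y := by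
  rw [Rad, Rad, h.cls_eq hxy]

theorem SR.pow_inv_exists (hG : IsPGroup 3 G) {m : ℕ} (hm : ¬ 3 ∣ m) :
    ∃ m', ¬ 3 ∣ m' ∧ ∀ z : G, (z ^ m) ^ m' = z := by
  obtain ⟨k, hk⟩ := IsPGroup.iff_card.1 hG
  have hc : m.Coprime (3 ^ (k+1)) := 
    Nat.Coprime.pow_right _ ((Nat.Prime.coprime_iff_not_dvd Nat.prime_three).2 hm).symm
  obtain ⟨m', hm'⟩ := Nat.exists_mul_mod_eq_one_of_coprime hc (Nat.one_lt_pow (by omega) (by norm_num))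
  refine ⟨m', ?_, ?_⟩
  · intro hd
    have h3 : (m * m') % 3 = 1 := by rw [← Nat.mod_mod_of_dvd _ (dvd_pow_self 3 (Nat.succ_ne_zero k)), hm'.2]
    have : (m * m') % 3 = 0 := Nat.mod_eq_zero_of_dvd (Dvd.dvd.mul_left hd m)
    omega
  · intro z
    have hz : z ^ (3 ^ (k+1)) = 1 := by rw [pow_succ, pow_mul, ← hk, pow_card_eq_one', one_pow]
    rw [← pow_mul, ← Nat.div_add_mod (m * m') (3 ^ (k+1)), hm'.2, pow_add, pow_mul, hz]; simp

theorem SR.Rad_pow (h : SR r) (hG : IsPGroup 3 G) {m : ℕ} (hm : ¬ 3 ∣ m) {x g : G}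
    (hg : g ∈ Rad r x) : g ^ m ∈ Rad r (x ^ m) := by
  obtain ⟨m', h3, hm'⟩ := SR.pow_inv_exists hG hm
  apply mem_Rad_of
  intro y hy
  have h1 := h.pow hG h3 hy
  rw [hm'] at h1
  have h2 := h.pow hG hm (mem_Rad hg h1)
  rw [mul_pow] at h2
  have e : (y ^ m') ^ m = y := by rw [← pow_mul, mul_comm, pow_mul, hm']
  rwa [e] at h2

/-- coset count -/
noncomputable def cc (X : Finset G) (V : Subgroup G) (g : G) : ℕ :=
  (X.filter (fun x => x⁻¹ * g ∈ V)).card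

theorem SR.cc_eq (h : SR r) {X : Finset G} (hX : AS r X) {V : Subgroup G} (hV : RC r V) {g g' : G}
    (hg : r g g') : cc X V g = cc X V g' := by
  have := h.count hX hV.AS hg
  simpa [cc] using this

theorem cc_coset {X : Finset G} {V : Subgroup G} {g v : G} (hv : v ∈ V) : cc X V (v * g) = cc X V g := by
  unfold cc; congr 1; apply Finset.filter_congr
  intro x _
  rw [show x⁻¹ * (v * g) = v * (x⁻¹ * g) by rw [mul_left_comm], Subgroup.mul_mem_cancel_left _ hv]

theorem sum_ov (X : Finset G) (V : Subgroup G) :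
    ∑ g ∈ fs V, ov X g = ∑ x ∈ X, cc X V x := by
  unfold ov cc
  simp only [Finset.card_filter]
  rw [Finset.sum_comm]
  apply Finset.sum_congr rfl
  intro x hx
  rw [← Finset.card_filter, ← Finset.card_filter]
  apply Finset.card_bij (fun g _ => g * x)
  · intro a ha; simp only [Finset.mem_filter, mem_fs] at *
    exact ⟨ha.2, by simpa [mul_comm] using ha.1⟩
  · intro a _ b _ hab; simpa using hab
  · intro b hb; simp only [Finset.mem_filter, mem_fs] at *
    refine ⟨b * x⁻¹, ⟨?_, by simpa using hb.1⟩, by simp⟩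
    have := V.inv_mem hb.2
    simpa [mul_comm] using this

theorem SR.sum_ov (h : SR r) (z : G) {V : Subgroup G} (hV : RC r V) :
    ∑ g ∈ fs V, ov (cls r z) g = (cls r z).card * cc (cls r z) V z := by
  rw [_root_.sum_ov, Finset.card_eq_sum_ones, Finset.sum_mul]
  apply Finset.sum_congr rfl
  intro x hx
  rw [one_mul]; exact h.cc_eq (h.AS_cls z) hV (h.symm (mem_cls.1 hx))

theorem card_sub_ov (X : Finset G) (g : G) :
    ov X g + (X.filter (fun x => g * x ∉ X)).card = X.card := by
  rw [ov]; exact Finset.card_filter_add_card_filter_not (fun x => g * x ∈ X)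

theorem sum_cc (D X : Finset G) (V : Subgroup G) :
    ∑ x ∈ X, cc D V x = ∑ x ∈ D, cc X V x := by
  unfold cc
  simp only [Finset.card_filter]
  rw [Finset.sum_comm]
  apply Finset.sum_congr rfl; intro x _
  apply Finset.sum_congr rfl; intro y _
  have : x⁻¹ * y ∈ V ↔ y⁻¹ * x ∈ V := by
    rw [← V.inv_mem_iff]; simp
  simp [this]

/-- double counting of a subset of the class -/
theorem SR.sum_sub (h : SR r) (z : G) {V : Subgroup G} (hV : RC r V) {D : Finset G} (hD : D ⊆ cls r z) :
    ∑ x ∈ cls r z, cc D V x = D.card * cc (cls r z) V z := by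
  rw [sum_cc, Finset.card_eq_sum_ones, Finset.sum_mul]
  apply Finset.sum_congr rfl
  intro x hx
  rw [one_mul]; exact h.cc_eq (h.AS_cls z) hV (h.symm (mem_cls.1 (hD hx)))

theorem SR.hull_le {H : Subgroup G} {c : G} (hH : RC r H) (hc : c ∈ H) :
    Subgroup.closure (cls r c : Set G) ≤ H := by
  rw [Subgroup.closure_le]
  intro x hx
  exact hH c x (mem_cls.1 hx) hc

/-- quotient relation -/
def qrel {G' : Type*} [CommGroup G'] (r : G → G → Prop) (φ : G →* G') : G' → G' → Prop :=
  fun u v => ∃ x y, φ x = u ∧ φ y = v ∧ r x y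

theorem SR.lift (h : SR r) {G' : Type*} [CommGroup G'] (φ : G →* G') (hk : RC r φ.ker)
    {x x' y : G} (e : φ x = φ x') (hxy : r x y) : ∃ y', φ y' = φ y ∧ r x' y' := by
  have : x = (x * x'⁻¹) * x' := by simp
  rw [this] at hxy
  obtain ⟨a, b, ha, hb, e2⟩ := h.prod_mem hxy
  have hk' : a ∈ φ.ker := hk _ _ ha (by rw [MonoidHom.mem_ker]; simp [e])
  refine ⟨b, ?_, hb⟩
  rw [← e2, map_mul, MonoidHom.mem_ker.1 hk', one_mul]

theorem SR.quot (h : SR r) {G' : Type*} [CommGroup G'] [Fintype G'] (φ : G →* G')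
    (hs : Function.Surjective φ) (hk : RC r φ.ker) : SR (qrel r φ) where
  refl := by intro u; obtain ⟨x, rfl⟩ := hs u; exact ⟨x, x, rfl, rfl, h.refl x⟩
  symm := by rintro u v ⟨x, y, hx, hy, k⟩; exact ⟨y, x, hy, hx, h.symm k⟩
  trans := by
    rintro u v w ⟨x, y, hx, hy, k⟩ ⟨y', z, hy', hz, k'⟩
    obtain ⟨z', hz', k''⟩ := h.lift φ hk (hy'.trans hy.symm) k'
    exact ⟨x, z', hx, hz'.trans hz, h.trans k k''⟩
  one := by
    rintro v ⟨x, y, hx, hy, k⟩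
    have := hk x y k (MonoidHom.mem_ker.2 hx)
    rw [← hy]; exact MonoidHom.mem_ker.1 this
  inv := by
    rintro u v ⟨x, y, hx, hy, k⟩
    exact ⟨x⁻¹, y⁻¹, by simp [hx], by simp [hy], h.inv k⟩
  mul := by
    rintro a b ha hb u v ⟨x, y, hx, hy, k⟩
    have := h.mul (fun x => a (φ x)) (fun x => b (φ x))
      (fun x y hxy => ha _ _ ⟨x, y, rfl, rfl, hxy⟩) (fun x y hxy => hb _ _ ⟨x, y, rfl, rfl, hxy⟩) x y k
    have key : ∀ f : G' → ℤ, ∑ x, f (φ x) = (Fintype.card φ.ker : ℤ) * ∑ u, f u := by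
      intro f
      rw [← Finset.sum_fiberwise Finset.univ φ, Finset.mul_sum]
      apply Finset.sum_congr rfl
      intro u _
      rw [Finset.sum_congr rfl (g := fun _ => f u) (fun x hx => by rw [(Finset.mem_filter.1 hx).2])]
      rw [Finset.sum_const, nsmul_eq_mul]
      congr 2
      rw [MonoidHom.card_fiber_eq_of_mem_range φ (hs u) ⟨1, map_one φ⟩, Fintype.card_subtype]
      congr 1
      ext g; simp [MonoidHom.mem_ker]
    have e1 := key (fun u' => a u' * b (u'⁻¹ * u))
    have e2 := key (fun u' => a u' * b (u'⁻¹ * v))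
    have hpos : (Fintype.card φ.ker : ℤ) ≠ 0 := by
      have : 0 < Fintype.card φ.ker := Fintype.card_pos
      omega
    apply mul_left_cancel₀ hpos
    rw [← e1, ← e2]
    simpa [map_mul, map_inv, hx, hy] using this

/-- separation -/
theorem SR.separation (h : SR r) {x0 : G} (H' : Subgroup G) (hx1 : ¬ r x0 1)
    (hY : ∃ y, r x0 y ∧ y ∈ H') (hZ : ∃ y, r x0 y ∧ y ∉ H')
    (hK : ∀ y, r x0 y → y ∈ H' → ∀ z, r x0 z → z ∉ H' → r x0 (y * z)) :
    ∃ W : Subgroup G, W ≤ Subgroup.closure {y | r x0 y ∧ y ∈ H'} ∧ 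
      ∀ g, r x0 g ↔ g ∈ Subgroup.closure (cls r x0 : Set G) ∧ g ∉ W := by
  set X := cls r x0 with hX
  set Y := X.filter (· ∈ H') with hYd
  set Z := X.filter (· ∉ H') with hZd
  set K := Subgroup.closure {y | r x0 y ∧ y ∈ H'} with hKd
  have mY : ∀ y, y ∈ Y ↔ r x0 y ∧ y ∈ H' := fun y => by simp [hYd, hX, mem_cls]
  have mZ : ∀ y, y ∈ Z ↔ r x0 y ∧ y ∉ H' := fun y => by simp [hZd, hX, mem_cls]
  have mX : ∀ y, y ∈ X ↔ y ∈ Z ∨ y ∈ Y := fun y => by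
    rw [mY, mZ, hX, mem_cls]; tauto
  have hKH : K ≤ H' := by rw [hKd, Subgroup.closure_le]; exact fun y hy => hy.2
  have hYK : ∀ y ∈ Y, y ∈ K := fun y hy => Subgroup.subset_closure ((mY y).1 hy)
  have hKst : K ≤ stab Z := by
    rw [hKd, Subgroup.closure_le]
    rintro y ⟨hy, hy'⟩
    apply mem_stab_of
    intro z hz
    rw [mZ] at *
    exact ⟨hK y hy hy' z hz.1 hz.2, fun k => hz.2 ((Subgroup.mul_mem_cancel_left _ hy').1 k)⟩
  have hZK : ∀ z ∈ Z, z ∉ K := fun z hz k => ((mZ z).1 hz).2 (hKH k)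
  have one_Y : (1:G) ∉ Y := fun k => hx1 ((mY _).1 k).1
  have stZ : ∀ k ∈ K, ∀ z, z ∈ Z ↔ k * z ∈ Z := fun k hk => mem_stab.1 (hKst hk)
  -- number of missed elements
  have hδ : ∀ g ∈ X, ∀ g' ∈ X, (X.filter (fun x => g * x ∉ X)).card = (X.filter (fun x => g' * x ∉ X)).card := by
    intro g hg g' hg'
    have h1 := card_sub_ov X g
    have h2 := card_sub_ov X g'
    have h3 := h.ov_eq (h.AS_cls x0) (h.trans (h.symm (mem_cls.1 hg)) (mem_cls.1 hg'))
    rw [← hX] at h3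
    omega
  have hmY : ∀ y ∈ Y, X.filter (fun x => y * x ∉ X) = Y.filter (fun x => y * x ∉ Y) := by
    intro y hy
    ext u
    simp only [Finset.mem_filter]
    constructor
    · rintro ⟨h1, h2⟩
      rw [mX] at h1 h2
      push Not at h2
      rcases h1 with h1 | h1
      · exact absurd ((stZ y (hYK y hy) u).1 h1) h2.1
      · exact ⟨h1, h2.2⟩
    · rintro ⟨h1, h2⟩
      refine ⟨(mX u).2 (Or.inr h1), fun k => ?_⟩
      rcases (mX _).1 k with k | k
      · exact hZK _ k (mul_mem (hYK y hy) (hYK u h1))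
      · exact h2 k
  have hmZ : ∀ z ∈ Z, X.filter (fun x => z * x ∉ X) = Z.filter (fun x => z * x ∉ X) := by
    intro z hz
    ext u
    simp only [Finset.mem_filter]
    constructor
    · rintro ⟨h1, h2⟩
      refine ⟨?_, h2⟩
      rcases (mX u).1 h1 with h1 | h1
      · exact h1
      · exfalso; apply h2; rw [mX, mul_comm]; left; exact (stZ u (hYK u h1) z).1 hz
    · rintro ⟨h1, h2⟩
      exact ⟨(mX u).2 (Or.inl h1), h2⟩
  obtain ⟨y0, hy0⟩ := hY
  have hy0 : y0 ∈ Y := (mY y0).2 hy0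
  have hlt : Y.card < (fs K).card := by
    apply Finset.card_lt_card
    refine ⟨fun y hy => mem_fs.2 (hYK y hy), fun k => one_Y (k (mem_fs.2 (one_mem K)))⟩
  have hpos : (Y.filter (fun x => y0 * x ∉ Y)).Nonempty := by
    by_contra hne
    rw [Finset.not_nonempty_iff_eq_empty, Finset.filter_eq_empty_iff] at hne
    push Not at hne
    have h1 : y0 ∈ stab Y := mem_stab_of (fun y hy => hne hy)
    have h2 := mem_stab.1 ((stab Y).inv_mem h1) y0
    rw [inv_mul_cancel] at h2
    exact one_Y (h2.1 hy0)
  have hZ1 : ∀ z ∈ Z, (∀ x ∈ Z, z * x ∉ X → z * x ∈ K) ∧ (∀ k ∈ K, ∃ x ∈ Z, z * x = k) := by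
    intro z hz
    have hle : (Z.filter (fun x => z * x ∉ X)).card = (Y.filter (fun x => y0 * x ∉ Y)).card := by
      rw [← hmZ z hz, ← hmY y0 hy0]
      exact hδ z ((mX z).2 (Or.inl hz)) y0 ((mX y0).2 (Or.inr hy0))
    have hle2 : (Z.filter (fun x => z * x ∉ X)).card < (fs K).card := by
      rw [hle]; exact lt_of_le_of_lt (Finset.card_filter_le _ _) hlt
    have hA : ∀ x ∈ Z, z * x ∉ X → z * x ∈ K := by
      intro x hx hxX
      by_contra hnK
      have : (fs K).card ≤ (Z.filter (fun x => z * x ∉ X)).card := by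
        apply Finset.card_le_card_of_injOn (fun k => k * x)
        · intro k hk
          simp only [Finset.coe_filter, Set.mem_setOf_eq]
          have hk' : k ∈ K := mem_fs.1 hk
          refine ⟨(stZ k hk' x).1 hx, fun hc => ?_⟩
          have e : z * (k * x) = k * (z * x) := mul_left_comm _ _ _
          rw [e, mX] at hc
          rcases hc with hc | hc
          · exact hxX ((mX _).2 (Or.inl ((stZ k hk' (z * x)).2 hc)))
          · exact hnK ((Subgroup.mul_mem_cancel_left _ hk').1 (hYK _ hc))
        · intro a _ b _ hab; simpa using hab
      omega
    refine ⟨hA, ?_⟩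
    have hne : (Z.filter (fun x => z * x ∉ X)).Nonempty := by
      rw [← Finset.card_pos, hle]; exact Finset.card_pos.2 hpos
    obtain ⟨x, hx⟩ := hne
    simp only [Finset.mem_filter] at hx
    have hxK := hA x hx.1 hx.2
    intro k hk
    refine ⟨k * (z * x)⁻¹ * x, (stZ _ (mul_mem hk (inv_mem hxK)) x).1 hx.1, ?_⟩
    rw [mul_left_comm, inv_mul_cancel_right]
  obtain ⟨z0, hz0⟩ := hZ
  have hz0 : z0 ∈ Z := (mZ z0).2 hz0
  -- W
  have hWY : ∀ y ∈ Y, ∀ w ∈ K, w ∉ Y → y⁻¹ * w ∈ Y := by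
    intro y hy
    have hsub : (Y.filter (fun x => y * x ∉ Y)).image (y * ·) ⊆ fs K \ Y := by
      intro w hw
      simp only [Finset.mem_image, Finset.mem_filter, Finset.mem_sdiff, mem_fs] at *
      obtain ⟨u, ⟨h1, h2⟩, rfl⟩ := hw
      exact ⟨mul_mem (hYK y hy) (hYK u h1), h2⟩
    have hcard : (fs K \ Y).card ≤ ((Y.filter (fun x => y * x ∉ Y)).image (y * ·)).card := by
      rw [Finset.card_image_of_injective _ (mul_right_injective y), ← hmY y hy,
        hδ y ((mX y).2 (Or.inr hy)) z0 ((mX z0).2 (Or.inl hz0)), hmZ z0 hz0]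
      apply Finset.card_le_card_of_injOn (fun k => z0⁻¹ * k)
      · intro k hk
        simp only [Finset.coe_sdiff, Set.mem_diff, Finset.mem_coe, mem_fs] at hk
        obtain ⟨x, hx, e⟩ := (hZ1 z0 hz0).2 k hk.1
        simp only [Finset.coe_filter, Set.mem_setOf_eq]
        rw [← e]
        simp only [inv_mul_cancel_left]
        refine ⟨hx, ?_⟩
        rw [e, mX]; push Not
        exact ⟨fun hkz => hZK k hkz hk.1, hk.2⟩
      · intro a _ b _ hab; simpa using hab
    have heq := Finset.eq_of_subset_of_card_le hsub hcard
    intro w hw hwY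
    have : w ∈ fs K \ Y := by simp [hw, hwY]
    rw [← heq] at this
    simp only [Finset.mem_image, Finset.mem_filter] at this
    obtain ⟨u, ⟨h1, h2⟩, rfl⟩ := this
    simpa using h1
  have hYinv : ∀ y ∈ Y, y⁻¹ ∈ Y := fun y hy => by
    simpa using hWY y hy 1 (one_mem K) one_Y
  let W : Subgroup G :=
    { carrier := {w | w ∈ K ∧ w ∉ Y}
      one_mem' := ⟨one_mem K, one_Y⟩
      mul_mem' := by
        rintro a b ⟨ha, ha'⟩ ⟨hb, hb'⟩
        refine ⟨mul_mem ha hb, fun k => ?_⟩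
        have := hWY _ k a ha ha'
        rw [mul_inv, mul_comm a⁻¹, inv_mul_cancel_right] at this
        exact hb' (by simpa using hYinv _ this)
      inv_mem' := by
        rintro a ⟨ha, ha'⟩
        exact ⟨inv_mem ha, fun k => ha' (by simpa using hYinv _ k)⟩ }
  have mW : ∀ g, g ∈ W ↔ g ∈ K ∧ g ∉ Y := fun g => Iff.rfl
  let M : Subgroup G :=
    { carrier := {g | g ∈ Z ∨ g ∈ K}
      one_mem' := Or.inr (one_mem K)
      mul_mem' := by
        rintro a b (ha | ha) (hb | hb)
        · by_cases hX' : a * b ∈ X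
          · rcases (mX _).1 hX' with k | k
            · exact Or.inl k
            · exact Or.inr (hYK _ k)
          · exact Or.inr ((hZ1 a ha).1 b hb hX')
        · left; rw [mul_comm]; exact (stZ b hb a).1 ha
        · left; exact (stZ a ha b).1 hb
        · right; exact mul_mem ha hb
      inv_mem' := by
        rintro a (ha | ha)
        · left
          obtain ⟨x, hx, e⟩ := (hZ1 a ha).2 1 (one_mem K)
          rw [inv_eq_of_mul_eq_one_right e]; exact hx
        · exact Or.inr (inv_mem ha) }
  have mM : ∀ g, g ∈ M ↔ g ∈ Z ∨ g ∈ K := fun g => Iff.rfl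
  refine ⟨W, fun g hg => hg.1, fun g => ?_⟩
  rw [show r x0 g ↔ g ∈ X from mem_cls.symm]
  constructor
  · intro hg
    refine ⟨Subgroup.subset_closure hg, fun hW => ?_⟩
    rcases (mX g).1 hg with k | k
    · exact hZK g k hW.1
    · exact hW.2 k
  · rintro ⟨hg, hW⟩
    have hle : Subgroup.closure (X : Set G) ≤ M := by
      rw [Subgroup.closure_le]
      intro u hu
      rcases (mX u).1 hu with k | k
      · exact Or.inl k
      · exact Or.inr (hYK u k)
    rcases hle hg with k | k
    · exact (mX g).2 (Or.inl k)
    · rw [mX]; right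
      by_contra hc
      exact hW ⟨k, hc⟩

end generic

set_option linter.all false

structure DG {G : Type*} [CommGroup G] (n : ℕ) (c : G) (α : G →* Multiplicative (ZMod 3)) : Prop where
  n2 : 2 ≤ n
  c3 : c ^ 3 = 1
  c1 : c ≠ 1
  exp : ∀ g : G, g ^ (3 ^ n) = 1
  sgn : ∀ l, 2 ≤ l → ∀ g : G, g ^ (3 ^ l) = 1 →
    g ^ (3 ^ (l - 1)) = 1 ∨ g ^ (3 ^ (l - 1)) = c ∨ g ^ (3 ^ (l - 1)) = c⁻¹
  αc : α c = 1
  ker : ∀ g : G, g ^ 3 = 1 → α g = 1 → g = 1 ∨ g = c ∨ g = c⁻¹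
  ext : ∃ t : G, t ^ 3 = 1 ∧ α t ≠ 1
  orb : ∀ l, 2 ≤ l → ∀ x y : G, (x ^ (3 ^ (l - 1)) = c ∨ x ^ (3 ^ (l - 1)) = c⁻¹) →
    y ^ (3 ^ (l - 1)) = x ^ (3 ^ (l - 1)) → α x = α y → ∃ m, y = x ^ (1 + 3 * m)

/-- elements of order dividing `3^j` -/
def Om (G : Type*) [CommGroup G] (j : ℕ) : Subgroup G := (powMonoidHom (3 ^ j)).ker

theorem mem_Om {G : Type*} [CommGroup G] {j : ℕ} {x : G} : x ∈ Om G j ↔ x ^ (3 ^ j) = 1 := by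
  simp [Om, MonoidHom.mem_ker]

def Lv {G : Type*} [CommGroup G] (l : ℕ) (x : G) : Prop := x ∈ Om G l ∧ x ∉ Om G (l - 1)

def good {G : Type*} [CommGroup G] (r : G → G → Prop) (c x : G) : Prop :=
  r x (c * x) ∧ r x (c⁻¹ * x)

theorem mz3 (a : Multiplicative (ZMod 3)) : a ^ 3 = 1 := by revert a; decide
theorem mz3_gen (a b : Multiplicative (ZMod 3)) (ha : a ≠ 1) : ∃ s : ℕ, a ^ s = b := by
  have : ∀ a b : Multiplicative (ZMod 3), a ≠ 1 → ∃ s : Fin 3, a ^ (s : ℕ) = b := by decide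
  obtain ⟨s, hs⟩ := this a b ha
  exact ⟨s, hs⟩

section dg
variable {G : Type*} [CommGroup G] [Fintype G] {r : G → G → Prop} {n : ℕ} {c : G}
  {α : G →* Multiplicative (ZMod 3)}

theorem Om_mono {i j : ℕ} (hij : i ≤ j) : Om G i ≤ Om G j := by
  intro x hx
  rw [mem_Om] at *
  obtain ⟨k, rfl⟩ := Nat.exists_eq_add_of_le hij
  rw [pow_add, pow_mul, hx, one_pow]

theorem mem_Om1 {x : G} : x ∈ Om G 1 ↔ x ^ 3 = 1 := by rw [mem_Om, pow_one]

theorem mem_Om0 {x : G} : x ∈ Om G 0 ↔ x = 1 := by rw [mem_Om]; simp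

theorem pow_mem_Om {i j : ℕ} {x : G} : x ^ (3 ^ i) ∈ Om G j ↔ x ∈ Om G (i + j) := by
  rw [mem_Om, mem_Om, ← pow_mul, ← pow_add]

theorem DG.pg (d : DG n c α) : IsPGroup 3 G := fun g => ⟨n, d.exp g⟩

theorem DG.pow_cop (d : DG n c α) {v : ℕ} (hv : ¬ 3 ∣ v) {x : G} (hx : x ^ v = 1) : x = 1 := by
  obtain ⟨m', _, hm⟩ := SR.pow_inv_exists d.pg hv
  rw [← hm x, hx, one_pow]

theorem DG.pow_memi (d : DG n c α) {v : ℕ} (hv : ¬ 3 ∣ v) {x : G} {H : Subgroup G} : x ^ v ∈ H ↔ x ∈ H := by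
  refine ⟨fun hx => ?_, fun hx => H.pow_mem hx v⟩
  obtain ⟨m', _, hm⟩ := SR.pow_inv_exists d.pg hv
  rw [← hm x]; exact H.pow_mem hx _

theorem α_cube (α : G →* Multiplicative (ZMod 3)) (x : G) : α (x ^ 3) = 1 := by rw [map_pow, mz3]

theorem α_pow1 (α : G →* Multiplicative (ZMod 3)) (x : G) (m : ℕ) : α (x ^ (1 + 3 * m)) = α x := by
  rw [pow_add, pow_one, map_mul, pow_mul, map_pow, α_cube, one_pow, mul_one]

theorem α_pow3 (α : G →* Multiplicative (ZMod 3)) (x : G) {j : ℕ} (hj : 1 ≤ j) : α (x ^ (3 ^ j)) = 1 := by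
  obtain ⟨k, rfl⟩ : ∃ k, j = k + 1 := ⟨j - 1, by omega⟩
  rw [pow_succ, pow_mul, α_cube]

theorem DG.cE (d : DG n c α) : c ∈ Om G 1 := mem_Om1.2 d.c3

theorem DG.c2 (d : DG n c α) : c * c = c⁻¹ := by
  rw [eq_inv_iff_mul_eq_one, ← d.c3, pow_succ, pow_two]

theorem DG.ci2 (d : DG n c α) : c⁻¹ * c⁻¹ = c := by
  rw [← mul_inv, d.c2, inv_inv]

theorem DG.ci1 (d : DG n c α) : c⁻¹ ≠ 1 := by simpa using d.c1

theorem DG.cci (d : DG n c α) : c ≠ c⁻¹ := by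
  intro k
  have := d.c2; rw [← k] at this
  exact d.c1 (by simpa using this)

theorem DG.mem_C (d : DG n c α) {x : G} : x ∈ Subgroup.zpowers c ↔ x = 1 ∨ x = c ∨ x = c⁻¹ := by
  constructor
  · intro hx
    have h1 : x ^ 3 = 1 := by
      obtain ⟨k, rfl⟩ := hx
      change (c ^ k) ^ 3 = 1
      rw [← zpow_natCast, zpow_comm, zpow_natCast, d.c3, one_zpow]
    have h2 : α x = 1 := by
      obtain ⟨k, rfl⟩ := hx
      change α (c ^ k) = 1
      rw [map_zpow, d.αc, one_zpow]
    exact d.ker x h1 h2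
  · rintro (rfl | rfl | rfl)
    · exact one_mem _
    · exact Subgroup.mem_zpowers _
    · exact inv_mem (Subgroup.mem_zpowers _)

theorem DG.mem_C' (d : DG n c α) {x : G} : x ∈ Subgroup.zpowers c ↔ x ∈ Om G 1 ∧ α x = 1 := by
  constructor
  · intro hx
    rw [d.mem_C] at hx
    rcases hx with rfl | rfl | rfl
    · exact ⟨one_mem _, map_one _⟩
    · exact ⟨d.cE, d.αc⟩
    · exact ⟨inv_mem d.cE, by rw [map_inv, d.αc, inv_one]⟩
  · rintro ⟨h1, h2⟩
    rw [d.mem_C]; exact d.ker x (mem_Om1.1 h1) h2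

theorem DG.card_C (d : DG n c α) : Nat.card (Subgroup.zpowers c) = 3 := by
  rw [Nat.card_zpowers]
  exact orderOf_eq_prime d.c3 d.c1

theorem DG.exists_Lv (d : DG n c α) {x : G} (hx : x ≠ 1) : ∃ l, 1 ≤ l ∧ l ≤ n ∧ Lv l x := by
  have hex : ∃ l, x ∈ Om G l := ⟨n, mem_Om.2 (d.exp x)⟩
  refine ⟨Nat.find hex, ?_, Nat.find_min' hex (mem_Om.2 (d.exp x)), Nat.find_spec hex, ?_⟩
  · by_contra hc
    have h0 : Nat.find hex = 0 := by omega
    have := Nat.find_spec hex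
    rw [h0, mem_Om0] at this
    exact hx this
  · intro k
    have h1 := Nat.find_min' hex k
    have h2 : Nat.find hex ≠ 0 := by
      intro h0
      have := Nat.find_spec hex
      rw [h0, mem_Om0] at this
      exact hx this
    omega

theorem DG.exists_Lv2 (d : DG n c α) {x : G} (hx : x ∉ Om G 1) : ∃ l, 2 ≤ l ∧ l ≤ n ∧ Lv l x := by
  obtain ⟨l, h1, h2, h3⟩ := d.exists_Lv (x := x) (fun k => hx (k ▸ one_mem _))
  refine ⟨l, ?_, h2, h3⟩
  by_contra hc
  have : l = 1 := by omega
  subst this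
  exact hx h3.1

theorem DG.Lv_pow (d : DG n c α) {l v : ℕ} (hv : ¬ 3 ∣ v) {x : G} (hx : Lv l x) : Lv l (x ^ v) :=
  ⟨(d.pow_memi hv).2 hx.1, fun k => hx.2 ((d.pow_memi hv).1 k)⟩

theorem Lv_inv {l : ℕ} {x : G} (hx : Lv l x) : Lv l x⁻¹ :=
  ⟨inv_mem hx.1, fun k => hx.2 (by simpa using inv_mem k)⟩

theorem Lv_E {l : ℕ} (hl : 2 ≤ l) {x e : G} (hx : Lv l x) (he : e ∈ Om G 1) : Lv l (e * x) :=
  ⟨mul_mem (Om_mono (by omega) he) hx.1, fun k => hx.2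
    ((Subgroup.mul_mem_cancel_left _ (Om_mono (by omega : 1 ≤ l - 1) he)).1 k)⟩

theorem sgn_E {l : ℕ} (hl : 2 ≤ l) {x e : G} (he : e ∈ Om G 1) : (e * x) ^ (3 ^ (l-1)) = x ^ (3 ^ (l-1)) := by
  rw [mul_pow, mem_Om.1 (Om_mono (by omega : 1 ≤ l - 1) he), one_mul]

theorem DG.sg (d : DG n c α) {l : ℕ} (hl : 2 ≤ l) {x : G} (hx : Lv l x) :
    x ^ (3 ^ (l - 1)) = c ∨ x ^ (3 ^ (l - 1)) = c⁻¹ := by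
  rcases d.sgn l hl x (mem_Om.1 hx.1) with k | k | k
  · exact absurd (mem_Om.2 k) hx.2
  · exact Or.inl k
  · exact Or.inr k

theorem DG.sgE (d : DG n c α) {l : ℕ} (hl : 2 ≤ l) {x y : G} (hx : Lv l x) (hy : Lv l y) :
    y ^ (3 ^ (l - 1)) = x ^ (3 ^ (l - 1)) ∨ y ^ (3 ^ (l - 1)) = x⁻¹ ^ (3 ^ (l - 1)) := by
  rw [inv_pow]
  rcases d.sg hl hx with k | k <;> rcases d.sg hl hy with k' | k' <;> rw [k, k'] <;> simp

theorem DG.Lv_lin (d : DG n c α) {l : ℕ} (hl : 2 ≤ l) {x : G} (hx : x ∈ Om G l)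
    (hs : x ^ (3 ^ (l - 1)) ≠ 1) : Lv l x := ⟨hx, fun k => hs (mem_Om.1 k)⟩

theorem DG.adj_same (d : DG n c α) {l : ℕ} (hl : 2 ≤ l) {h x y : G} (hh : h ∈ Om G 1) (hα : α h ≠ 1)
    (hx : Lv l x) (e : y ^ (3 ^ (l - 1)) = x ^ (3 ^ (l - 1))) : ∃ s m : ℕ, α (h ^ s * x) = α y ∧ y = (h ^ s * x) ^ (1 + 3 * m) := by
  obtain ⟨s, hs⟩ := mz3_gen (α h) (α y * (α x)⁻¹) hα
  have ha : α (h ^ s * x) = α y := by rw [map_mul, map_pow, hs]; simp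
  have := d.orb l hl (h ^ s * x) y (by rw [sgn_E hl (Subgroup.pow_mem _ hh s)]; exact d.sg hl hx)
    (by rw [sgn_E hl (Subgroup.pow_mem _ hh s), e]) ha
  obtain ⟨m, hm⟩ := this
  exact ⟨s, m, ha, hm⟩

theorem DG.inv_pow' (d : DG n c α) : ∃ k, ¬ 3 ∣ k ∧ k % 3 = 2 ∧ ∀ x : G, x ^ k = x⁻¹ := by
  have hd : 3 ∣ 3 ^ n := dvd_pow_self 3 (by have := d.n2; omega)
  have h1 : 1 ≤ 3 ^ n := Nat.one_le_pow _ _ (by norm_num)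
  refine ⟨3 ^ n - 1, ?_, ?_, ?_⟩
  · intro k
    omega
  · omega
  · intro x
    rw [eq_inv_iff_mul_eq_one, ← pow_succ, Nat.sub_add_cancel h1, d.exp]

theorem DG.adj (d : DG n c α) {l : ℕ} (hl : 2 ≤ l) {h x y : G} (hh : h ∈ Om G 1) (hα : α h ≠ 1)
    (hx : Lv l x) (hy : Lv l y) : ∃ s k : ℕ, ¬ 3 ∣ k ∧ y = h ^ s * x ^ k := by
  rcases d.sgE hl hx hy with e | e
  · obtain ⟨s, m, _, e⟩ := d.adj_same hl hh hα hx e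
    exact ⟨s * (1 + 3 * m), 1 + 3 * m, by omega, by rw [e, mul_pow, pow_mul]⟩
  · obtain ⟨s, m, _, e⟩ := d.adj_same hl hh hα (Lv_inv hx) e
    obtain ⟨k, hk, _, hki⟩ := d.inv_pow'
    refine ⟨s * (1 + 3 * m), k * (1 + 3 * m), ?_, by rw [e, mul_pow, pow_mul, pow_mul, hki]⟩
    intro hd
    rcases (Nat.Prime.dvd_mul Nat.prime_three).1 hd with h1 | h1
    · exact hk h1
    · omega

theorem DG.Edec (d : DG n c α) {h e : G} (hh : h ∈ Om G 1) (hα : α h ≠ 1) (he : e ∈ Om G 1) :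
    ∃ s : ℕ, ∃ u ∈ Subgroup.zpowers c, e = u * h ^ s := by
  obtain ⟨s, hs⟩ := mz3_gen (α h) (α e) hα
  refine ⟨s, e * (h ^ s)⁻¹, ?_, by simp⟩
  rw [d.mem_C']
  refine ⟨mul_mem he (inv_mem (Subgroup.pow_mem _ hh s)), ?_⟩
  rw [map_mul, map_inv, map_pow, hs, mul_inv_cancel]

theorem DG.one_good (d : DG n c α) (h : SR r) : ¬ good r c 1 := by
  intro k
  have := h.one k.1
  exact d.c1 (by simpa using this)

/-- O1 -/
theorem DG.O1 (d : DG n c α) (h : SR r) {y : G} {m : ℕ} (hy : r y (y ^ (1 + 3 * m)))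
    (hne : y ^ (1 + 3 * m) ≠ y) : good r c y := by
  have key : ∀ j m : ℕ, (y ^ (3 * m)) ^ (3 ^ j) = 1 → y ^ (3 * m) ≠ 1 → r y (y ^ (1 + 3 * m)) → good r c y := by
    intro j
    induction j with
    | zero => intro m h1 h2 _; simp at h1; exact absurd h1 h2
    | succ j ih =>
      intro m h1 h2 h3
      by_cases h4 : (y ^ (3 * m)) ^ 3 = 1
      · have hα : α (y ^ (3 * m)) = 1 := by rw [pow_mul, map_pow, α_cube, one_pow]
        have e1 : y ^ (1 + 3 * m) = y ^ (3 * m) * y := by rw [pow_add, pow_one, mul_comm]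
        have h5 : r y (y ^ ((1 + 3 * m) * (1 + 3 * m))) := by
          have := h.pow d.pg (m := 1 + 3 * m) (by omega) h3
          rw [pow_mul]
          exact h.trans h3 this
        have e2 : y ^ ((1 + 3 * m) * (1 + 3 * m)) = y ^ (3 * m) * y ^ (3 * m) * y := by
          have : (1 + 3 * m) * (1 + 3 * m) = 3 * m + 3 * m + 1 + (3 * m) * 3 * m := by ring
          rw [this, pow_add, pow_mul, pow_mul _ (3*m), h4, one_pow, mul_one, pow_add, pow_add, pow_one]
        rw [e1] at h3
        rw [e2] at h5
        rcases d.ker _ h4 hα with k | k | k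
        · exact absurd k h2
        · rw [k] at h3 h5; rw [d.c2] at h5; exact ⟨h3, h5⟩
        · rw [k] at h3 h5; rw [d.ci2] at h5; exact ⟨h5, h3⟩
      · have e : (1 + 3 * m) * ((1 + 3 * m) * (1 + 3 * m)) = 1 + 3 * (3 * m * (1 + 3 * m + 3 * m * m)) := by ring
        apply ih (3 * m * (1 + 3 * m + 3 * m * m))
        · rw [← mul_assoc, show 3 * (3 * m) = 3 * m * 3 by ring, pow_mul, pow_mul, pow_right_comm, ← pow_mul (y ^ (3 * m)), 
            show 3 * 3 ^ j = 3 ^ (j + 1) by ring, h1, one_pow]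
        · rw [← mul_assoc, show 3 * (3 * m) = 3 * m * 3 by ring, pow_mul, pow_mul]
          intro k
          exact h4 (d.pow_cop (v := 1 + 3 * m + 3 * m * m) (by rw [mul_assoc 3 m m]; omega) k)
        · rw [← e, pow_mul, pow_mul]
          have h5 := h.pow d.pg (m := 1 + 3 * m) (by omega) h3
          have h6 := h.pow d.pg (m := 1 + 3 * m) (by omega) h5
          exact h.trans h3 (h.trans h5 h6)
  refine key n m ?_ ?_ hy
  · exact d.exp _
  · intro k
    apply hne
    rw [pow_add, k, mul_one, pow_one]

/-- O2 -/
theorem DG.O2 (d : DG n c α) (h : SR r) {z y : G} {j : ℕ} (hj : 1 ≤ j) (hz : z ∈ Om G j) (hy : y ∉ Om G j)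
    (hzy : r z y) : good r c y := by
  have e : 1 + 3 * 3 ^ (j - 1) = 1 + 3 ^ j := by
    obtain ⟨k, rfl⟩ : ∃ k, j = k + 1 := ⟨j - 1, by omega⟩
    simp [pow_succ]; ring
  apply d.O1 h (m := 3 ^ (j - 1))
  · have := h.pow d.pg (m := 1 + 3 * 3 ^ (j - 1)) (by omega) hzy
    rw [e, pow_add z, mem_Om.1 hz, mul_one, pow_one] at this
    rw [e]
    exact h.trans (h.symm hzy) this
  · rw [e, pow_add, pow_one]
    intro k
    exact hy (mem_Om.2 (by simpa using k))

theorem DG.bad_min (d : DG n c α) (h : SR r) {z y : G} {l : ℕ} (hl : 2 ≤ l) (hz : ¬ good r c z) (hzl : Lv l z)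
    (hzy : r z y) (hy : y ∈ Om G l) : Lv l y :=
  ⟨hy, fun k => hz (d.O2 h (j := l - 1) (by omega) k hzl.2 (h.symm hzy))⟩

theorem Lv_pow_eq {l : ℕ} (hl : 1 ≤ l) {z y : G} (hz : Lv l z) (hy : y ∈ Om G l) {m : ℕ} (e : z ^ m = 1) : y ^ m = 1 := by
  have h1 : orderOf z = 3 ^ l := by
    obtain ⟨k, rfl⟩ : ∃ k, l = k + 1 := ⟨l - 1, by omega⟩
    haveI : Fact (Nat.Prime 3) := ⟨Nat.prime_three⟩
    exact orderOf_eq_prime_pow (fun k => hz.2 (mem_Om.2 k)) (mem_Om.1 hz.1)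
  have h2 : 3 ^ l ∣ m := by rw [← h1]; exact orderOf_dvd_of_pow_eq_one e
  obtain ⟨k, rfl⟩ := h2
  rw [pow_mul, mem_Om.1 hy, one_pow]

theorem DG.bad_pow (d : DG n c α) (h : SR r) {z y : G} {l m : ℕ} (hl : 2 ≤ l) (hz : ¬ good r c z) (hzl : Lv l z)
    (hzy : r z y) (hy : y ∈ Om G l) (k : r y (y ^ (1 + 3 * m))) : y ^ (1 + 3 * m) = y := by
  have h1 : r z (z ^ (1 + 3 * m)) :=
    h.trans hzy (h.trans k (h.symm (h.pow d.pg (by omega) hzy)))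
  have h2 : z ^ (1 + 3 * m) = z := by
    by_contra hne
    exact hz (d.O1 h h1 hne)
  have h3 : z ^ (3 * m) = 1 := by
    rw [pow_add, pow_one] at h2; simpa using h2
  rw [pow_add, Lv_pow_eq (by omega) hzl hy h3, pow_one, mul_one]

/-- O3 : elements of minimal level in a bad class are determined by sign and `α` -/
theorem DG.bad_det (d : DG n c α) (h : SR r) {z y y' : G} {l : ℕ} (hl : 2 ≤ l) (hz : ¬ good r c z) (hzl : Lv l z)
    (hy : r z y) (hyl : y ∈ Om G l) (hy' : r z y') (hs : y' ^ (3 ^ (l - 1)) = y ^ (3 ^ (l - 1)))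
    (ha : α y = α y') : y' = y := by
  obtain ⟨m, rfl⟩ := d.orb l hl y y' (d.sg hl (d.bad_min h hl hz hzl hy hyl)) hs ha
  exact d.bad_pow h hl hz hzl hy hyl (h.trans (h.symm hy) hy')

end dg

set_option linter.all false

def thin {G : Type*} [CommGroup G] (r : G → G → Prop) (c : G) (l : ℕ) (z : G) : Prop :=
  2 ≤ l ∧ Lv l z ∧ ¬ good r c z ∧ ∀ y, r z y → y ∈ Om G l

noncomputable def hull {G : Type*} [CommGroup G] [Fintype G] (r : G → G → Prop) (c : G) : Subgroup G :=
  Subgroup.closure (cls r c : Set G)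

section dg
variable {G : Type*} [CommGroup G] [Fintype G] {r : G → G → Prop} {n : ℕ} {c : G}
  {α : G →* Multiplicative (ZMod 3)}

theorem card_le3 (α : G →* Multiplicative (ZMod 3)) (D : Finset G)
    (hD : ∀ x ∈ D, ∀ y ∈ D, α x = α y → x = y) : D.card ≤ 3 := by
  have : D.card ≤ (Finset.univ : Finset (Multiplicative (ZMod 3))).card :=
    Finset.card_le_card_of_injOn α (fun _ _ => Finset.mem_univ _) (fun x hx y hy e => hD x hx y hy e)
  have e : (Finset.univ : Finset (Multiplicative (ZMod 3))).card = 3 := by decide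
  omega

theorem DG.three_le (d : DG n c α) (D : Finset G) {x : G} (h1 : x ∈ D) (h2 : c * x ∈ D) (h3 : c⁻¹ * x ∈ D) :
    3 ≤ D.card := by
  have : ({x, c * x, c⁻¹ * x} : Finset G).card = 3 := by
    rw [Finset.card_eq_three]
    refine ⟨x, c * x, c⁻¹ * x, ?_, ?_, ?_, rfl⟩
    · intro k; exact d.c1 (by simpa using k.symm)
    · intro k; exact d.ci1 (by simpa using k.symm)
    · intro k; exact d.cci (by simpa using k)
  rw [← this]
  apply Finset.card_le_card
  intro y hy
  simp only [Finset.mem_insert, Finset.mem_singleton] at hy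
  rcases hy with rfl | rfl | rfl <;> assumption

theorem DG.RC_hull (d : DG n c α) (h : SR r) : RC r (hull r c) :=
  h.RC_closure (fun x y hxy hx => h.AS_cls c x y hxy hx)

theorem DG.c_hull (d : DG n c α) (h : SR r) : c ∈ hull r c := Subgroup.subset_closure (h.self_mem c)

theorem DG.hull_le (d : DG n c α) {H : Subgroup G} (hH : RC r H) (hc : c ∈ H) : hull r c ≤ H :=
  SR.hull_le hH hc

theorem DG.C_le (d : DG n c α) {H : Subgroup G} (hc : c ∈ H) : Subgroup.zpowers c ≤ H := by
  rw [Subgroup.zpowers_le]; exact hc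

theorem DG.E_le (d : DG n c α) {H : Subgroup G} (hc : c ∈ H) {q : G} (hq : q ∈ H) (hqE : q ∈ Om G 1)
    (hα : α q ≠ 1) : Om G 1 ≤ H := by
  intro e he
  obtain ⟨s, u, hu, rfl⟩ := d.Edec hqE hα he
  exact mul_mem (d.C_le hc hu) (H.pow_mem hq s)

theorem DG.good_Rad (d : DG n c α) (h : SR r) {z : G} (hz : ∀ y, r z y → good r c y) : hull r c ≤ Rad r z := by
  apply d.hull_le (h.RC_Rad z)
  apply mem_Rad_of
  intro y hy
  exact h.trans hy (hz y hy).1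

theorem DG.good_of_Rad (d : DG n c α) (h : SR r) {z : G} (hz : c ∈ Rad r z) : good r c z :=
  ⟨h.mem_Rad' hz, h.mem_Rad' (inv_mem hz)⟩

/-- hull classification -/
theorem DG.hull_cases (d : DG n c α) (h : SR r) :
    (∀ y, r c y → y ∈ Om G 1) ∨
    ∃ W : Subgroup G, W ≤ Subgroup.closure {y | r c y ∧ y ∈ Om G 1} ∧
      ∀ g, r c g ↔ g ∈ hull r c ∧ g ∉ W := by
  by_cases hT : ∀ y, r c y → y ∈ Om G 1
  · exact Or.inl hT
  right
  push Not at hT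
  have hc1 : ¬ r c 1 := fun k => d.c1 (h.one' k)
  have hg : ∀ z, r c z → z ∉ Om G 1 → r c (c * z) ∧ r c (c⁻¹ * z) := by
    intro z hz hzE
    have := d.O2 h (le_refl 1) d.cE hzE hz
    exact ⟨h.trans hz this.1, h.trans hz this.2⟩
  apply h.separation (Om G 1) hc1 ⟨c, h.refl c, d.cE⟩ hT
  intro q hq hqE z hz hzE
  by_cases hα : α q = 1
  · rcases d.ker q (mem_Om1.1 hqE) hα with rfl | rfl | rfl
    · exact absurd hq hc1
    · exact (hg z hz hzE).1
    · exact (hg z hz hzE).2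
  -- hard case
  by_contra hqz
  set T := cls r c with hTd
  set T' := T.filter (· ∉ Om G 1) with hT'
  set Q := T.filter (· ∈ Om G 1) with hQ
  have split : ∀ g ∈ Om G 1, (T.filter (fun x => g * x ∉ T)).card =
      (T'.filter (fun x => g * x ∉ T)).card + (Q.filter (fun x => g * x ∉ Q)).card := by
    intro g hgE
    rw [← Finset.card_filter_add_card_filter_not (s := T.filter (fun x => g * x ∉ T)) (fun x => x ∉ Om G 1)]
    congr 1
    · congr 1; ext x; simp only [hT', Finset.mem_filter]; tauto
    · congr 1; ext x; simp only [hQ, Finset.mem_filter, Subgroup.mul_mem_cancel_left _ hgE]; tauto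
  have e1 : ((T'.filter (fun x => c * x ∉ T)).card) = 0 := by
    rw [Finset.card_eq_zero, Finset.filter_eq_empty_iff]
    intro x hx
    simp only [hT', Finset.mem_filter, hTd, mem_cls] at hx
    simp only [hTd, mem_cls, not_not]
    exact (hg x hx.1 hx.2).1
  have e2 : (Q.filter (fun x => c * x ∉ Q)).card ≤ 3 := by
    apply card_le3 α
    intro x hx y hy e
    simp only [Finset.mem_filter] at hx hy
    have hxE : x ∈ Om G 1 := by have := hx.1; simp only [hQ, Finset.mem_filter] at this; exact this.2
    have hyE : y ∈ Om G 1 := by have := hy.1; simp only [hQ, Finset.mem_filter] at this; exact this.2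
    have h1 := d.mem_C.1 ((d.mem_C' (x := y * x⁻¹)).2 ⟨mul_mem hyE (inv_mem hxE), by rw [map_mul, map_inv, e, mul_inv_cancel]⟩)
    rcases h1 with k | k | k
    · exact (mul_inv_eq_one.1 k).symm
    · rw [mul_inv_eq_iff_eq_mul] at k; exact absurd (k ▸ hy.1) hx.2
    · rw [mul_inv_eq_iff_eq_mul] at k; exfalso; apply hy.2; rw [k]; simpa using hx.1
  have e3 : 1 ≤ (Q.filter (fun x => q * x ∉ Q)).card := by
    rw [Nat.one_le_iff_ne_zero, Ne, Finset.card_eq_zero, Finset.filter_eq_empty_iff]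
    intro hne
    push Not at hne
    have hqQ : q ∈ Q := by simp [hQ, hTd, mem_cls, hq, hqE]
    have h1 : q ∈ stab Q := mem_stab_of (fun y hy => hne hy)
    have h2 := mem_stab.1 ((stab Q).inv_mem h1) q
    rw [inv_mul_cancel] at h2
    have := h2.1 hqQ
    simp only [hQ, hTd, Finset.mem_filter, mem_cls] at this
    exact hc1 this.1
  have e4 : 3 ≤ (T'.filter (fun x => q * x ∉ T)).card := by
    have inv : ∀ x, r c x → x ∉ Om G 1 → ¬ r c (q * x) → ∀ u, (u = c ∨ u = c⁻¹) →
        u * x ∈ T'.filter (fun x => q * x ∉ T) := by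
      intro x hx hxE hqx u hu
      have huE : u ∈ Om G 1 := by rcases hu with rfl | rfl; exacts [d.cE, inv_mem d.cE]
      have hux : r c (u * x) := by rcases hu with rfl | rfl; exacts [(hg x hx hxE).1, (hg x hx hxE).2]
      simp only [hT', hTd, Finset.mem_filter, mem_cls, Subgroup.mul_mem_cancel_left _ huE]
      refine ⟨⟨hux, hxE⟩, fun k => hqx ?_⟩
      rw [mul_left_comm] at k
      have hqxE : u * (q * x) ∉ Om G 1 := by
        rwa [Subgroup.mul_mem_cancel_left _ huE, Subgroup.mul_mem_cancel_left _ hqE]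
      have := hg _ k hqxE
      rcases hu with rfl | rfl
      · simpa using this.2
      · simpa using this.1
    apply d.three_le _ (x := z)
    · simp only [hT', hTd, Finset.mem_filter, mem_cls]; exact ⟨⟨hz, hzE⟩, hqz⟩
    · exact inv z hz hzE hqz c (Or.inl rfl)
    · exact inv z hz hzE hqz c⁻¹ (Or.inr rfl)
  have s1 := split c d.cE
  have s2 := split q hqE
  have c1 := card_sub_ov T c
  have c2 := card_sub_ov T q
  have c3 := h.ov_eq (h.AS_cls c) hq
  rw [← hTd] at c3
  omega

theorem DG.card_sign (d : DG n c α) (h : SR r) {z : G} {l : ℕ} (hl : 2 ≤ l) (hz : ¬ good r c z) (hzl : Lv l z)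
    (D : Finset G) (hD : ∀ x ∈ D, r z x ∧ x ∈ Om G l) (hs : ∀ x ∈ D, ∀ y ∈ D, y ^ (3 ^ (l - 1)) = x ^ (3 ^ (l - 1))) :
    D.card ≤ 3 := by
  apply card_le3 α
  intro x hx y hy e
  exact (d.bad_det h hl hz hzl (hD x hx).1 (hD x hx).2 (hD y hy).1 (hs x hx y hy) e).symm

theorem DG.card_six (d : DG n c α) (h : SR r) {z : G} {l : ℕ} (hl : 2 ≤ l) (hz : ¬ good r c z) (hzl : Lv l z)
    (D : Finset G) (hD : ∀ x ∈ D, r z x ∧ x ∈ Om G l) : D.card ≤ 6 := by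
  rw [← Finset.card_filter_add_card_filter_not (s := D) (fun x => x ^ (3 ^ (l - 1)) = c)]
  have hsg : ∀ x ∈ D, x ^ (3 ^ (l - 1)) = c ∨ x ^ (3 ^ (l - 1)) = c⁻¹ := fun x hx =>
    d.sg hl (d.bad_min h hl hz hzl (hD x hx).1 (hD x hx).2)
  have h1 := d.card_sign h hl hz hzl (D.filter (fun x => x ^ (3 ^ (l - 1)) = c))
    (fun x hx => hD x (Finset.mem_filter.1 hx).1)
    (fun x hx y hy => by rw [(Finset.mem_filter.1 hx).2, (Finset.mem_filter.1 hy).2])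
  have h2 := d.card_sign h hl hz hzl (D.filter (fun x => ¬ x ^ (3 ^ (l - 1)) = c))
    (fun x hx => hD x (Finset.mem_filter.1 hx).1)
    (fun x hx y hy => by
      have hx := Finset.mem_filter.1 hx
      have hy := Finset.mem_filter.1 hy
      rw [(hsg x hx.1).resolve_left hx.2, (hsg y hy.1).resolve_left hy.2])
  omega

/-- a bad element of level at least two is not related to its `c`-translates -/
theorem DG.bad_c (d : DG n c α) (h : SR r) {z y : G} {l : ℕ} (hl : 2 ≤ l) (hz : ¬ good r c z) (hzl : Lv l z)
    (hy : r z y) (hyl : y ∈ Om G l) {u : G} (hu : u ∈ Subgroup.zpowers c) (hc : r z (u * y)) : u = 1 := by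
  have hu' := d.mem_C'.1 hu
  have := d.bad_det h hl hz hzl hy hyl hc (sgn_E hl hu'.1) (by rw [map_mul, hu'.2, one_mul])
  simpa using this

theorem DG.thin_rel (d : DG n c α) (h : SR r) {z y : G} {l : ℕ} (hz : thin r c l z) (hy : r z y) : thin r c l y := by
  obtain ⟨hl, hzl, hb, hall⟩ := hz
  refine ⟨hl, d.bad_min h hl hb hzl hy (hall y hy), fun hg => ?_, fun x hx => hall x (h.trans hy hx)⟩
  exact d.c1 (d.bad_c h hl hb hzl hy (hall y hy) (Subgroup.mem_zpowers c) (h.trans hy hg.1))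

theorem DG.good_iff_cc (d : DG n c α) (h : SR r) (z y : G) (hzy : r z y) :
    good r c y ↔ 3 ≤ cc (cls r z) (Subgroup.zpowers c) y := by
  constructor
  · intro hg
    apply d.three_le _ (x := y)
    · simp only [Finset.mem_filter, mem_cls]; exact ⟨hzy, by simp⟩
    · simp only [Finset.mem_filter, mem_cls]; exact ⟨h.trans hzy hg.1, by simp⟩
    · simp only [Finset.mem_filter, mem_cls]; exact ⟨h.trans hzy hg.2, by simp⟩
  · intro h3
    by_contra hg
    have hsub : (cls r z).filter (fun x => x⁻¹ * y ∈ Subgroup.zpowers c) ⊆ {y, c * y, c⁻¹ * y} := by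
      intro x hx
      simp only [Finset.mem_filter, mem_cls] at hx
      simp only [Finset.mem_insert, Finset.mem_singleton]
      rcases d.mem_C.1 hx.2 with k | k | k
      · left; exact inv_mul_eq_one.1 k
      · right; right; rw [inv_mul_eq_iff_eq_mul] at k; rw [k, mul_comm x]; simp
      · right; left; rw [inv_mul_eq_iff_eq_mul] at k; rw [k, mul_comm x]; simp
    have h4 : (cls r z).filter (fun x => x⁻¹ * y ∈ Subgroup.zpowers c) = {y, c * y, c⁻¹ * y} :=
      Finset.eq_of_subset_of_card_le hsub (le_trans Finset.card_le_three h3)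
    apply hg
    have m1 : c * y ∈ ({y, c * y, c⁻¹ * y} : Finset G) := by simp
    have m2 : c⁻¹ * y ∈ ({y, c * y, c⁻¹ * y} : Finset G) := by simp
    rw [← h4] at m1 m2
    simp only [Finset.mem_filter, mem_cls] at m1 m2
    exact ⟨h.trans (h.symm hzy) m1.1, h.trans (h.symm hzy) m2.1⟩

theorem DG.good_rel (d : DG n c α) (h : SR r) (hC : RC r (Subgroup.zpowers c)) {z y : G} (hzy : r z y) :
    good r c z ↔ good r c y := by
  rw [d.good_iff_cc h z z (h.refl z), d.good_iff_cc h z y hzy, h.cc_eq (h.AS_cls z) hC hzy]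

theorem DG.hullA (d : DG n c α) (h : SR r) (hA : ∀ y, r c y → y ∈ Om G 1) :
    hull r c = Subgroup.zpowers c ∨ (hull r c = Om G 1 ∧ ∃ g, r c g ∧ g ∈ Om G 1 ∧ α g ≠ 1) := by
  by_cases hex : ∃ g, r c g ∧ α g ≠ 1
  · right
    obtain ⟨g, hg, ha⟩ := hex
    refine ⟨le_antisymm ?_ ?_, g, hg, hA g hg, ha⟩
    · rw [hull, Subgroup.closure_le]; intro x hx; exact hA x (mem_cls.1 hx)
    · exact d.E_le (d.c_hull h) (Subgroup.subset_closure (mem_cls.2 hg)) (hA g hg) ha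
  · left
    push Not at hex
    apply le_antisymm
    · rw [hull, Subgroup.closure_le]; intro x hx
      exact d.mem_C'.2 ⟨hA x (mem_cls.1 hx), hex x (mem_cls.1 hx)⟩
    · exact d.C_le (d.c_hull h)

/-- dichotomy in case (A) -/
theorem DG.dich (d : DG n c α) (h : SR r) (hA : ∀ y, r c y → y ∈ Om G 1) {z : G} (hzE : z ∉ Om G 1) :
    (∃ l, l ≤ n ∧ thin r c l z) ∨ hull r c ≤ Rad r z := by
  by_cases hgood : ∀ y, r z y → good r c y
  · exact Or.inr (d.good_Rad h hgood)
  left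
  push Not at hgood
  obtain ⟨y0, hy0, hb⟩ := hgood
  rcases d.hullA h hA with hV | ⟨hV, g, hg, hgE, hga⟩
  · have hC : RC r (Subgroup.zpowers c) := hV ▸ d.RC_hull h
    have hzb : ¬ good r c z := fun k => hb ((d.good_rel h hC hy0).1 k)
    obtain ⟨l, hl, hln, hzl⟩ := d.exists_Lv2 hzE
    refine ⟨l, hln, hl, hzl, hzb, fun y hy => ?_⟩
    by_contra hyl
    exact hzb ((d.good_rel h hC hy).2 (d.O2 h (by omega) hzl.1 hyl hy))
  · have hE : RC r (Om G 1) := hV ▸ d.RC_hull h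
    have hy0E : y0 ∉ Om G 1 := fun k => hzE (hE _ _ (h.symm hy0) k)
    obtain ⟨j, hj, hjn, hjl⟩ := d.exists_Lv2 hy0E
    suffices hth : thin r c j y0 from ⟨j, hjn, d.thin_rel h hth (h.symm hy0)⟩
    refine ⟨hj, hjl, hb, ?_⟩
    by_contra hex
    push Not at hex
    obtain ⟨y, hy, hyj⟩ := hex
    have hgy : ∀ x, r y0 x → x ∉ Om G j → good r c x := fun x hx hxj => d.O2 h (by omega) hjl.1 hxj hx
    set Z := cls r y0 with hZ
    -- coset counts
    have hm : cc Z (Om G 1) y0 ≤ 3 := by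
      apply d.card_sign h hj hb hjl
      · intro x hx
        simp only [Finset.mem_filter, hZ, mem_cls] at hx
        refine ⟨hx.1, ?_⟩
        have := mul_mem hjl.1 (inv_mem (Om_mono (by omega : 1 ≤ j) hx.2))
        simpa using this
      · intro x hx y hy
        simp only [Finset.mem_filter, hZ, mem_cls] at hx hy
        have ex : x = (x⁻¹ * y0)⁻¹ * y0 := by simp
        have ey : y = (y⁻¹ * y0)⁻¹ * y0 := by simp
        rw [ex, ey, sgn_E hj (inv_mem hx.2), sgn_E hj (inv_mem hy.2)]
    have hcc : ∀ x, r y0 x → cc Z (Om G 1) x ≤ 3 := fun x hx => by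
      rw [← h.cc_eq (h.AS_cls y0) hE hx]; exact hm
    have hcos : ∀ x, r y0 x → x ∉ Om G j → Z.filter (fun w => w⁻¹ * x ∈ Om G 1) = {x, c * x, c⁻¹ * x} ∧
        (Z.filter (fun w => w⁻¹ * x ∈ Om G 1)).card = 3 := by
      intro x hx hxj
      have hgx := hgy x hx hxj
      have hsub : {x, c * x, c⁻¹ * x} ⊆ Z.filter (fun w => w⁻¹ * x ∈ Om G 1) := by
        intro w hw
        simp only [Finset.mem_insert, Finset.mem_singleton] at hw
        simp only [Finset.mem_filter, hZ, mem_cls]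
        rcases hw with rfl | rfl | rfl
        · exact ⟨hx, by simp⟩
        · exact ⟨h.trans hx hgx.1, by simpa using inv_mem d.cE⟩
        · exact ⟨h.trans hx hgx.2, by simpa using d.cE⟩
      have h3 : 3 ≤ ({x, c * x, c⁻¹ * x} : Finset G).card := d.three_le _ (x := x) (by simp) (by simp) (by simp)
      have h4 : (Z.filter (fun w => w⁻¹ * x ∈ Om G 1)).card ≤ 3 := hcc x hx
      have h5 := Finset.eq_of_subset_of_card_le hsub (le_trans h4 h3)
      refine ⟨h5.symm, ?_⟩
      have := Finset.card_le_card hsub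
      omega
    set N := Z.filter (· ∉ Om G j) with hN
    have ov1 : N.card ≤ ov Z c := by
      apply Finset.card_le_card
      intro x hx
      simp only [hN, Finset.mem_filter, hZ, mem_cls] at hx ⊢
      exact ⟨hx.1, h.trans hx.1 (hgy x hx.1 hx.2).1⟩
    have ov2 : ov Z g ≤ 6 := by
      apply d.card_six h hj hb hjl
      intro x hx
      simp only [Finset.mem_filter, hZ, mem_cls] at hx
      refine ⟨hx.1, ?_⟩
      by_contra hxj
      have : g * x ∈ Z.filter (fun w => w⁻¹ * x ∈ Om G 1) := by
        simp only [Finset.mem_filter, hZ, mem_cls]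
        exact ⟨hx.2, by simpa using inv_mem hgE⟩
      rw [(hcos x hx.1 hxj).1] at this
      simp only [Finset.mem_insert, Finset.mem_singleton] at this
      have hgC : g = 1 ∨ g = c ∨ g = c⁻¹ := by simpa using this
      exact hga (d.mem_C'.1 (d.mem_C.2 hgC)).2
    have ov3 := h.ov_eq (h.AS_cls y0) hg
    rw [← hZ] at ov3
    -- multipliers
    have hmul : ∀ k : ℕ, ¬ 3 ∣ k → y0 ^ k * y0⁻¹ ∈ Om G 1 → ∃ x, r y0 x ∧ x⁻¹ * y ^ k ∈ Om G 1 := by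
      intro k hk hkE
      have h1 : r (y0 ^ k) (y ^ k) := h.pow d.pg hk hy
      have h2 : r ((y0 ^ k * y0⁻¹) * y0) (y ^ k) := by simpa using h1
      obtain ⟨a, b, ha, hb', e⟩ := h.prod_mem h2
      refine ⟨b, hb', ?_⟩
      rw [← e, mul_comm a, inv_mul_cancel_left]
      exact hE _ _ ha hkE
    have hyp : ∀ v : ℕ, ¬ 3 ∣ v → y ^ (3 ^ (j - 1) * v) ∉ Om G 1 := by
      intro v hv k
      rw [pow_mul, d.pow_memi hv, pow_mem_Om] at k
      rw [show j - 1 + 1 = j by omega] at k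
      exact hyj k
    have hy0p : ∀ v : ℕ, y0 ^ (3 ^ (j - 1) * v) ∈ Om G 1 := by
      intro v
      rw [pow_mul]
      apply Subgroup.pow_mem
      rw [pow_mem_Om, show j - 1 + 1 = j by omega]; exact hjl.1
    have h3j : 3 ∣ 3 ^ (j - 1) := dvd_pow_self 3 (by omega)
    obtain ⟨y1, hy1, hy1E⟩ := hmul (1 + 3 ^ (j - 1) * 1) (by omega) (by
      rw [pow_add, pow_one, mul_comm y0, mul_inv_cancel_right]; exact hy0p 1)
    obtain ⟨y2, hy2, hy2E⟩ := hmul (1 + 3 ^ (j - 1) * 2) (by omega) (by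
      rw [pow_add, pow_one, mul_comm y0, mul_inv_cancel_right]; exact hy0p 2)
    have nin : ∀ (v : ℕ) (x : G), x⁻¹ * y ^ (1 + 3 ^ (j - 1) * v) ∈ Om G 1 → x ∉ Om G j := by
      intro v x hx hxj
      have := mul_mem hxj (Om_mono (by omega : 1 ≤ j) hx)
      rw [mul_inv_cancel_left, d.pow_memi (by
        intro hd
        have : 3 ∣ 3 ^ (j-1) * v := Dvd.dvd.mul_right h3j v
        omega)] at this
      exact hyj this
    have n1 := nin 1 y1 hy1E
    have n2 := nin 2 y2 hy2E
    set F0 := Z.filter (fun w => w⁻¹ * y ∈ Om G 1) with hF0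
    set F1 := Z.filter (fun w => w⁻¹ * y1 ∈ Om G 1) with hF1
    set F2 := Z.filter (fun w => w⁻¹ * y2 ∈ Om G 1) with hF2
    have c0 : F0.card = 3 := (hcos y hy hyj).2
    have c1 : F1.card = 3 := (hcos y1 hy1 n1).2
    have c2 : F2.card = 3 := (hcos y2 hy2 n2).2
    have dis : ∀ a b : G, a⁻¹ * b ∉ Om G 1 → Disjoint (Z.filter (fun w => w⁻¹ * a ∈ Om G 1)) (Z.filter (fun w => w⁻¹ * b ∈ Om G 1)) := by
      intro a b hab
      rw [Finset.disjoint_left]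
      intro w hw hw'
      simp only [Finset.mem_filter] at hw hw'
      apply hab
      have := mul_mem (inv_mem hw.2) hw'.2
      simpa using this
    have e01 : y⁻¹ * y1 ∉ Om G 1 := by
      intro k
      have := mul_mem k hy1E
      rw [mul_assoc, mul_inv_cancel_left, pow_add, pow_one, inv_mul_cancel_left] at this
      exact hyp 1 (by norm_num) this
    have e02 : y⁻¹ * y2 ∉ Om G 1 := by
      intro k
      have := mul_mem k hy2E
      rw [mul_assoc, mul_inv_cancel_left, pow_add, pow_one, inv_mul_cancel_left] at this
      exact hyp 2 (by norm_num) this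
    have e12 : y1⁻¹ * y2 ∉ Om G 1 := by
      intro k
      have h1 := mul_mem k hy2E
      have h2 := mul_mem (inv_mem hy1E) h1
      have e : (y1⁻¹ * y ^ (1 + 3 ^ (j - 1) * 1))⁻¹ * (y1⁻¹ * y2 * (y2⁻¹ * y ^ (1 + 3 ^ (j - 1) * 2))) = y ^ (3 ^ (j - 1) * 1) := by
        rw [mul_assoc y1⁻¹, mul_inv_cancel_left, mul_inv, inv_inv, mul_comm y1, mul_assoc, mul_inv_cancel_left,
          inv_mul_eq_iff_eq_mul, ← pow_add]
        congr 1; ring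
      rw [e] at h2
      exact hyp 1 (by norm_num) h2
    have hsubN : (F0 ∪ F1) ∪ F2 ⊆ N := by
      intro w hw
      have aux : ∀ a, a ∉ Om G j → w ∈ Z.filter (fun w => w⁻¹ * a ∈ Om G 1) → w ∈ N := by
        intro a ha hw
        simp only [Finset.mem_filter, hN] at hw ⊢
        refine ⟨hw.1, fun k => ha ?_⟩
        have := mul_mem k (Om_mono (by omega : 1 ≤ j) hw.2)
        simpa using this
      rcases Finset.mem_union.1 hw with hw | hw
      · rcases Finset.mem_union.1 hw with hw | hw
        · exact aux y hyj hw
        · exact aux y1 n1 hw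
      · exact aux y2 n2 hw
    have hcard := Finset.card_le_card hsubN
    rw [Finset.card_union_of_disjoint (Finset.disjoint_union_left.2 ⟨dis _ _ e02, dis _ _ e12⟩),
      Finset.card_union_of_disjoint (dis _ _ e01), c0, c1, c2] at hcard
    omega

end dg

set_option linter.all false

def Goal {G : Type*} [CommGroup G] [Fintype G] (r : G → G → Prop) : Prop :=
  ∃ L U : Subgroup G, RC r L ∧ RC r U ∧ L ≤ U ∧ L ≠ ⊥ ∧ U ≠ ⊤ ∧
    (∀ x, x ∉ U → ∀ l ∈ L, r x (l * x)) ∧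
    (Nat.card U = Nat.card L ∨ Nat.card U = 3 * Nat.card L ∨
      ((∀ x ∈ U, orderOf x = Monoid.exponent U → ∀ g ∈ Rad r x, g = 1) ∧ Nat.card L = 3))

section dg
variable {G : Type*} [CommGroup G] [Fintype G] {r : G → G → Prop} {n : ℕ} {c : G}
  {α : G →* Multiplicative (ZMod 3)}

theorem exp_Lv {U : Subgroup G} {i : ℕ} (hi : 1 ≤ i) (hU : U ≤ Om G i) {x y : G} (hy : y ∈ U) (hyl : Lv i y) (hx : x ∈ U)
    (e : orderOf x = Monoid.exponent U) : Lv i x := by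
  refine ⟨hU hx, fun k => hyl.2 ?_⟩
  have h1 : orderOf x ∣ 3 ^ (i - 1) := orderOf_dvd_of_pow_eq_one (mem_Om.1 k)
  rw [e] at h1
  have h2 := Monoid.pow_exponent_eq_one (⟨y, hy⟩ : U)
  have h3 : y ^ Monoid.exponent U = 1 := by simpa using congrArg Subtype.val h2
  obtain ⟨t, ht⟩ := h1
  rw [mem_Om, ht, pow_mul, h3, one_pow]

theorem DG.order3 (d : DG n c α) {K : Subgroup G} {g : G} (hg : g ∈ K) (hg1 : g ≠ 1) :
    ∃ g' ∈ K, g' ≠ 1 ∧ g' ∈ Om G 1 := by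
  obtain ⟨l, h1, h2, h3⟩ := d.exists_Lv hg1
  refine ⟨g ^ (3 ^ (l - 1)), K.pow_mem hg _, fun k => h3.2 (mem_Om.2 k), ?_⟩
  rw [pow_mem_Om, show l - 1 + 1 = l by omega]; exact h3.1

theorem gen3 {h g : G} (hh : h ^ 3 = 1) (hg : g ∈ Subgroup.zpowers h) (hg1 : g ≠ 1) : h ∈ Subgroup.zpowers g := by
  have h0 : h ≠ 1 := by
    rintro rfl; simp at hg; exact hg1 hg
  have ho : orderOf h = 3 := orderOf_eq_prime hh h0
  obtain ⟨k, hk, rfl⟩ := (mem_powers_iff_mem_range_orderOf (x := h)).1 (mem_powers_iff_mem_zpowers.2 hg) |> Finset.mem_image.1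
  rw [ho, Finset.mem_range] at hk
  interval_cases k
  · simp at hg1
  · simp
  · refine ⟨2, ?_⟩
    change (h ^ 2) ^ (2 : ℤ) = h
    have : (h ^ 2) ^ (2 : ℤ) = h ^ 3 * h := by group
    rw [this, hh, one_mul]

theorem card3 {h : G} (hh : h ^ 3 = 1) (h1 : h ≠ 1) : Nat.card (Subgroup.zpowers h) = 3 := by
  rw [Nat.card_zpowers]; exact orderOf_eq_prime hh h1

theorem α_ne {h : G} (ha : α h ≠ 1) : h ≠ 1 := by rintro rfl; simp at ha

theorem DG.card_E (d : DG n c α) : Nat.card (Om G 1) = 9 := by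
  let β : Om G 1 →* Multiplicative (ZMod 3) := α.comp (Om G 1).subtype
  have hk : β.ker = (Subgroup.zpowers c).subgroupOf (Om G 1) := by
    ext x
    rw [MonoidHom.mem_ker, Subgroup.mem_subgroupOf, d.mem_C']
    simp [β]
  have h1 := Subgroup.card_mul_index β.ker
  have h2 : Nat.card β.ker = 3 := by
    rw [hk, Nat.card_congr (Subgroup.subgroupOfEquivOfLe (d.C_le d.cE)).toEquiv, d.card_C]
  have h3 : β.ker.index = 3 := by
    rw [Subgroup.index_ker]
    have : β.range = ⊤ := by
      rw [MonoidHom.range_eq_top]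
      intro b
      obtain ⟨t, ht, hta⟩ := d.ext
      obtain ⟨s, hs⟩ := mz3_gen (α t) b hta
      refine ⟨⟨t ^ s, Subgroup.pow_mem _ (mem_Om1.2 ht) s⟩, ?_⟩
      simp [β, hs]
    rw [this, Subgroup.card_top, Nat.card_eq_fintype_card]
    decide
  rw [h2, h3] at h1
  omega

theorem DG.Rad_tr (d : DG n c α) (h : SR r) {t : G} (ht : t ∈ Om G 1) (hta : α t ≠ 1) {l : ℕ} (hl : 2 ≤ l)
    {x y : G} (hx : Lv l x) (hy : Lv l y) (hR : t ∈ Rad r x) : t ∈ Rad r y := by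
  obtain ⟨s, k, hk, rfl⟩ := d.adj hl ht hta hx hy
  have h1 : t ∈ Rad r (x ^ k) := (d.pow_memi hk).1 (h.Rad_pow d.pg hk hR)
  have h2 : r (x ^ k) (t ^ s * x ^ k) := h.mem_Rad' (Subgroup.pow_mem _ h1 s)
  rw [← h.Rad_eq h2]; exact h1

/-- `hA` property: classes within `Ω_i` lie in `H y ∪ H y⁻¹` -/
def HA (r : G → G → Prop) (t : G) (i : ℕ) : Prop :=
  ∀ y ∈ Om G i, ∀ x, r y x → x * y⁻¹ ∈ Subgroup.zpowers t ∨ x * y ∈ Subgroup.zpowers t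

theorem HA.RC_Om {t : G} {i j : ℕ} (hA : HA r t i) (ht : t ∈ Om G 1) (hj : 1 ≤ j) (hji : j ≤ i) : RC r (Om G j) := by
  intro x y hxy hx
  have hH : Subgroup.zpowers t ≤ Om G j := by
    rw [Subgroup.zpowers_le]; exact Om_mono hj ht
  rcases hA x (Om_mono hji hx) y hxy with k | k
  · have := mul_mem (hH k) hx; simpa using this
  · have := mul_mem (hH k) (inv_mem hx); simpa using this

theorem HA.RC_H {t : G} {i : ℕ} (hA : HA r t i) (hi : 1 ≤ i) (ht : t ∈ Om G 1) : RC r (Subgroup.zpowers t) := by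
  intro x y hxy hx
  have hH : Subgroup.zpowers t ≤ Om G i := by
    rw [Subgroup.zpowers_le]; exact Om_mono hi ht
  rcases hA x (hH hx) y hxy with k | k
  · have := mul_mem k hx; simpa using this
  · have := mul_mem k (inv_mem hx); simpa using this

theorem HA.mono {t : G} {i j : ℕ} (hA : HA r t i) (hj : j ≤ i) : HA r t j :=
  fun y hy x hx => hA y (Om_mono hj hy) x hx

/-- F(i) -/
theorem DG.F (d : DG n c α) (h : SR r) {t : G} (ht : t ∈ Om G 1) (hta : α t ≠ 1) {i : ℕ} (hi : 2 ≤ i) (hin : i ≤ n)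
    (hA : HA r t i) (hR : ∀ y, y ∉ Om G (i - 1) → t ∈ Rad r y) {x0 : G} (hx0 : Lv n x0) : Goal r := by
  have hex : ∃ s, 1 ≤ s ∧ ∀ y, y ∉ Om G s → t ∈ Rad r y := ⟨i - 1, by omega, hR⟩
  obtain ⟨h1, h2⟩ := Nat.find_spec hex
  have hle : Nat.find hex ≤ i - 1 := Nat.find_min' hex ⟨by omega, hR⟩
  have hmin := fun m (hm : m < Nat.find hex) => Nat.find_min hex hm
  generalize Nat.find hex = s at h1 h2 hle hmin
  refine ⟨Subgroup.zpowers t, Om G s, hA.RC_H (by omega) ht, hA.RC_Om ht h1 (by omega), ?_, ?_, ?_, ?_, ?_⟩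
  · rw [Subgroup.zpowers_le]; exact Om_mono h1 ht
  · rw [Ne, Subgroup.zpowers_eq_bot]; exact α_ne hta
  · intro k
    have : x0 ∈ Om G s := by rw [k]; trivial
    exact hx0.2 (Om_mono (by omega) this)
  · intro x hx l hl
    exact h.mem_Rad' ((Subgroup.zpowers_le (H := Rad r x)).2 (h2 x hx) hl)
  · by_cases hs : s = 1
    · subst hs
      right; left
      rw [d.card_E, card3 (mem_Om1.1 ht) (α_ne hta)]
    · right; right
      refine ⟨?_, card3 (mem_Om1.1 ht) (α_ne hta)⟩
      have := hmin (s - 1) (by omega)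
      push Not at this
      obtain ⟨y, hy, hyR⟩ := this (by omega)
      have hys : y ∈ Om G s := by
        by_contra k; exact hyR (h2 y k)
      have hyl : Lv s y := ⟨hys, hy⟩
      intro x hx e g hg
      have hxl := exp_Lv (by omega) (le_refl _) hys hyl hx e
      by_contra hg1
      obtain ⟨g', hg', hg1', hgE⟩ := d.order3 hg hg1
      apply hyR
      apply d.Rad_tr h ht hta (by omega) hxl hyl
      have hgH : g' ∈ Subgroup.zpowers t := by
        rcases hA x (Om_mono (by omega) hx) _ (h.mem_Rad' hg') with k | k
        · simpa using k
        · exfalso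
          apply hxl.2
          have hH : Subgroup.zpowers t ≤ Om G 1 := by
            rw [Subgroup.zpowers_le]; exact ht
          have := mul_mem (inv_mem hgE) (hH k)
          rw [mul_assoc, inv_mul_cancel_left, ← pow_two, d.pow_memi (by norm_num)] at this
          exact Om_mono (by omega) this
      exact (Subgroup.zpowers_le (H := Rad r x)).2 hg' (gen3 (mem_Om1.1 ht) hgH hg1')

theorem DG.caseA (d : DG n c α) (h : SR r) {l : ℕ} {z : G} (hz : thin r c l z) {g : G} (hg : g ∈ Rad r z) (hg1 : g ≠ 1) :
    ∃ t ∈ Om G 1, α t ≠ 1 ∧ t ∈ Subgroup.zpowers g ∧ HA r t l ∧ ∀ y, Lv l y → t ∈ Rad r y := by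
  obtain ⟨hl, hzl, hb, hall⟩ := hz
  obtain ⟨t, htg, ht1, htE⟩ := d.order3 (Subgroup.mem_zpowers g) hg1
  have htR : t ∈ Rad r z := (Subgroup.zpowers_le (H := Rad r z)).2 hg htg
  have hta : α t ≠ 1 := by
    intro k
    exact ht1 (d.bad_c h hl hb hzl (h.refl z) hzl.1 (d.mem_C'.2 ⟨htE, k⟩) (h.mem_Rad' htR))
  have hHR : Subgroup.zpowers t ≤ Rad r z := (Subgroup.zpowers_le (H := Rad r z)).2 htR
  have hHE : Subgroup.zpowers t ≤ Om G 1 := (Subgroup.zpowers_le).2 htE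
  -- elements of the class of the same sign
  have same : ∀ x, r z x → x ^ (3 ^ (l - 1)) = z ^ (3 ^ (l - 1)) → ∃ s : ℕ, x = t ^ s * z := by
    intro x hx e
    obtain ⟨s, m, ha, e2⟩ := d.adj_same hl htE hta hzl e
    refine ⟨s, ?_⟩
    have hts : r z (t ^ s * z) := h.mem_Rad' (Subgroup.pow_mem _ htR s)
    exact d.bad_det h hl hb hzl hts (hall _ hts) hx (by rw [e, sgn_E hl (Subgroup.pow_mem _ htE s)]) ha
  have opp : ∀ x, r z x → x ^ (3 ^ (l - 1)) = z⁻¹ ^ (3 ^ (l - 1)) → ∃ s : ℕ, x = t ^ s * z⁻¹ := by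
    intro x hx e
    obtain ⟨s, m, ha, e2⟩ := d.adj_same hl htE hta (Lv_inv hzl) e
    refine ⟨s, ?_⟩
    set y := (t ^ s)⁻¹ * z with hy
    have hyz : r z y := h.mem_Rad' (inv_mem (Subgroup.pow_mem _ htR s))
    have ey : t ^ s * z⁻¹ = y⁻¹ := by rw [hy, mul_inv, inv_inv]
    rw [ey] at e2 ⊢
    have h1 : r y x := h.trans (h.symm hyz) hx
    have h2 : r y⁻¹ (y ^ (1 + 3 * m)) := by
      have := h.inv h1
      rw [e2, inv_pow, inv_inv] at this; exact this
    have h3 := h.pow d.pg (m := 1 + 3 * m) (by omega) h2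
    rw [← e2, ← pow_mul] at h3
    have e3 : (1 + 3 * m) * (1 + 3 * m) = 1 + 3 * (m * (2 + 3 * m)) := by ring
    have h4 := h.trans h1 h3
    rw [e3] at h4
    have h5 := d.bad_pow h hl hb hzl hyz (hall y hyz) h4
    have h6 : (y ^ (3 * m)) ^ (2 + 3 * m) = 1 := by
      rw [← pow_mul, mul_assoc]
      rw [pow_add, pow_one] at h5; simpa using h5
    have h7 := d.pow_cop (by omega) h6
    rw [e2, pow_add, pow_one, inv_pow _ (3 * m), h7]; simp
  have both : ∀ x, r z x → (∃ s : ℕ, x = t ^ s * z) ∨ (∃ s : ℕ, x = t ^ s * z⁻¹) := by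
    intro x hx
    rcases d.sgE hl hzl (d.bad_min h hl hb hzl hx (hall x hx)) with e | e
    · exact Or.inl (same x hx e)
    · exact Or.inr (opp x hx e)
  have hRH : Rad r z = Subgroup.zpowers t := by
    apply le_antisymm _ hHR
    intro u hu
    have h1 := h.mem_Rad' hu
    rcases both _ h1 with ⟨s, e⟩ | ⟨s, e⟩
    · rw [mul_left_inj] at e; rw [e]; exact Subgroup.pow_mem _ (Subgroup.mem_zpowers t) s
    · exfalso
      have h2 : r z (u * u * z) := h.mem_Rad' (mul_mem hu hu)
      have h3 := (d.bad_min h hl hb hzl h2 (hall _ h2)).2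
      apply h3
      have e' : u = t ^ s * z⁻¹ * z⁻¹ := by rw [← e]; simp
      have : u * u * z = (t ^ s * t ^ s) * (z ^ 3)⁻¹ := by
        rw [e', pow_succ, pow_two, mul_inv, mul_inv]
        have : ∀ a b : G, a * b * b * (a * b * b) * b⁻¹ = a * a * (b * b * b) := by
          intro a b
          rw [mul_inv_eq_iff_eq_mul]
          simp only [mul_comm, mul_left_comm, mul_assoc]
        simpa using this (t ^ s) z⁻¹
      rw [this]
      apply mul_mem
      · exact mul_mem (Om_mono (by omega) (Subgroup.pow_mem _ htE s)) (Om_mono (by omega) (Subgroup.pow_mem _ htE s))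
      · apply inv_mem
        have : z ^ 3 = z ^ (3 ^ 1) := by rw [pow_one]
        rw [this, pow_mem_Om, show 1 + (l - 1) = l by omega]; exact hzl.1
  have hRC : RC r (Subgroup.zpowers t) := hRH ▸ h.RC_Rad z
  set q := QuotientGroup.mk' (Subgroup.zpowers t) with hq
  have hqt : q t = 1 := (QuotientGroup.eq_one_iff t).2 (Subgroup.mem_zpowers t)
  have hq1 : ∀ x, q x = 1 ↔ x ∈ Subgroup.zpowers t := fun x => QuotientGroup.eq_one_iff x
  have hcl : ∀ k : ℕ, ∀ x y, r x y → (q x = q z ^ k ∨ q x = (q z ^ k)⁻¹) → (q y = q z ^ k ∨ q y = (q z ^ k)⁻¹) := by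
    have h0 : ∀ x y, r x y → (q x = q z ^ 0 ∨ q x = (q z ^ 0)⁻¹) → (q y = q z ^ 0 ∨ q y = (q z ^ 0)⁻¹) := by
      intro x y hxy hx
      simp only [pow_zero, inv_one, or_self, hq1] at hx ⊢
      exact hRC x y hxy hx
    have h1' : ∀ x y, r x y → q x = q z → (q y = q z ∨ q y = (q z)⁻¹) := by
      intro x y hxy hx
      have h2 : x * z⁻¹ ∈ Subgroup.zpowers t := by rw [← hq1, map_mul, map_inv, hx, mul_inv_cancel]
      have h3 : r z x := by simpa using h.mem_Rad' (hHR h2)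
      rcases both y (h.trans h3 hxy) with ⟨s, e⟩ | ⟨s, e⟩
      · left; rw [e, map_mul, map_pow, hqt, one_pow, one_mul]
      · right; rw [e, map_mul, map_pow, hqt, one_pow, one_mul, map_inv]
    have h1 : ∀ x y, r x y → (q x = q z ^ 1 ∨ q x = (q z ^ 1)⁻¹) → (q y = q z ^ 1 ∨ q y = (q z ^ 1)⁻¹) := by
      intro x y hxy hx
      rw [pow_one] at *
      rcases hx with hx | hx
      · exact h1' x y hxy hx
      · have := h1' x⁻¹ y⁻¹ (h.inv hxy) (by rw [map_inv, hx, inv_inv])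
        rw [map_inv] at this
        rcases this with k | k
        · right; rw [← k, inv_inv]
        · left; exact inv_injective k
    have step : ∀ k : ℕ, (∀ x y, r x y → (q x = q z ^ k ∨ q x = (q z ^ k)⁻¹) → (q y = q z ^ k ∨ q y = (q z ^ k)⁻¹)) ∧
        (∀ x y, r x y → (q x = q z ^ (k+1) ∨ q x = (q z ^ (k+1))⁻¹) → (q y = q z ^ (k+1) ∨ q y = (q z ^ (k+1))⁻¹)) := by
      intro k
      induction k with
      | zero => exact ⟨h0, h1⟩
      | succ k ih =>
        refine ⟨ih.2, ?_⟩
        intro x y hxy hx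
        have hab : ∃ a b, x = a * b ∧ (q a = q z ^ (k+1) ∨ q a = (q z ^ (k+1))⁻¹) ∧ (q b = q z ^ 1 ∨ q b = (q z ^ 1)⁻¹) := by
          rcases hx with hx | hx
          · refine ⟨x * z⁻¹, z, by simp, Or.inl ?_, Or.inl (by simp)⟩
            rw [map_mul, hx, map_inv, pow_succ]; simp
          · refine ⟨x * z, z⁻¹, by simp, Or.inr ?_, Or.inr (by simp)⟩
            rw [map_mul, hx, pow_succ _ (k+1), mul_inv]; simp
        obtain ⟨a, b, e, ha, hb'⟩ := hab
        rw [e] at hxy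
        obtain ⟨a', b', ha', hb'', e'⟩ := h.prod_mem hxy
        have A := ih.2 a a' ha' ha
        have B := h1 b b' hb'' hb'
        rw [pow_one] at B
        have Y : q y = q z ^ (k+1+1) ∨ q y = (q z ^ (k+1+1))⁻¹ ∨ q y = q z ^ k ∨ q y = (q z ^ k)⁻¹ := by
          rw [← e', map_mul]
          rcases A with A | A <;> rcases B with B | B <;> rw [A, B]
          · left; rw [pow_succ _ (k+1)]
          · right; right; left; rw [pow_succ]; simp
          · right; right; right; rw [pow_succ, mul_inv]; simp
          · right; left; rw [pow_succ _ (k+1), mul_inv]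
        rcases Y with Y | Y | Y | Y
        · exact Or.inl Y
        · exact Or.inr Y
        all_goals
          have X := ih.1 y x (by rw [e]; exact h.symm hxy) (by tauto)
          have gen : ∀ x y u v : G ⧸ Subgroup.zpowers t, (x = v ∨ x = v⁻¹) → (x = u ∨ x = u⁻¹) →
              (y = u ∨ y = u⁻¹) → (y = v ∨ y = v⁻¹) := by
            intro x y u v h1 h2 h3
            have hu : u = v ∨ u = v⁻¹ := by
              rcases h2 with h2 | h2
              · rw [← h2]; exact h1
              · rw [show u = x⁻¹ by rw [h2, inv_inv]]
                rcases h1 with h1 | h1 <;> rw [h1] <;> simp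
            rcases h3 with h3 | h3 <;> rcases hu with hu | hu <;> rw [h3, hu] <;> simp
          exact gen _ _ _ _ hx X (by tauto)
    exact fun k => (step k).1
  refine ⟨t, htE, hta, htg, ?_, fun y hy => d.Rad_tr h htE hta hl hzl hy htR⟩
  intro y hy x hxy
  have hdec : ∃ s k : ℕ, y = t ^ s * z ^ k := by
    by_cases hyl : y ∈ Om G (l - 1)
    · have : Lv l (y * z) := ⟨mul_mem hy hzl.1, fun k => hzl.2 ((Subgroup.mul_mem_cancel_left _ hyl).1 k)⟩
      obtain ⟨s, k, hk, e⟩ := d.adj hl htE hta hzl this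
      obtain ⟨k', rfl⟩ : ∃ k', k = k' + 1 := ⟨k - 1, by
        have : k ≠ 0 := by rintro rfl; simp at hk
        omega⟩
      refine ⟨s, k', ?_⟩
      rw [pow_succ, ← mul_assoc, mul_left_inj] at e
      exact e
    · obtain ⟨s, k, hk, e⟩ := d.adj hl htE hta hzl (⟨hy, hyl⟩ : Lv l y)
      exact ⟨s, k, e⟩
  obtain ⟨s, k, e⟩ := hdec
  have hqy : q y = q z ^ k := by rw [e, map_mul, map_pow, map_pow, hqt, one_pow, one_mul]
  have := hcl k y x hxy (Or.inl hqy)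
  rw [← hqy] at this
  rcases this with k | k
  · left; rw [← hq1, map_mul, map_inv, k, mul_inv_cancel]
  · right; rw [← hq1, map_mul, k, inv_mul_cancel]

end dg

set_option linter.all false

section dg
variable {G : Type*} [CommGroup G] [Fintype G] {r : G → G → Prop} {n : ℕ} {c : G}
  {α : G →* Multiplicative (ZMod 3)}

/-- the subgroup generated by the cubes with count not divisible by three -/
theorem SR.cubeF (h : SR r) (α : G →* Multiplicative (ZMod 3)) {z z' : G}
    (hk : ¬ 3 ∣ ((cls r z).filter (fun x => x ^ 3 = z' ^ 3)).card) :
    ∃ F : Subgroup G, RC r F ∧ (∀ f ∈ F, α f = 1) ∧ z' ^ 3 ∈ F := by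
  haveI : Fact (Nat.Prime 3) := ⟨by norm_num⟩
  let X : Set G := {g | (((cls r z).filter (fun x => x ^ 3 = g)).card : ZMod 3) ≠ 0}
  refine ⟨Subgroup.closure X, h.RC_closure ?_, ?_, Subgroup.subset_closure ?_⟩
  · intro x y hxy hx
    show _ ≠ _
    rw [← h.pcount (h.AS_cls z) 3 hxy]
    exact hx
  · have : Subgroup.closure X ≤ α.ker := by
      rw [Subgroup.closure_le]
      intro g hg
      have : ((cls r z).filter (fun x => x ^ 3 = g)).card ≠ 0 := by
        intro k; apply hg; rw [k]; simp
      rw [Finset.card_ne_zero] at this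
      obtain ⟨x, hx⟩ := this
      rw [Finset.mem_filter] at hx
      rw [SetLike.mem_coe, MonoidHom.mem_ker, ← hx.2, α_cube]
    exact fun f hf => MonoidHom.mem_ker.1 (this hf)
  · show _ ≠ _
    rw [Ne, ZMod.natCast_eq_zero_iff]
    exact hk

theorem DG.thin_uniq (d : DG n c α) (h : SR r) {l : ℕ} {z : G} (hz : thin r c l z) {e e' : G}
    (he : e ∈ Om G 1) (he' : e' ∈ Om G 1) (h1 : r z (e * z)) (h2 : r z (e' * z)) (ha : α e = α e') : e = e' := by
  obtain ⟨hl, hzl, hb, hO⟩ := hz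
  have := d.bad_det h hl hb hzl h1 (hO _ h1) h2
    (by rw [sgn_E hl he, sgn_E hl he']) (by rw [map_mul, map_mul, ha])
  exact (mul_right_cancel this).symm

theorem DG.thin_cube (d : DG n c α) (h : SR r) {l : ℕ} {z : G} (hz : thin r c l z) :
    (∃ F : Subgroup G, RC r F ∧ (∀ f ∈ F, α f = 1) ∧ z ^ 3 ∈ F) ∨
    ∀ a, ∃ e ∈ Om G 1, α e = a ∧ r z (e * z) := by
  by_cases hk : 3 ∣ ((cls r z).filter (fun x => x ^ 3 = z ^ 3)).card
  · right
    set D := (cls r z).filter (fun x => x ^ 3 = z ^ 3) with hD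
    have hzD : z ∈ D := by rw [hD, Finset.mem_filter]; exact ⟨h.self_mem z, rfl⟩
    have hinj : ∀ x ∈ D, ∀ y ∈ D, α x = α y → x = y := by
      intro x hx y hy hxy
      rw [hD, Finset.mem_filter, mem_cls] at hx hy
      have ex : x * z⁻¹ ∈ Om G 1 := by rw [mem_Om1, mul_pow, hx.2, inv_pow, mul_inv_cancel]
      have ey : y * z⁻¹ ∈ Om G 1 := by rw [mem_Om1, mul_pow, hy.2, inv_pow, mul_inv_cancel]
      have := d.thin_uniq h hz ex ey (by simpa using hx.1) (by simpa using hy.1) (by simp [hxy])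
      exact mul_right_cancel this
    have hpos : 0 < D.card := Finset.card_pos.2 ⟨z, hzD⟩
    have h3 : 3 ≤ D.card := Nat.le_of_dvd hpos hk
    have himg : D.image α = Finset.univ := by
      rw [← Finset.card_eq_iff_eq_univ, Finset.card_image_of_injOn (fun x hx y hy => hinj x hx y hy)]
      have : Fintype.card (Multiplicative (ZMod 3)) = 3 := rfl
      rw [this]
      exact le_antisymm (card_le3 α D hinj) h3
    intro a
    have : a * α z ∈ D.image α := by rw [himg]; exact Finset.mem_univ _
    rw [Finset.mem_image] at this
    obtain ⟨x, hx, e⟩ := this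
    rw [hD, Finset.mem_filter, mem_cls] at hx
    refine ⟨x * z⁻¹, by rw [mem_Om1, mul_pow, hx.2, inv_pow, mul_inv_cancel], by rw [map_mul, e, map_inv]; simp, by simpa using hx.1⟩
  · left
    exact h.cubeF α hk

theorem DG.lineRad (d : DG n c α) (h : SR r) {l : ℕ} {z : G} (hz : thin r c l z) {e : G}
    (he : e ∈ Om G 1) (ha : α e ≠ 1) (h1 : r z (e * z)) (h2 : r z (e⁻¹ * z)) : e ∈ Rad r z := by
  have hz' := hz
  obtain ⟨hl, hzl, hb, hO⟩ := hz
  have e3 : e ^ 3 = 1 := mem_Om1.1 he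
  have e2 : e ^ 2 = e⁻¹ := by rw [eq_inv_iff_mul_eq_one, ← pow_succ, e3]
  have all : ∀ s : ℕ, r z (e ^ s * z) := by
    intro s
    have : e ^ s = e ^ (s % 3) := by
      conv_lhs => rw [← Nat.div_add_mod s 3, pow_add, pow_mul, e3, one_pow, one_mul]
    rw [this]
    have : s % 3 < 3 := Nat.mod_lt _ (by norm_num)
    interval_cases s % 3
    · simpa using h.refl z
    · simpa using h1
    · rw [e2]; exact h2
  apply mem_Rad_of
  intro y hy
  have hyl := d.bad_min h hl hb hzl hy (hO y hy)
  rcases d.sgE hl hzl hyl with k | k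
  · obtain ⟨s, m, ha', ey⟩ := d.adj_same hl he ha hzl k
    have := d.bad_det h hl hb hzl (all s) (hO _ (all s)) hy (by rw [k, sgn_E hl (pow_mem he s)]) ha'
    rw [this, ← mul_assoc, ← pow_succ']
    exact all _
  · have k' : y⁻¹ ^ (3 ^ (l-1)) = z ^ (3 ^ (l-1)) := by rw [inv_pow, k, inv_pow, inv_inv]
    obtain ⟨s, m, ha', ey⟩ := d.adj_same hl he ha hzl k'
    have h3 : r ((e ^ s * z) ^ (1 + 3 * m)) ((e ^ (s+2) * z) ^ (1 + 3 * m)) :=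
      h.pow d.pg (by omega) (h.trans (h.symm (all s)) (all (s+2)))
    have : (e ^ (s+2) * z) ^ (1 + 3 * m) = e⁻¹ * y⁻¹ := by
      rw [ey, pow_add e s 2, e2, mul_comm (e ^ s), mul_assoc, mul_pow e⁻¹]
      congr 1
      rw [pow_add, pow_mul, inv_pow e 3, e3]; simp
    rw [this, ← ey] at h3
    have := h.inv h3
    rw [mul_inv, inv_inv, inv_inv] at this
    exact h.trans hy this

theorem DG.VE_thin (d : DG n c α) (h : SR r) {g : G} (hg : r c g) (hgE : g ∈ Om G 1) (hga : α g ≠ 1)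
    {l : ℕ} {z : G} (hz : thin r c l z) : ∃ e ∈ Rad r z, e ≠ 1 := by
  have hz' := hz
  obtain ⟨hl, hzl, hb, hO⟩ := hz
  rcases d.thin_cube h hz' with ⟨F, hF, hFa, hzF⟩ | hE
  · exfalso
    have hp : z ^ (3 ^ (l-1)) ∈ F := by
      have : 3 ^ (l - 1) = 3 * 3 ^ (l - 2) := by rw [← pow_succ']; congr 1; omega
      rw [this, pow_mul]; exact pow_mem hzF _
    have hc : c ∈ F := by
      rcases d.sg hl hzl with k | k <;> rw [k] at hp
      · exact hp
      · simpa using hp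
    exact hga (hFa _ (hF _ _ hg hc))
  · have ov0 : ∀ y, r z y → ¬ r z (g * y) := by
      have := h.ov_eq (h.AS_cls z) hg
      have e1 : ((cls r z).filter (fun x => c * x ∉ cls r z)).card = ((cls r z).filter (fun x => g * x ∉ cls r z)).card := by
        have a1 := card_sub_ov (cls r z) c
        have a2 := card_sub_ov (cls r z) g
        omega
      have e2 : (cls r z).filter (fun x => c * x ∉ cls r z) = cls r z := by
        rw [Finset.filter_eq_self]
        intro y hy hcy
        rw [mem_cls] at hy hcy
        exact d.c1 (d.bad_c h hl hb hzl hy (hO y hy) (Subgroup.mem_zpowers c) hcy)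
      rw [e2] at e1
      have e3 := Finset.filter_card_eq e1.symm
      intro y hy hgy
      exact e3 y (mem_cls.2 hy) (mem_cls.2 hgy)
    obtain ⟨e, he, hea, her⟩ := hE (α g)
    obtain ⟨f, hf, hfa, hfr⟩ := hE (α g)⁻¹
    have hegC : e * g⁻¹ ∈ Subgroup.zpowers c := d.mem_C'.2 ⟨mul_mem he (inv_mem hgE), by simp [hea]⟩
    have hfgC : f * g ∈ Subgroup.zpowers c := d.mem_C'.2 ⟨mul_mem hf hgE, by simp [hfa]⟩
    have n1 : e * g⁻¹ ≠ 1 := by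
      intro k; rw [mul_inv_eq_one] at k; subst k; exact ov0 z (h.refl z) her
    have n2 : f * g ≠ 1 := by
      intro k
      apply ov0 _ hfr
      rw [← mul_assoc, mul_comm g f, k, one_mul]; exact h.refl z
    have n3 : f ≠ g * e := by
      intro k
      apply ov0 _ her
      rw [← mul_assoc, ← k]; exact hfr
    have g3 : g * g * g = 1 := by have := mem_Om1.1 hgE; rw [pow_succ, pow_two] at this; exact this
    have hef : e * f = 1 := by
      have e1 : e * f = (e * g⁻¹) * (f * g) := by
        rw [mul_comm f g, ← mul_assoc]; simp
      rw [d.mem_C] at hegC hfgC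
      have key : e * g⁻¹ ≠ f * g := by
        intro k
        apply n3
        have : e = f * g * g := by rw [← k]; simp
        rw [this, mul_comm g, mul_assoc, mul_assoc, ← mul_assoc g, g3, mul_one]
      rw [e1]
      rcases hegC with k | k | k <;> rcases hfgC with k' | k' | k' <;> first
        | exact absurd k n1 | exact absurd k' n2 | exact absurd (k.trans k'.symm) key | (rw [k, k']; simp)
    have hf' : f = e⁻¹ := (eq_inv_of_mul_eq_one_right hef)
    rw [hf'] at hfr
    have hea' : α e ≠ 1 := by rw [hea]; exact hga
    exact ⟨e, d.lineRad h hz' he hea' her hfr, α_ne hea'⟩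

theorem DG.Lv_unique {l l' : ℕ} {x : G} (h1 : Lv l x) (h2 : x ∈ Om G l') : l ≤ l' := by
  by_contra k
  exact h1.2 (Om_mono (by omega) h2)

/-- Case A with full hull -/
theorem DG.mainAE (d : DG n c α) (h : SR r) (hA : ∀ y, r c y → y ∈ Om G 1) (hV : hull r c = Om G 1)
    {g : G} (hg : r c g) (hgE : g ∈ Om G 1) (hga : α g ≠ 1) {x0 : G} (hx0 : Lv n x0) : Goal r := by
  have hE1 : Om G 1 ≠ ⊤ := by
    intro k
    apply hx0.2
    apply Om_mono (show 1 ≤ n - 1 by have := d.n2; omega)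
    rw [k]; trivial
  by_cases hth : ∃ l, l ≤ n ∧ ∃ z, thin r c l z
  · obtain ⟨i, ⟨hin, z, hz⟩, hmax⟩ : ∃ i, (i ≤ n ∧ ∃ z, thin r c i z) ∧ ∀ l, (l ≤ n ∧ ∃ z, thin r c l z) → l ≤ i := by
      obtain ⟨l0, hl0⟩ := hth
      refine ⟨Nat.findGreatest (fun l => l ≤ n ∧ ∃ z, thin r c l z) n, ?_, ?_⟩
      · exact Nat.findGreatest_spec (P := fun l => l ≤ n ∧ ∃ z, thin r c l z) hl0.1 hl0
      · intro l hl
        exact Nat.le_findGreatest hl.1 hl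
    obtain ⟨e, heR, he1⟩ := d.VE_thin h hg hgE hga hz
    obtain ⟨t, htE, hta, -, hHA, hR⟩ := d.caseA h hz heR he1
    refine d.F h htE hta hz.1 hin hHA ?_ hx0
    intro y hy
    by_cases hyi : y ∈ Om G i
    · exact hR y ⟨hyi, hy⟩
    · have hy1 : y ∉ Om G 1 := fun k => hyi (Om_mono (by have := hz.1; omega) k)
      rcases d.dich h hA hy1 with ⟨l, hl, hyl⟩ | k
      · exact absurd (Om_mono (hmax l ⟨hl, y, hyl⟩) hyl.2.1.1) hyi
      · apply k; rw [hV]; exact htE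
  · refine ⟨Om G 1, Om G 1, hV ▸ d.RC_hull h, hV ▸ d.RC_hull h, le_rfl, ?_, hE1, ?_, Or.inl rfl⟩
    · intro k
      have := d.cE
      rw [k, Subgroup.mem_bot] at this
      exact d.c1 this
    · intro x hx l hl
      rcases d.dich h hA hx with ⟨l, hl, hyl⟩ | k
      · exact absurd ⟨l, hl, x, hyl⟩ hth
      · rw [hV] at k
        exact h.mem_Rad' (k hl)
end dg

set_option linter.all false

section dg
variable {G : Type*} [CommGroup G] [Fintype G] {r : G → G → Prop} {n : ℕ} {c : G}
  {α : G →* Multiplicative (ZMod 3)}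

theorem SR.H_two (h : SR r) {H : Subgroup G} (hH : RC r H) {z w w' : G} (hw : r z w) (hw' : r z w')
    (k : ∃ s ∈ H, s ≠ 1 ∧ r z (s * w)) : ∃ s ∈ H, s ≠ 1 ∧ r z (s * w') := by
  have e := h.cc_eq (h.AS_cls z) hH (h.trans (h.symm hw) hw')
  obtain ⟨s, hs, hs1, hr⟩ := k
  have h2 : 1 < cc (cls r z) H w := by
    unfold cc
    rw [Finset.one_lt_card]
    refine ⟨w, ?_, s * w, ?_, ?_⟩
    · rw [Finset.mem_filter, mem_cls]; exact ⟨hw, by simpa using one_mem H⟩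
    · rw [Finset.mem_filter, mem_cls]; exact ⟨hr, by simpa using hs⟩
    · intro e; exact hs1 (by simpa using e.symm)
  rw [e] at h2
  unfold cc at h2
  obtain ⟨x, hx, hne⟩ := Finset.exists_mem_ne h2 w'
  rw [Finset.mem_filter, mem_cls] at hx
  refine ⟨x * w'⁻¹, ?_, ?_, by simpa using hx.1⟩
  · have := inv_mem hx.2; rw [mul_inv, inv_inv] at this; exact this
  · rw [Ne, mul_inv_eq_one]; exact hne

theorem zp3 {e x : G} (he : e ^ 3 = 1) (hx : x ∈ Subgroup.zpowers e) : x = 1 ∨ x = e ∨ x = e⁻¹ := by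
  by_cases h1 : e = 1
  · subst h1; left; simpa using hx
  · rw [Subgroup.mem_zpowers_iff] at hx
    obtain ⟨k, rfl⟩ := hx
    have e3 : e ^ (3:ℤ) = 1 := by exact_mod_cast he
    have hk : e ^ k = e ^ (k % 3) := by
      conv_lhs => rw [← Int.mul_ediv_add_emod k 3, zpow_add, zpow_mul, e3, one_zpow, one_mul]
    rw [hk]
    have h1 := Int.emod_nonneg k (show (3:ℤ) ≠ 0 by norm_num)
    have h2 := Int.emod_lt_of_pos k (show (0:ℤ) < 3 by norm_num)
    interval_cases k % 3
    · left; simp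
    · right; left; simp
    · right; right; rw [eq_inv_iff_mul_eq_one, ← he, pow_succ]; norm_cast

theorem a_ne_inv {a : Multiplicative (ZMod 3)} (ha : a ≠ 1) : a ≠ a⁻¹ := by
  revert a; decide

theorem DG.P_thin (d : DG n c α) (h : SR r) {i : ℕ} (hi : 1 ≤ i) {t : G} (ht : t ∈ Om G 1)
    (hta : α t ≠ 1) (hHA : HA r t i) (hR : ∀ y, y ^ (3 ^ (i-1)) = c → t ∈ Rad r y)
    {l : ℕ} {z : G} (hz : thin r c l z) (hzi : z ∉ Om G i) : t ∈ Rad r z := by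
  have hz' := hz
  obtain ⟨hl, hzl, hb, hO⟩ := hz
  have hil : i < l := by
    by_contra k
    exact hzi (Om_mono (by omega) hzl.1)
  have t3 : t ^ 3 = 1 := mem_Om1.1 ht
  have t2 : t * t = t⁻¹ := by rw [eq_inv_iff_mul_eq_one]; rw [← t3, pow_succ, pow_two]
  have hRCH := hHA.RC_H hi ht
  obtain ⟨y, hyc, hyz, hyF⟩ : ∃ y, y ^ (3 ^ (i-1)) = c ∧ y ∈ Om G i ∧ ∀ F : Subgroup G, z ^ 3 ∈ F → y ∈ F := by
    have e1 : (z ^ (3 ^ (l - i))) ^ (3 ^ (i-1)) = z ^ (3 ^ (l-1)) := by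
      rw [← pow_mul, ← pow_add]; congr 2; omega
    have e2 : z ^ (3 ^ (l - i)) ∈ Om G i := by
      rw [pow_mem_Om]; rw [show l - i + i = l by omega]; exact hzl.1
    have e3 : ∀ F : Subgroup G, z ^ 3 ∈ F → z ^ (3 ^ (l - i)) ∈ F := by
      intro F hF
      rw [show 3 ^ (l - i) = 3 * 3 ^ (l - i - 1) by rw [← pow_succ']; congr 1; omega, pow_mul]
      exact pow_mem hF _
    rcases d.sg hl hzl with k | k
    · exact ⟨_, by rw [e1, k], e2, e3⟩
    · exact ⟨(z ^ (3 ^ (l - i)))⁻¹, by rw [inv_pow, e1, k, inv_inv], inv_mem e2, fun F hF => inv_mem (e3 F hF)⟩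
  have hty := hR y hyc
  rcases d.thin_cube h hz' with ⟨F, hF, hFa, hzF⟩ | hE
  · exfalso
    have h1 := hyF F hzF
    have h2 := hF _ _ (h.mem_Rad' hty) h1
    have := hFa _ h2
    rw [map_mul, hFa _ h1, mul_one] at this
    exact hta this
  · obtain ⟨e, he, hea, her⟩ := hE (α t)
    obtain ⟨f, hf, hfa, hfr⟩ := hE (α t)⁻¹
    have tH : t ∈ Subgroup.zpowers t := Subgroup.mem_zpowers t
    have hone : r z (1 * z) := by rw [one_mul]; exact h.refl z
    by_cases hQ : ∃ s ∈ Subgroup.zpowers t, s ≠ 1 ∧ r z (s * z)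
    · have hte : r z (t * z) := by
        obtain ⟨s, hs, hs1, hsr⟩ := hQ
        rcases zp3 t3 hs with k | k | k
        · exact absurd k hs1
        · rw [← k]; exact hsr
        · obtain ⟨s', hs', hs1', hsr'⟩ := h.H_two hRCH (h.refl z) her ⟨s, hs, hs1, hsr⟩
          rw [k] at hsr
          rw [← mul_assoc] at hsr'
          rcases zp3 t3 hs' with k' | k' | k'
          · exact absurd k' hs1'
          · have := d.thin_uniq h hz' (mul_mem (k' ▸ ht) he) (inv_mem ht) hsr' hsr (by
              rw [map_mul, hea, k', ← map_mul, t2])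
            have e' : e = t := by
              have : t * e = t⁻¹ := by have q := this; rw [k'] at q; exact q
              rw [← t2] at this; exact mul_left_cancel this
            rw [← e']; exact her
          · have := d.thin_uniq h hz' (mul_mem (k' ▸ inv_mem ht) he) (one_mem _) hsr' hone (by
              rw [map_mul, hea, k', ← map_mul]; simp)
            have e' : e = t := by
              have : t⁻¹ * e = 1 := by rw [← k']; exact this
              rw [inv_mul_eq_one] at this; exact this.symm
            rw [← e']; exact her
      have hti : r z (t⁻¹ * z) := by
        obtain ⟨s', hs', hs1', hsr'⟩ := h.H_two hRCH (h.refl z) hfr hQ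
        rw [← mul_assoc] at hsr'
        rcases zp3 t3 hs' with k' | k' | k'
        · exact absurd k' hs1'
        · have := d.thin_uniq h hz' (mul_mem (k' ▸ ht) hf) (one_mem _) hsr' hone (by
            rw [map_mul, hfa, k']; simp)
          have e' : f = t⁻¹ := by
            have : t * f = 1 := by rw [← k']; exact this
            exact eq_inv_of_mul_eq_one_right this
          rw [← e']; exact hfr
        · have := d.thin_uniq h hz' (mul_mem (k' ▸ inv_mem ht) hf) ht hsr' hte (by
            rw [map_mul, hfa, k', ← map_inv, ← map_mul, ← t2, mul_assoc, ← mul_assoc t t t, t2]; simp)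
          have e' : f = t⁻¹ := by
            have : t⁻¹ * f = t := by rw [← k']; exact this
            rw [inv_mul_eq_iff_eq_mul, t2] at this; exact this
          rw [← e']; exact hfr
      exact d.lineRad h hz' ht hta hte hti
    · exfalso
      have n1 : e ≠ t := fun k => hQ ⟨t, tH, α_ne hta, k ▸ her⟩
      have n2 : f ≠ t⁻¹ := fun k => hQ ⟨t⁻¹, inv_mem tH, inv_ne_one.2 (α_ne hta), k ▸ hfr⟩
      have n3 : f ≠ t * e := by
        intro k
        apply hQ
        apply h.H_two hRCH her (h.refl z)
        exact ⟨t, tH, α_ne hta, by rw [← mul_assoc, ← k]; exact hfr⟩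
      have hC1 : e * t⁻¹ ∈ Subgroup.zpowers c := d.mem_C'.2 ⟨mul_mem he (inv_mem ht), by simp [hea]⟩
      have hC2 : f * t ∈ Subgroup.zpowers c := d.mem_C'.2 ⟨mul_mem hf ht, by simp [hfa]⟩
      have hef : e * f = 1 := by
        have e1 : e * f = (e * t⁻¹) * (f * t) := by
          rw [mul_comm f t, ← mul_assoc]; simp
        rw [d.mem_C] at hC1 hC2
        have m1 : e * t⁻¹ ≠ 1 := by rw [Ne, mul_inv_eq_one]; exact n1
        have m2 : f * t ≠ 1 := by rw [Ne, mul_eq_one_iff_eq_inv]; exact n2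
        have key : e * t⁻¹ ≠ f * t := by
          intro k
          apply n3
          have : f = e * t⁻¹ * t⁻¹ := by rw [k]; simp
          rw [this, mul_assoc, ← mul_inv, t2, inv_inv, mul_comm]
        rw [e1]
        rcases hC1 with k | k | k <;> rcases hC2 with k' | k' | k' <;> first
          | exact absurd k m1 | exact absurd k' m2 | exact absurd (k.trans k'.symm) key | (rw [k, k']; simp)
      have hf' : f = e⁻¹ := (eq_inv_of_mul_eq_one_right hef)
      rw [hf'] at hfr
      have hea' : α e ≠ 1 := by rw [hea]; exact hta
      have heR := d.lineRad h hz' he hea' her hfr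
      obtain ⟨u, huE, hua, hue, hHA', -⟩ := d.caseA h hz' heR (α_ne hea')
      have hyl : y ∈ Om G l := Om_mono hil.le hyz
      have c1 := hHA' y hyl _ (h.mem_Rad' hty)
      have c2 := hHA' y hyl _ (h.mem_Rad' (inv_mem hty))
      have hK : t ∈ Subgroup.zpowers u := by
        rcases c1 with k1 | k1
        · simpa using k1
        · rcases c2 with k2 | k2
          · have : t⁻¹ ∈ Subgroup.zpowers u := by simpa using k2
            simpa using this
          · have := mul_mem k1 (inv_mem k2)
            have e1 : t * y * y * (t⁻¹ * y * y)⁻¹ = t⁻¹ := by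
              simp only [mul_inv, inv_inv]
              rw [show t * y * y * (t * y⁻¹ * y⁻¹) = t * t * (y * y⁻¹) * (y * y⁻¹) by ac_rfl]
              simp [t2]
            rw [e1] at this
            simpa using this
      have hKe : t ∈ Subgroup.zpowers e := (Subgroup.zpowers_le.2 hue) hK
      rcases zp3 (mem_Om1.1 he) hKe with k | k | k
      · exact α_ne hta k
      · exact n1 k.symm
      · apply a_ne_inv hta
        conv_lhs => rw [k, map_inv, hea]
end dg

theorem DG.C_ker {G : Type*} [CommGroup G] [Fintype G] {n : ℕ} {c : G}
    {α : G →* Multiplicative (ZMod 3)} (d : DG n c α) : Subgroup.zpowers c ≤ α.ker := by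
  intro x hx; exact MonoidHom.mem_ker.2 (d.mem_C'.1 hx).2

theorem DG.quot {G : Type*} [CommGroup G] [Fintype G] {n : ℕ} {c : G}
    {α : G →* Multiplicative (ZMod 3)} (d : DG n c α) (hn : 3 ≤ n) {b : G} (hb : b ^ 3 = c) (hba : α b = 1) :
    DG (n-1) (QuotientGroup.mk b : G ⧸ Subgroup.zpowers c)
      (QuotientGroup.lift (Subgroup.zpowers c) α d.C_ker) := by
  have hC1 : ∀ g : G, (QuotientGroup.mk g : G ⧸ Subgroup.zpowers c) = 1 ↔ g ∈ Subgroup.zpowers c := fun g => QuotientGroup.eq_one_iff g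
  have key : ∀ w : G, w ^ 3 ∈ Subgroup.zpowers c → α w = 1 →
      (QuotientGroup.mk w : G ⧸ Subgroup.zpowers c) = 1 ∨ (QuotientGroup.mk w : G ⧸ Subgroup.zpowers c) = QuotientGroup.mk b ∨
      (QuotientGroup.mk w : G ⧸ Subgroup.zpowers c) = (QuotientGroup.mk b)⁻¹ := by
    intro w hw ha
    rcases d.mem_C.1 hw with k | k | k
    · left; rw [hC1, d.mem_C']; exact ⟨mem_Om1.2 k, ha⟩
    · right; left
      rw [QuotientGroup.eq, d.mem_C', mem_Om1]
      constructor
      · rw [mul_pow, inv_pow, k, hb]; simp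
      · simp [ha, hba]
    · right; right
      rw [← QuotientGroup.mk_inv, QuotientGroup.eq, d.mem_C', mem_Om1]
      constructor
      · rw [mul_pow, inv_pow, inv_pow, k, hb]; simp
      · simp [ha, hba]
  refine ⟨by omega, ?_, ?_, ?_, ?_, ?_, ?_, ?_, ?_⟩
  · rw [← QuotientGroup.mk_pow, hC1, hb]; exact Subgroup.mem_zpowers c
  · rw [Ne, hC1, d.mem_C', mem_Om1, hb]; exact fun k => d.c1 k.1
  · intro g
    obtain ⟨g, rfl⟩ := QuotientGroup.mk_surjective g
    rw [← QuotientGroup.mk_pow, hC1, d.mem_C]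
    exact d.sgn n (by omega) g (d.exp g)
  · intro l hl g hg
    obtain ⟨g, rfl⟩ := QuotientGroup.mk_surjective g
    rw [← QuotientGroup.mk_pow, hC1] at hg
    rw [← QuotientGroup.mk_pow]
    apply key
    · rw [← pow_mul, ← pow_succ]; rw [show l - 1 + 1 = l by omega]; exact hg
    · exact α_pow3 α g (by omega)
  · rw [QuotientGroup.lift_mk]; exact hba
  · intro g hg ha
    obtain ⟨g, rfl⟩ := QuotientGroup.mk_surjective g
    rw [← QuotientGroup.mk_pow, hC1] at hg
    rw [QuotientGroup.lift_mk] at ha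
    exact key g hg ha
  · obtain ⟨t, ht, hta⟩ := d.ext
    refine ⟨QuotientGroup.mk t, by rw [← QuotientGroup.mk_pow, ht]; rfl, ?_⟩
    rw [QuotientGroup.lift_mk]; exact hta
  · intro l hl x y hx hxy ha
    obtain ⟨x, rfl⟩ := QuotientGroup.mk_surjective x
    obtain ⟨y, rfl⟩ := QuotientGroup.mk_surjective y
    rw [QuotientGroup.lift_mk, QuotientGroup.lift_mk] at ha
    have cu : ∀ u v : G, (QuotientGroup.mk u : G ⧸ Subgroup.zpowers c) = QuotientGroup.mk v → u ^ 3 = v ^ 3 := by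
      intro u v e
      rw [QuotientGroup.eq] at e
      have := mem_Om1.1 (d.mem_C'.1 e).1
      rw [mul_pow, inv_pow, inv_mul_eq_one] at this
      exact this
    have e1 : ∀ w : G, w ^ (3 ^ (l + 1 - 1)) = (w ^ (3 ^ (l-1))) ^ 3 := by
      intro w; rw [← pow_mul, ← pow_succ]; congr 2; omega
    rw [← QuotientGroup.mk_pow, ← QuotientGroup.mk_pow] at hxy
    rw [← QuotientGroup.mk_pow, ← QuotientGroup.mk_inv] at hx
    obtain ⟨m, hm⟩ := d.orb (l+1) (by omega) x y (by
      rw [e1]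
      rcases hx with k | k
      · left; rw [cu _ _ k, hb]
      · right; rw [cu _ _ k, inv_pow, hb]) (by rw [e1, e1, cu _ _ hxy]) ha
    exact ⟨m, by rw [hm]; rfl⟩

theorem DG.P {G : Type*} [CommGroup G] [Fintype G] {r : G → G → Prop} {n : ℕ} {c : G}
    {α : G →* Multiplicative (ZMod 3)} (d : DG n c α) (h : SR r) {i : ℕ} (hi : 1 ≤ i) (hin : i < n) {t : G} (ht : t ∈ Om G 1)
    (hta : α t ≠ 1) (hHA : HA r t i) (hR : ∀ y, y ^ (3 ^ (i-1)) = c → t ∈ Rad r y) :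
    ∀ z, z ∉ Om G i → t ∈ Rad r z := by
  induction i generalizing G n with
  | zero => omega
  | succ i ih =>
    intro z hz
    have hzE : z ∉ Om G 1 := fun k => hz (Om_mono hi k)
    have hA : ∀ y, r c y → y ∈ Om G 1 := fun y hy => (hHA.RC_Om ht le_rfl hi) _ _ hy d.cE
    rcases d.dich h hA hzE with ⟨l, hl, hzl⟩ | hV
    · exact d.P_thin h hi ht hta hHA hR hzl hz
    rcases d.hullA h hA with hC | ⟨hE, -⟩
    swap
    · rw [hE] at hV; exact hV ht
    rw [hC] at hV
    have hRC : RC r (Subgroup.zpowers c) := hC ▸ d.RC_hull h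
    rcases Nat.eq_zero_or_pos i with rfl | hi0
    · exfalso
      have := hR c (by simp)
      have := hRC _ _ (h.mem_Rad' this) (Subgroup.mem_zpowers c)
      rw [d.mem_C', map_mul, d.αc, mul_one] at this
      exact hta this.2
    have hn3 : 3 ≤ n := by omega
    obtain ⟨l, hl1, hln, hzl⟩ := d.exists_Lv2 hzE
    have hil : i + 1 < l := by
      by_contra k
      exact hz (Om_mono (by omega) hzl.1)
    obtain ⟨b, hb, hba⟩ : ∃ b : G, b ^ 3 = c ∧ α b = 1 := by
      have e1 : (z ^ (3 ^ (l - 2))) ^ 3 = z ^ (3 ^ (l-1)) := by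
        rw [← pow_mul, ← pow_succ]; congr 2; omega
      have e2 : α (z ^ (3 ^ (l-2))) = 1 := α_pow3 α z (by omega)
      rcases d.sg hl1 hzl with k | k
      · exact ⟨_, e1.trans k, e2⟩
      · exact ⟨(z ^ (3 ^ (l-2)))⁻¹, by rw [inv_pow, e1, k, inv_inv], by rw [map_inv, e2, inv_one]⟩
    have d' := d.quot hn3 hb hba
    let φ : G →* G ⧸ Subgroup.zpowers c := QuotientGroup.mk' _
    have hker : φ.ker = Subgroup.zpowers c := QuotientGroup.ker_mk' _
    have hs : Function.Surjective φ := QuotientGroup.mk'_surjective _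
    have hRC' : RC r φ.ker := by rw [hker]; exact hRC
    have h' : SR (qrel r φ) := h.quot φ hs (hRC')
    have hφ1 : ∀ g, φ g = 1 ↔ g ∈ Subgroup.zpowers c := fun g => QuotientGroup.eq_one_iff g
    have hOm : ∀ g : G, φ g ∈ Om (G ⧸ Subgroup.zpowers c) i → g ∈ Om G (i+1) := by
      intro g hg
      rw [mem_Om, ← map_pow, hφ1] at hg
      have := (d.mem_C'.1 hg).1
      rw [pow_mem_Om] at this; exact this
    have hzp : ∀ g, g ∈ Subgroup.zpowers t → φ g ∈ Subgroup.zpowers (φ t) := by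
      intro g hg
      rw [← MonoidHom.map_zpowers]; exact Subgroup.mem_map_of_mem φ hg
    have hOmt : φ t ∈ Om (G ⧸ Subgroup.zpowers c) 1 := by
      rw [mem_Om1, ← map_pow, mem_Om1.1 ht, map_one]
    have res := ih d' h' (t := φ t) hi0 (by omega) hOmt hta ?_ ?_ (φ z) (fun k => hz (hOm z k))
    · apply mem_Rad_of
      intro y hy
      have q1 : qrel r φ (φ z) (φ y) := ⟨z, y, rfl, rfl, hy⟩
      obtain ⟨x1, y1, e1, e2, hxy⟩ := mem_Rad res q1
      obtain ⟨y', e3, hy'⟩ := h.lift φ (hRC') e1 hxy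
      have : t * y * y'⁻¹ ∈ Subgroup.zpowers c := by
        rw [← hφ1, map_mul, map_inv, e3, e2, map_mul]; simp
      have := mem_Rad (hV this) hy'
      simpa using this
    · intro y hy x hyx
      obtain ⟨x1, y1, e1, e2, hxy⟩ := hyx
      subst e1; subst e2
      rcases hHA _ (hOm _ hy) _ hxy with k | k
      · left; have := hzp _ k; rw [map_mul, map_inv] at this; exact this
      · right; have := hzp _ k; rw [map_mul] at this; exact this
    · intro y hy
      obtain ⟨y, rfl⟩ := hs y
      have hyR : t ∈ Rad r y := by
        apply hR
        have : φ (y ^ (3 ^ (i-1))) = φ b := by rw [map_pow]; exact hy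
        have h1 : y ^ (3 ^ (i-1)) * b⁻¹ ∈ Subgroup.zpowers c := by
          rw [← hφ1, map_mul, this, map_inv, mul_inv_cancel]
        have h2 := mem_Om1.1 (d.mem_C'.1 h1).1
        rw [mul_pow, inv_pow, mul_inv_eq_one, hb, ← pow_mul, ← pow_succ] at h2
        rw [← h2]; congr 2; omega
      apply mem_Rad_of
      rintro w ⟨x1, y1, e1, e2, hxy⟩
      obtain ⟨y', e3, hy'⟩ := h.lift φ (hRC') e1 hxy
      refine ⟨y, t * y', rfl, ?_, mem_Rad hyR hy'⟩
      rw [map_mul, e3, e2]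

set_option linter.all false

section dg
variable {G : Type*} [CommGroup G] [Fintype G] {r : G → G → Prop} {n : ℕ} {c : G}
  {α : G →* Multiplicative (ZMod 3)}

theorem DG.good_pow (d : DG n c α) (h : SR r) {k : ℕ} (hk : ¬ 3 ∣ k) {x : G} (hx : good r c x) : good r c (x ^ k) := by
  have h1 := h.pow d.pg hk hx.1
  have h2 := h.pow d.pg hk hx.2
  rw [mul_pow] at h1 h2
  have hck : c ^ k = c ∨ c ^ k = c⁻¹ := by
    rcases d.mem_C.1 (pow_mem (Subgroup.mem_zpowers c) k) with e | e
    · exact absurd (d.pow_cop hk e) d.c1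
    · exact e
  rw [inv_pow] at h2
  rcases hck with e | e
  · rw [e] at h1 h2; exact ⟨h1, h2⟩
  · rw [e] at h1 h2; rw [inv_inv] at h2; exact ⟨h2, h1⟩

theorem DG.bad_powc (d : DG n c α) (h : SR r) {k : ℕ} (hk : ¬ 3 ∣ k) {x : G} (hx : ¬ good r c x) : ¬ good r c (x ^ k) := by
  obtain ⟨m, hm, e⟩ := SR.pow_inv_exists d.pg hk
  intro k; apply hx
  have := d.good_pow h hm k
  rwa [e] at this

theorem DG.bad_inv (d : DG n c α) (h : SR r) {x : G} (hx : ¬ good r c x) : ¬ good r c x⁻¹ := by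
  obtain ⟨k, hk, -, e⟩ := d.inv_pow'
  rw [← e]; exact d.bad_powc h hk hx

theorem DG.VC_Om (d : DG n c α) (h : SR r) (hC : RC r (Subgroup.zpowers c)) {y y' : G} {j : ℕ} (hj : 1 ≤ j)
    (hy : ¬ good r c y) (hyj : y ∈ Om G j) (k : r y y') : y' ∈ Om G j := by
  by_contra q
  exact hy ((d.good_rel h hC k).2 (d.O2 h hj hyj q k))

theorem DG.VC_thin (d : DG n c α) (h : SR r) (hC : RC r (Subgroup.zpowers c)) {z : G} {l : ℕ} (hl : 2 ≤ l)
    (hz : ¬ good r c z) (hzl : Lv l z) : thin r c l z :=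
  ⟨hl, hzl, hz, fun y hy => d.VC_Om h hC (by omega) hz hzl.1 hy⟩

theorem DG.VCcount (d : DG n c α) (h : SR r) (hC : RC r (Subgroup.zpowers c)) {z y : G}
    (hy : ¬ good r c y) (hzy : good r c (z * y)) :
    3 ∣ ((cls r z).filter (fun x => ∃ u ∈ Subgroup.zpowers c, r y (u⁻¹ * (x⁻¹ * (z * y))))).card := by
  set C := Subgroup.zpowers c with hCdef
  let k : G → ℕ := fun g => ((fs C).filter (fun u => u⁻¹ * g ∈ cls r y)).card
  have kinv : ∀ u ∈ C, ∀ g, k (u⁻¹ * g) = k g := by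
    intro u hu g
    apply Finset.card_bij (fun v _ => u * v)
    · intro v hv
      rw [Finset.mem_filter, mem_fs] at hv ⊢
      refine ⟨mul_mem hu hv.1, ?_⟩
      rw [mul_inv, mul_comm u⁻¹, mul_assoc]; exact hv.2
    · intro a _ b _ e; exact mul_left_cancel e
    · intro v hv
      rw [Finset.mem_filter, mem_fs] at hv
      refine ⟨u⁻¹ * v, ?_, by simp⟩
      rw [Finset.mem_filter, mem_fs]
      refine ⟨mul_mem (inv_mem hu) hv.1, ?_⟩
      rw [mul_inv, inv_inv, mul_comm u, mul_assoc, mul_inv_cancel_left]; exact hv.2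
  have kcl : ∀ g, r y g → k g = k y := fun g hg => (h.count hC.AS (h.AS_cls y) hg).symm
  have hcard : (fs C).card = 3 := by rw [card_fs]; exact d.card_C
  have k1 : 0 < k y := by
    apply Finset.card_pos.2
    refine ⟨1, ?_⟩
    rw [Finset.mem_filter, mem_fs, mem_cls]
    exact ⟨one_mem _, by simpa using h.refl y⟩
  have k2 : k y < 3 := by
    rw [← hcard]
    apply Finset.card_lt_card
    rw [Finset.filter_ssubset]
    by_contra q
    push Not at q
    apply hy
    have a := q c (by rw [mem_fs]; exact Subgroup.mem_zpowers c)
    have b := q c⁻¹ (by rw [mem_fs]; exact inv_mem (Subgroup.mem_zpowers c))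
    rw [mem_cls] at a b
    rw [inv_inv] at b
    exact ⟨b, a⟩
  have dbl : ∑ u ∈ fs C, ((cls r z).filter (fun x => x⁻¹ * (u⁻¹ * (z * y)) ∈ cls r y)).card
      = ∑ x ∈ cls r z, k (x⁻¹ * (z * y)) := by
    have := Finset.sum_card_bipartiteAbove_eq_sum_card_bipartiteBelow
      (s := fs C) (t := cls r z) (fun u x => x⁻¹ * (u⁻¹ * (z * y)) ∈ cls r y)
    simp only [Finset.bipartiteAbove, Finset.bipartiteBelow] at this
    rw [this]
    apply Finset.sum_congr rfl
    intro x _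
    apply congrArg Finset.card
    apply Finset.filter_congr
    intro u _
    rw [mul_left_comm]
  have lhs : ∑ u ∈ fs C, ((cls r z).filter (fun x => x⁻¹ * (u⁻¹ * (z * y)) ∈ cls r y)).card
      = 3 * ((cls r z).filter (fun x => x⁻¹ * (z * y) ∈ cls r y)).card := by
    rw [Finset.sum_congr rfl (g := fun _ => ((cls r z).filter (fun x => x⁻¹ * (z * y) ∈ cls r y)).card)]
    · rw [Finset.sum_const, hcard, smul_eq_mul]
    · intro u hu
      rw [mem_fs] at hu
      apply h.count (h.AS_cls z) (h.AS_cls y)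
      apply h.symm
      rcases d.mem_C.1 hu with e | e | e <;> rw [e]
      · rw [inv_one, one_mul]; exact h.refl _
      · exact hzy.2
      · rw [inv_inv]; exact hzy.1
  have rhs : ∑ x ∈ cls r z, k (x⁻¹ * (z * y)) =
      ((cls r z).filter (fun x => ∃ u ∈ C, r y (u⁻¹ * (x⁻¹ * (z * y))))).card * k y := by
    rw [← Finset.sum_const_nat (f := fun _ => k y) (fun _ _ => rfl), Finset.sum_filter]
    apply Finset.sum_congr rfl
    intro x _
    split_ifs with q
    · obtain ⟨u, hu, hr⟩ := q
      rw [← kinv u hu, kcl _ hr]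
    · apply Finset.card_eq_zero.2
      rw [Finset.filter_eq_empty_iff]
      intro u hu hm
      rw [mem_fs] at hu
      rw [mem_cls] at hm
      exact q ⟨u, hu, hm⟩
  have tot : 3 ∣ ((cls r z).filter (fun x => ∃ u ∈ C, r y (u⁻¹ * (x⁻¹ * (z * y))))).card * k y := by
    rw [← rhs, ← dbl, lhs]; exact dvd_mul_right _ _
  rcases (Nat.Prime.dvd_mul Nat.prime_three).1 tot with q | q
  · exact q
  · exact absurd (Nat.le_of_dvd k1 q) (by omega)

theorem DG.VC_b1 (d : DG n c α) (h : SR r) (hC : RC r (Subgroup.zpowers c)) {z y : G} {i : ℕ} (hi : 2 ≤ i)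
    (hz : ¬ good r c z) (hzl : Lv i z) (hy : ¬ good r c y) (hyi : y ∈ Om G (i-1)) (a : Multiplicative (ZMod 3))
    (ha : ∀ w, ¬ good r c w → w ^ (3 ^ (i-1)) = z ^ (3 ^ (i-1)) → α w ≠ a) : ¬ good r c (z * y) := by
  intro hg
  have h3 := d.VCcount h hC hy hg
  set B := (cls r z).filter (fun x => ∃ u ∈ Subgroup.zpowers c, r y (u⁻¹ * (x⁻¹ * (z * y)))) with hB
  have hpos : 0 < B.card := Finset.card_pos.2 ⟨z, by
    rw [hB, Finset.mem_filter]
    exact ⟨h.self_mem z, 1, one_mem _, by simpa using h.refl y⟩⟩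
  have hth := d.VC_thin h hC hi hz hzl
  have hsg : ∀ x ∈ B, r z x ∧ x ^ (3 ^ (i-1)) = z ^ (3 ^ (i-1)) := by
    intro x hx
    rw [hB, Finset.mem_filter, mem_cls] at hx
    obtain ⟨hx, u, hu, hr⟩ := hx
    refine ⟨hx, ?_⟩
    have h1 := d.VC_Om h hC (by omega) hy hyi hr
    have h2 : u ∈ Om G (i-1) := Om_mono (by omega) (d.mem_C'.1 hu).1
    have h3 := mul_mem (mul_mem h2 h1) (inv_mem hyi)
    have : u * (u⁻¹ * (x⁻¹ * (z * y))) * y⁻¹ = x⁻¹ * z := by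
      rw [mul_inv_cancel_left, ← mul_assoc, mul_inv_cancel_right]
    rw [this, mem_Om, mul_pow, inv_pow, inv_mul_eq_one] at h3
    exact h3
  have hcard : B.card ≤ ((Finset.univ : Finset (Multiplicative (ZMod 3))).erase a).card := by
    apply Finset.card_le_card_of_injOn α
    · intro x hx
      have q := hsg x hx
      simp only [Finset.coe_erase, Finset.coe_univ, Set.mem_diff, Set.mem_univ, Set.mem_singleton_iff, true_and]
      exact ha x (fun k => hz ((d.good_rel h hC q.1).2 k)) q.2
    · intro x hx x' hx' e
      have q := hsg x hx
      have q' := hsg x' hx'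
      exact (d.bad_det h hi hz hzl q.1 (hth.2.2.2 x q.1) q'.1 (by rw [q.2, q'.2]) e).symm
  have h2 : ((Finset.univ : Finset (Multiplicative (ZMod 3))).erase a).card = 2 := by
    rw [Finset.card_erase_of_mem (Finset.mem_univ a)]; rfl
  have := Nat.le_of_dvd hpos h3
  omega

theorem mz_three (a b x : Multiplicative (ZMod 3)) (hb : b ≠ 1) : x = a ∨ x = a * b ∨ x = a * b⁻¹ := by
  revert a b x; decide

theorem DG.VC_fin (d : DG n c α) (h : SR r) {z : G} {i : ℕ} (hi : 2 ≤ i)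
    (hzl : Lv i z) (H : ∀ a, ∃ w, ¬ good r c w ∧ w ^ (3 ^ (i-1)) = z ^ (3 ^ (i-1)) ∧ α w = a) :
    ∀ x, Lv i x → ¬ good r c x := by
  have same : ∀ x, x ^ (3 ^ (i-1)) = z ^ (3 ^ (i-1)) → ¬ good r c x := by
    intro x hx
    obtain ⟨w, hw, hws, hwa⟩ := H (α x)
    obtain ⟨m, e⟩ := d.orb i hi w x (by rw [hws]; exact d.sg hi hzl) (by rw [hx, hws]) hwa
    rw [e]; exact d.bad_powc h (by omega) hw
  intro x hx
  rcases d.sgE hi hzl hx with k | k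
  · exact same x k
  · have := d.bad_inv h (same x⁻¹ (by rw [inv_pow, k, inv_pow, inv_inv]))
    rwa [inv_inv] at this

theorem DG.VC_all (d : DG n c α) (h : SR r) (hC : RC r (Subgroup.zpowers c)) {z y : G} {i : ℕ} (hi : 2 ≤ i)
    (hz : ¬ good r c z) (hzl : Lv i z) (hy : ¬ good r c y) (hyi : y ∈ Om G (i-1)) (hya : α y ≠ 1) :
    ∀ x, Lv i x → ¬ good r c x := by
  apply d.VC_fin h hi hzl
  by_contra! H
  obtain ⟨a, ha⟩ := H
  have b1 := d.VC_b1 h hC hi hz hzl hy hyi a ha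
  have b2 := d.VC_b1 h hC hi hz hzl (d.bad_inv h hy) (inv_mem hyi) a ha
  have s : ∀ y ∈ Om G (i-1), (z * y) ^ (3 ^ (i-1)) = z ^ (3 ^ (i-1)) := by
    intro y hy; rw [mul_pow, mem_Om.1 hy, mul_one]
  rcases mz_three (α z) (α y) a hya with k | k | k
  · exact ha z hz rfl k.symm
  · exact ha _ b1 (s _ hyi) (by rw [map_mul, k])
  · exact ha _ b2 (s _ (inv_mem hyi)) (by rw [map_mul, map_inv, k])

theorem mz_b2 (a b e x : Multiplicative (ZMod 3)) (hab : a ≠ b) (hae : a ≠ e) (hbe : b ≠ e) (hx : x ≠ e)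
    (h : x * a⁻¹ * b ≠ e) : x = a := by
  revert a b e x; decide

theorem mz_b2' (a b e x : Multiplicative (ZMod 3)) (hab : a ≠ b) (hae : a ≠ e) (hbe : b ≠ e) (hx : x⁻¹ ≠ e)
    (h : (x * a⁻¹ * b)⁻¹ ≠ e) : x = b⁻¹ := by
  have := mz_b2 b a e x⁻¹ hab.symm hbe hae hx (by
    have e1 : (x * a⁻¹ * b)⁻¹ = x⁻¹ * b⁻¹ * a := by simp only [mul_inv, inv_inv]; ac_rfl
    rw [← e1]; exact h)
  rw [← this, inv_inv]

theorem DG.VC_all2 (d : DG n c α) (h : SR r) (hC : RC r (Subgroup.zpowers c)) {z w : G} {i : ℕ} (hi : 2 ≤ i)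
    (hz : ¬ good r c z) (hzl : Lv i z) (hw : ¬ good r c w) (hws : w ^ (3 ^ (i-1)) = z ^ (3 ^ (i-1))) (hwa : α z ≠ α w) :
    ∀ x, Lv i x → ¬ good r c x := by
  by_contra H0
  have H1 : ¬ ∀ a, ∃ w, ¬ good r c w ∧ w ^ (3 ^ (i-1)) = z ^ (3 ^ (i-1)) ∧ α w = a :=
    fun H => H0 (d.VC_fin h hi hzl H)
  push Not at H1
  obtain ⟨a, ha⟩ := H1
  have hth := d.VC_thin h hC hi hz hzl
  have hbad : ¬ good r c (z * w⁻¹) := by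
    intro hg
    have h3 := d.VCcount h hC (d.bad_inv h hw) hg
    set B := (cls r z).filter (fun x => ∃ u ∈ Subgroup.zpowers c, r w⁻¹ (u⁻¹ * (x⁻¹ * (z * w⁻¹)))) with hB
    have hpos : 0 < B.card := Finset.card_pos.2 ⟨z, by
      rw [hB, Finset.mem_filter]
      exact ⟨h.self_mem z, 1, one_mem _, by simpa using h.refl _⟩⟩
    have prop : ∀ x ∈ B, r z x ∧ (x ^ (3 ^ (i-1)) = z ^ (3 ^ (i-1)) → α x = α z) ∧
        (x ^ (3 ^ (i-1)) = z⁻¹ ^ (3 ^ (i-1)) → α x = (α w)⁻¹) := by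
      intro x hx
      rw [hB, Finset.mem_filter, mem_cls] at hx
      obtain ⟨hx, u, hu, hr⟩ := hx
      refine ⟨hx, ?_⟩
      have hxb : ¬ good r c x := fun k => hz ((d.good_rel h hC hx).2 k)
      have hr' := h.inv hr
      rw [inv_inv] at hr'
      have ev : (u⁻¹ * (x⁻¹ * (z * w⁻¹)))⁻¹ = u * (x * z⁻¹ * w) := by
        simp only [mul_inv, inv_inv]; ac_rfl
      rw [ev] at hr'
      have hvb : ¬ good r c (u * (x * z⁻¹ * w)) := fun k => hw ((d.good_rel h hC hr').2 k)
      have hC' := d.mem_C'.1 hu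
      have hva : α (u * (x * z⁻¹ * w)) = α x * (α z)⁻¹ * α w := by
        rw [map_mul, hC'.2, one_mul, map_mul, map_mul, map_inv]
      have hvs : (u * (x * z⁻¹ * w)) ^ (3 ^ (i-1)) = x ^ (3 ^ (i-1)) := by
        rw [sgn_E hi hC'.1, mul_pow, mul_pow, hws, inv_pow]; simp
      constructor
      · intro k
        apply mz_b2 (α z) (α w) a (α x) hwa (ha z hz rfl) (ha w hw hws) (ha x hxb k)
        rw [← hva]; exact ha _ hvb (by rw [hvs, k])
      · intro k
        have k' : x⁻¹ ^ (3 ^ (i-1)) = z ^ (3 ^ (i-1)) := by rw [inv_pow, k, inv_pow, inv_inv]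
        apply mz_b2' (α z) (α w) a (α x) hwa (ha z hz rfl) (ha w hw hws)
        · rw [← map_inv]; exact ha _ (d.bad_inv h hxb) k'
        · rw [← hva, ← map_inv]; exact ha _ (d.bad_inv h hvb) (by rw [inv_pow, hvs, ← inv_pow, k'])
    have hcard : B.card ≤ ({z ^ (3 ^ (i-1)), z⁻¹ ^ (3 ^ (i-1))} : Finset G).card := by
      apply Finset.card_le_card_of_injOn (fun x => x ^ (3 ^ (i-1)))
      · intro x hx
        have q := (prop x hx).1
        have := d.sgE hi hzl (d.bad_min h hi hz hzl q (hth.2.2.2 x q))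
        simpa using this
      · intro x hx x' hx' e
        have q := prop x hx
        have q' := prop x' hx'
        apply (d.bad_det h hi hz hzl q.1 (hth.2.2.2 x q.1) q'.1 e.symm ?_).symm
        have e' : x ^ (3 ^ (i-1)) = x' ^ (3 ^ (i-1)) := e
        rcases d.sgE hi hzl (d.bad_min h hi hz hzl q.1 (hth.2.2.2 x q.1)) with k | k
        · rw [q.2.1 k, q'.2.1 (by rw [← e', k])]
        · rw [q.2.2 k, q'.2.2 (by rw [← e', k])]
    have := Nat.le_of_dvd hpos h3
    have := hcard.trans Finset.card_le_two
    omega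
  apply H0
  apply d.VC_all h hC hi hz hzl hbad
  · rw [mem_Om, mul_pow, inv_pow, hws, mul_inv_cancel]
  · rw [map_mul, map_inv, Ne, mul_inv_eq_one]; exact hwa

/-- elements of order 3 in a cyclic group of level at least two -/
theorem DG.cyc (d : DG n c α) {z t : G} {i : ℕ} (hi : 2 ≤ i) (hzl : Lv i z) (ht : t ∈ Subgroup.zpowers z)
    (htE : t ∈ Om G (i-1)) : α t = 1 := by
  obtain ⟨k, rfl⟩ := (Submonoid.mem_powers_iff _ _).1 (mem_powers_iff_mem_zpowers.2 ht)
  by_cases hk : 3 ∣ k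
  · obtain ⟨k, rfl⟩ := hk
    rw [mul_comm, pow_mul, α_cube]
  · exact absurd htE (d.Lv_pow hk hzl).2

theorem DG.mainAC (d : DG n c α) (h : SR r) (hA : ∀ y, r c y → y ∈ Om G 1) (hV : hull r c = Subgroup.zpowers c)
    {x0 g0 : G} (hx0 : Lv n x0) (hg0 : g0 ∈ Rad r x0) (hg1 : g0 ≠ 1) : Goal r := by
  have hC : RC r (Subgroup.zpowers c) := hV ▸ d.RC_hull h
  have hn2 := d.n2
  have hbot : Subgroup.zpowers c ≠ ⊥ := by rw [Ne, Subgroup.zpowers_eq_bot]; exact d.c1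
  by_cases hx0b : good r c x0
  swap
  · obtain ⟨t, htE, hta, -, hHA, hR⟩ := d.caseA h (d.VC_thin h hC hn2 hx0b hx0) hg0 hg1
    exact d.F h htE hta hn2 le_rfl hHA (fun y hy => hR y ⟨mem_Om.2 (d.exp y), hy⟩) hx0
  set N : Set G := {x | ¬ good r c x} with hN
  set U := Subgroup.closure N with hU
  have hRCU : RC r U := h.RC_closure (fun x y hxy hx k => hx ((d.good_rel h hC hxy).2 k))
  have cN : c ∈ N := by
    rintro ⟨-, k⟩
    rw [inv_mul_cancel] at k
    exact d.c1 (h.one' k)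
  have hCU : Subgroup.zpowers c ≤ U := by
    rw [Subgroup.zpowers_le]; exact Subgroup.subset_closure cN
  have hout : ∀ x, x ∉ U → ∀ l ∈ Subgroup.zpowers c, r x (l * x) := by
    intro x hx l hl
    have : good r c x := by
      by_contra k; exact hx (Subgroup.subset_closure k)
    have hle := d.good_Rad h (z := x) (fun y hy => (d.good_rel h hC hy).1 this)
    rw [hV] at hle
    exact h.mem_Rad' (hle hl)
  obtain ⟨i, ⟨hi1, hin, z0, hz0, hz0l⟩, hmax⟩ : ∃ i, (1 ≤ i ∧ i ≤ n ∧ ∃ z, ¬ good r c z ∧ Lv i z) ∧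
      ∀ l, (1 ≤ l ∧ l ≤ n ∧ ∃ z, ¬ good r c z ∧ Lv l z) → l ≤ i := by
    have hc1 : (1 ≤ 1 ∧ 1 ≤ n ∧ ∃ z, ¬ good r c z ∧ Lv 1 z) :=
      ⟨le_rfl, by omega, c, cN, d.cE, by
        show c ∉ Om G 0
        rw [mem_Om0]; exact d.c1⟩
    refine ⟨Nat.findGreatest (fun l => 1 ≤ l ∧ l ≤ n ∧ ∃ z, ¬ good r c z ∧ Lv l z) n, ?_, ?_⟩
    · exact Nat.findGreatest_spec (P := fun l => 1 ≤ l ∧ l ≤ n ∧ ∃ z, ¬ good r c z ∧ Lv l z) hc1.2.1 hc1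
    · intro l hl
      exact Nat.le_findGreatest hl.2.1 hl
  have hNi : ∀ x, ¬ good r c x → x ∈ Om G i := by
    intro x hx
    by_cases h1 : x = 1
    · rw [h1]; exact one_mem _
    · obtain ⟨l, hl1, hln, hl⟩ := d.exists_Lv h1
      exact Om_mono (hmax l ⟨hl1, hln, x, hx, hl⟩) hl.1
  have hUi : U ≤ Om G i := by
    rw [hU, Subgroup.closure_le]; exact fun x hx => hNi x hx
  rcases Nat.lt_or_ge i 2 with hi2 | hi2
  · obtain rfl : i = 1 := by omega
    refine ⟨Subgroup.zpowers c, U, hC, hRCU, hCU, hbot, ?_, hout, ?_⟩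
    · intro k
      apply hx0.2
      apply Om_mono (show 1 ≤ n - 1 by omega)
      apply hUi; rw [k]; trivial
    · have c1 := Subgroup.card_dvd_of_le hUi
      have c2 := Subgroup.card_dvd_of_le hCU
      rw [d.card_E] at c1
      rw [d.card_C] at c2 ⊢
      have : Nat.card U ≤ 9 := Nat.le_of_dvd (by norm_num) c1
      interval_cases Nat.card U <;> omega
  have hth0 := d.VC_thin h hC hi2 hz0 hz0l
  by_cases hcyc : ∀ x, ¬ good r c x → x ∈ Subgroup.zpowers z0
  · have hUz : U = Subgroup.zpowers z0 := by
      apply le_antisymm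
      · rw [hU, Subgroup.closure_le]; exact fun x hx => hcyc x hx
      · rw [Subgroup.zpowers_le]; exact Subgroup.subset_closure hz0
    refine ⟨Subgroup.zpowers c, U, hC, hRCU, hCU, hbot, ?_, hout, ?_⟩
    · intro k
      obtain ⟨t, ht, hta⟩ := d.ext
      apply hta
      apply d.cyc hi2 hz0l
      · rw [← hUz, k]; trivial
      · exact Om_mono (by omega) (mem_Om1.2 ht)
    · right; right
      refine ⟨?_, d.card_C⟩
      intro x hx hxo g hg
      have hxl := exp_Lv hi1 hUi (Subgroup.subset_closure hz0) hz0l hx hxo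
      by_contra hg1
      have hxb : ¬ good r c x := by
        rw [hUz] at hx
        obtain ⟨k, rfl⟩ := (Submonoid.mem_powers_iff _ _).1 (mem_powers_iff_mem_zpowers.2 hx)
        apply d.bad_powc h _ hz0
        rintro ⟨k, rfl⟩
        apply hxl.2
        rw [mem_Om, ← pow_mul, show 3 * k * 3 ^ (i-1) = 3 ^ (i - 1 + 1) * k by rw [pow_succ]; ring, pow_mul,
          show i - 1 + 1 = i by omega, mem_Om.1 hz0l.1, one_pow]
      have hxt := d.VC_thin h hC hi2 hxb hxl
      obtain ⟨t, htE, hta, -, hHA, hR⟩ := d.caseA h hxt hg hg1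
      have h1 := h.mem_Rad' (hR x hxl)
      have h2 := hRCU _ _ h1 hx
      have h3 : t ∈ U := by
        have := mul_mem h2 (inv_mem hx); simpa using this
      rw [hUz] at h3
      exact hta (d.cyc hi2 hz0l h3 (Om_mono (by omega) htE))
  · push Not at hcyc
    obtain ⟨y, hy, hyz⟩ := hcyc
    have hall : ∀ x, Lv i x → ¬ good r c x := by
      by_cases hyl : y ∈ Om G (i-1)
      · by_cases hya : α y = 1
        · exfalso
          apply hyz
          by_cases hy1 : y ∈ Om G 1
          · have : y ∈ Subgroup.zpowers c := d.mem_C'.2 ⟨hy1, hya⟩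
            apply (Subgroup.zpowers_le.2 _) this
            have hz := Subgroup.pow_mem _ (Subgroup.mem_zpowers z0) (3 ^ (i-1))
            rcases d.sg hi2 hz0l with k | k <;> rw [k] at hz
            · exact hz
            · simpa using hz
          · obtain ⟨j, hj1, hjn, hjl⟩ := d.exists_Lv2 hy1
            have hji : j ≤ i - 1 := DG.Lv_unique hjl hyl
            set w := z0 ^ (3 ^ (i - j)) with hw
            have hwz : w ∈ Subgroup.zpowers z0 := Subgroup.pow_mem _ (Subgroup.mem_zpowers z0) _
            have hws : w ^ (3 ^ (j-1)) = z0 ^ (3 ^ (i-1)) := by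
              rw [hw, ← pow_mul, ← pow_add]; congr 2; omega
            have hwa : α w = 1 := α_pow3 α z0 (by omega)
            have hwl : Lv j w := by
              constructor
              · rw [hw, pow_mem_Om, show i - j + j = i by omega]; exact hz0l.1
              · rw [hw, pow_mem_Om, show i - j + (j - 1) = i - 1 by omega]; exact hz0l.2
            rcases d.sgE hj1 hwl hjl with k | k
            · obtain ⟨m, e⟩ := d.orb j hj1 w y (d.sg hj1 hwl) k (by rw [hwa, hya])
              rw [e]; exact pow_mem hwz _
            · obtain ⟨m, e⟩ := d.orb j hj1 w y⁻¹ (d.sg hj1 hwl) (by rw [inv_pow, k, inv_pow, inv_inv]) (by rw [hwa, map_inv, hya, inv_one])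
              have : y⁻¹ ∈ Subgroup.zpowers z0 := by rw [e]; exact pow_mem hwz _
              simpa using this
        · exact d.VC_all h hC hi2 hz0 hz0l hy hyl hya
      · have hyl' : Lv i y := ⟨hNi y hy, hyl⟩
        have main : ∀ y, ¬ good r c y → y ∉ Subgroup.zpowers z0 → y ^ (3 ^ (i-1)) = z0 ^ (3 ^ (i-1)) → ∀ x, Lv i x → ¬ good r c x := by
          intro y hy hyz k
          apply d.VC_all2 h hC hi2 hz0 hz0l hy k
          intro e
          obtain ⟨m, e⟩ := d.orb i hi2 z0 y (d.sg hi2 hz0l) k e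
          apply hyz; rw [e]; exact pow_mem (Subgroup.mem_zpowers z0) _
        rcases d.sgE hi2 hz0l hyl' with k | k
        · exact main y hy hyz k
        · exact main y⁻¹ (d.bad_inv h hy) (by simpa using hyz) (by rw [inv_pow, k, inv_pow, inv_inv])
    have hin' : i < n := by
      rcases Nat.lt_or_ge i n with k | k
      · exact k
      · obtain rfl : i = n := by omega
        exact absurd hx0b (hall x0 hx0)
    have hUO : U = Om G i := by
      apply le_antisymm hUi
      intro x hx
      by_cases hxl : x ∈ Om G (i-1)
      · have : Lv i (x * z0) := ⟨mul_mem hx hz0l.1, fun k => hz0l.2 ((Subgroup.mul_mem_cancel_left _ hxl).1 k)⟩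
        have h1 : x * z0 ∈ U := Subgroup.subset_closure (hall _ this)
        have h2 : z0 ∈ U := Subgroup.subset_closure hz0
        exact (Subgroup.mul_mem_cancel_right _ h2).1 h1
      · exact Subgroup.subset_closure (hall x ⟨hx, hxl⟩)
    by_cases htriv : ∀ x, Lv i x → ∀ g ∈ Rad r x, g = 1
    · refine ⟨Subgroup.zpowers c, U, hC, hRCU, hCU, hbot, ?_, hout, Or.inr (Or.inr ⟨?_, d.card_C⟩)⟩
      · intro k
        apply hx0.2
        apply Om_mono (show i ≤ n - 1 by omega)
        apply hUi; rw [k]; trivial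
      · intro x hx hxo g hg
        exact htriv x (exp_Lv hi1 hUi (Subgroup.subset_closure hz0) hz0l hx hxo) g hg
    · push Not at htriv
      obtain ⟨x, hxl, g, hg, hg1⟩ := htriv
      obtain ⟨t, htE, hta, -, hHA, hR⟩ := d.caseA h (d.VC_thin h hC hi2 (hall x hxl) hxl) hg hg1
      refine d.F h htE hta hi2 hin hHA ?_ hx0
      intro y hy
      by_cases hyi : y ∈ Om G i
      · exact hR y ⟨hyi, hy⟩
      · refine d.P h hi1 hin' htE hta hHA ?_ y hyi
        intro w hw
        apply hR
        apply d.Lv_lin hi2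
        · rw [mem_Om, show i = i - 1 + 1 by omega, pow_succ, pow_mul, hw, d.c3]
        · rw [hw]; exact d.c1

/-- Case A -/
theorem DG.mainA (d : DG n c α) (h : SR r) (hA : ∀ y, r c y → y ∈ Om G 1)
    {x0 g0 : G} (hx0 : Lv n x0) (hg0 : g0 ∈ Rad r x0) (hg1 : g0 ≠ 1) : Goal r := by
  rcases d.hullA h hA with k | ⟨k, g, hg, hgE, hga⟩
  · exact d.mainAC h hA k hx0 hg0 hg1
  · exact d.mainAE h hA k hg hgE hga hx0
end dg

set_option linter.all false

section dg
variable {G : Type*} [CommGroup G] [Fintype G] {r : G → G → Prop} {n : ℕ} {c : G}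
  {α : G →* Multiplicative (ZMod 3)}

theorem DG.CZ (d : DG n c α) (h : SR r) {j : ℕ} {z : G} (hz : thin r c j z) :
    AS r (Finset.univ.filter (fun x => ∃ s ∈ Subgroup.zpowers c, r z (s * x))) := by
  have hz' := hz
  obtain ⟨hj, hzl, hb, hO⟩ := hz
  intro x y hxy hx
  rw [Finset.mem_filter] at hx ⊢
  obtain ⟨-, s, hs, hr⟩ := hx
  refine ⟨Finset.mem_univ _, ?_⟩
  have hzl' : Lv j (s * x) := (d.thin_rel h hz' hr).2.1
  obtain ⟨u, hu⟩ : ∃ u : ℕ, ((s * x) ^ (3 ^ (j-1))) ^ u = s⁻¹ := by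
    have : s⁻¹ ∈ Subgroup.zpowers ((s * x) ^ (3 ^ (j-1))) := by
      rcases d.sg hj hzl' with k | k <;> rw [k]
      · exact inv_mem hs
      · rw [Subgroup.zpowers_inv]; exact inv_mem hs
    exact (Submonoid.mem_powers_iff _ _).1 (mem_powers_iff_mem_zpowers.2 this)
  have hk : ¬ 3 ∣ 1 + 3 ^ (j-1) * u := by
    rw [show 3 ^ (j-1) = 3 * 3 ^ (j-2) by rw [← pow_succ']; congr 1; omega, mul_assoc]; omega
  have ex : (s * x) ^ (1 + 3 ^ (j-1) * u) = x := by
    rw [pow_add, pow_one, pow_mul, hu]; simp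
  obtain ⟨m, hm, e⟩ := SR.pow_inv_exists d.pg hk
  have hy' := h.pow d.pg hm hxy
  have hxm : x ^ m = s * x := by conv_lhs => rw [← ex, e]
  rw [hxm] at hy'
  have hzy := h.trans hr hy'
  have hyl : Lv j (y ^ m) := (d.thin_rel h hz' hzy).2.1
  have ey : y = (y ^ m) * ((y ^ m) ^ (3 ^ (j-1))) ^ u := by
    have := e y
    rw [← pow_mul, mul_comm _ m, pow_mul, pow_add, pow_one, pow_mul] at this
    exact this.symm
  refine ⟨(((y ^ m) ^ (3 ^ (j-1))) ^ u)⁻¹, inv_mem (pow_mem ?_ u), ?_⟩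
  · rcases d.sg hj hyl with k | k <;> rw [k]
    · exact Subgroup.mem_zpowers c
    · exact inv_mem (Subgroup.mem_zpowers c)
  · have : (((y ^ m) ^ (3 ^ (j-1))) ^ u)⁻¹ * y = y ^ m := by
      rw [inv_mul_eq_iff_eq_mul, mul_comm]; exact ey
    rw [this]; exact hzy

theorem DG.thinNo (d : DG n c α) (h : SR r) {v : G} (hv : v ∈ hull r c) (hvl : Lv 2 v) {j : ℕ} {z : G}
    (hz : thin r c j z) : False := by
  have hz' := hz
  obtain ⟨hj, hzl, hb, hO⟩ := hz
  set X := Finset.univ.filter (fun x => ∃ s ∈ Subgroup.zpowers c, r z (s * x)) with hX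
  have mX : ∀ x, x ∈ X ↔ ∃ s ∈ Subgroup.zpowers c, r z (s * x) := by intro x; simp [hX]
  have hAS := d.CZ h hz'
  have hcX : c ∈ stab X := by
    apply mem_stab_of
    intro y hy
    rw [mX] at hy ⊢
    obtain ⟨s, hs, k⟩ := hy
    exact ⟨s * c⁻¹, mul_mem hs (inv_mem (Subgroup.mem_zpowers c)), by rw [← mul_assoc]; simpa using k⟩
  have hVX : hull r c ≤ stab X := d.hull_le (h.RC_stab hAS) hcX
  have zX : z ∈ X := by rw [mX]; exact ⟨1, one_mem _, by simpa using h.refl z⟩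
  have Xl : ∀ x ∈ X, x ∉ Om G (j-1) := by
    intro x hx k
    rw [mX] at hx
    obtain ⟨s, hs, hr⟩ := hx
    exact (d.thin_rel h hz' hr).2.1.2 (mul_mem (Om_mono (by omega) (d.mem_C'.1 hs).1) k)
  have hlow : ∀ w ∈ hull r c, ¬ Lv j w := by
    intro w hw hwl
    rcases d.sgE hj hzl hwl with k | k
    · have := ((mem_stab.1 (hVX (inv_mem hw))) z).1 zX
      apply Xl _ this
      rw [mem_Om, mul_pow, inv_pow, k, inv_mul_cancel]
    · have := ((mem_stab.1 (hVX hw)) z).1 zX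
      apply Xl _ this
      rw [mem_Om, mul_pow, k, inv_pow, inv_mul_cancel]
  have hj3 : 3 ≤ j := by
    rcases Nat.lt_or_ge 2 j with k | k
    · exact k
    · obtain rfl : j = 2 := by omega
      exact absurd hvl (hlow v hv)
  set w := z ^ (3 ^ (j-2)) with hw
  have hwl : Lv 2 w := by
    constructor
    · rw [hw, pow_mem_Om, show j - 2 + 2 = j by omega]; exact hzl.1
    · rw [hw, pow_mem_Om, show j - 2 + (2-1) = j - 1 by omega]; exact hzl.2
  have hwa : α w = 1 := α_pow3 α z (by omega)
  have hwX : w ∈ stab X := by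
    by_cases hF : ∃ z', r z z' ∧ ∃ F : Subgroup G, RC r F ∧ (∀ f ∈ F, α f = 1) ∧ z' ^ 3 ∈ F
    · obtain ⟨z', hzz, F, hRF, hFa, hzF⟩ := hF
      have hzl' : Lv j z' := (d.thin_rel h hz' hzz).2.1
      have hp : z' ^ (3 ^ (j-1)) ∈ F := by
        have : 3 ^ (j - 1) = 3 * 3 ^ (j - 2) := by rw [← pow_succ']; congr 1; omega
        rw [this, pow_mul]; exact pow_mem hzF _
      have hc : c ∈ F := by
        rcases d.sg hj hzl' with k | k <;> rw [k] at hp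
        · exact hp
        · simpa using hp
      have hva : α v = 1 := hFa _ (d.hull_le hRF hc hv)
      rcases d.sgE le_rfl hvl hwl with k | k
      · obtain ⟨m, e⟩ := d.orb 2 le_rfl v w (d.sg le_rfl hvl) k (by rw [hwa, hva])
        rw [e]; exact pow_mem (hVX hv) _
      · obtain ⟨m, e⟩ := d.orb 2 le_rfl v⁻¹ w (d.sg le_rfl (Lv_inv hvl)) k (by rw [hwa, map_inv, hva, inv_one])
        rw [e]; exact pow_mem (hVX (inv_mem hv)) _
    · have hEX : Om G 1 ≤ stab X := by
        intro q hq
        apply mem_stab_of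
        intro y hy
        rw [mX] at hy ⊢
        obtain ⟨s, hs, k⟩ := hy
        rcases d.thin_cube h (d.thin_rel h hz' k) with k' | k'
        · exact absurd ⟨_, k, k'⟩ hF
        · obtain ⟨e, he, hea, her⟩ := k' (α q)
          have hC : e * q⁻¹ ∈ Subgroup.zpowers c := d.mem_C'.2 ⟨mul_mem he (inv_mem hq), by simp [hea]⟩
          refine ⟨(e * q⁻¹) * s, mul_mem hC hs, ?_⟩
          rw [show e * q⁻¹ * s * (q * y) = q⁻¹ * q * (e * (s * y)) by ac_rfl, inv_mul_cancel, one_mul]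
          exact h.trans k her
      obtain ⟨t, ht, hta⟩ := d.ext
      obtain ⟨s, k, -, e⟩ := d.adj le_rfl (mem_Om1.2 ht) hta hvl hwl
      rw [e]
      exact mul_mem (pow_mem (hEX (mem_Om1.2 ht)) s) (pow_mem (hVX hv) k)
  have hwz := ((mem_stab.1 hwX) z).1 zX
  rw [mX] at hwz
  obtain ⟨s, hs, hr⟩ := hwz
  obtain ⟨u, hu⟩ : ∃ u : ℕ, (z ^ (3 ^ (j-1))) ^ u = s := by
    have : s ∈ Subgroup.zpowers (z ^ (3 ^ (j-1))) := by
      rcases d.sg hj hzl with k | k <;> rw [k]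
      · exact hs
      · rw [Subgroup.zpowers_inv]; exact hs
    exact (Submonoid.mem_powers_iff _ _).1 (mem_powers_iff_mem_zpowers.2 this)
  have e1 : s * (w * z) = z ^ (1 + 3 * (3 ^ (j-3) + 3 ^ (j-2) * u)) := by
    have : 1 + 3 * (3 ^ (j-3) + 3 ^ (j-2) * u) = 3 ^ (j-1) * u + (3 ^ (j-2) + 1) := by
      rw [show 3 ^ (j-1) = 3 * 3 ^ (j-2) by rw [← pow_succ']; congr 1; omega,
        show 3 ^ (j-2) = 3 * 3 ^ (j-3) by rw [← pow_succ']; congr 1; omega]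
      ring
    rw [this, pow_add, pow_mul, hu, pow_succ]
  rw [e1] at hr
  have e2 := d.bad_pow h hj hb hzl (h.refl z) hzl.1 hr
  rw [← e1, ← mul_assoc] at e2
  have e3 : s * w = 1 := by simpa using e2
  apply hwl.2
  rw [eq_inv_of_mul_eq_one_right e3]
  exact inv_mem (d.mem_C'.1 hs).1

/-- the basic double counting -/
theorem DG.cnt (d : DG n c α) (h : SR r) {W : Subgroup G} (hT : ∀ g, r c g ↔ g ∈ hull r c ∧ g ∉ W) (z : G) :
    (cls r z).card + (cls r c).card * ov (cls r z) c ≤ (cls r z).card * cc (cls r z) (hull r c) z := by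
  rw [← h.sum_ov z (d.RC_hull h)]
  have h1 : ov (cls r z) 1 = (cls r z).card := ov_eq_card.2 (one_mem _)
  have h2 : (cls r c).card * ov (cls r z) c = ∑ g ∈ cls r c, ov (cls r z) g := by
    rw [Finset.sum_const_nat (m := ov (cls r z) c)]
    intro g hg
    exact (h.ov_eq (h.AS_cls z) (mem_cls.1 hg)).symm
  have h1T : (1 : G) ∉ cls r c := by
    rw [mem_cls]; intro k; exact d.c1 (h.one' k)
  rw [h2, ← h1, ← Finset.sum_insert h1T]
  apply Finset.sum_le_sum_of_subset
  intro g hg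
  rw [mem_fs]
  rcases Finset.mem_insert.1 hg with k | k
  · rw [k]; exact one_mem _
  · exact ((hT g).1 (mem_cls.1 k)).1

theorem DG.T8 (d : DG n c α) (h : SR r) {W : Subgroup G} (hWE : W ≤ Om G 1) (hT : ∀ g, r c g ↔ g ∈ hull r c ∧ g ∉ W)
    {v : G} (hv : v ∈ hull r c) (hvl : Lv 2 v) : 8 ≤ (cls r c).card := by
  have hcW : c ∉ W := ((hT c).1 (h.refl c)).2
  have sub : (fs (Subgroup.zpowers v)).erase 1 ⊆ cls r c := by
    intro x hx
    rw [Finset.mem_erase, mem_fs] at hx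
    rw [mem_cls, hT]
    refine ⟨(Subgroup.zpowers_le.2 hv) hx.2, fun hW => ?_⟩
    have hxE := hWE hW
    have hxa : α x = 1 := d.cyc le_rfl hvl hx.2 hxE
    have hxC : x ∈ Subgroup.zpowers c := d.mem_C'.2 ⟨hxE, hxa⟩
    have := gen3 d.c3 hxC hx.1
    exact hcW ((Subgroup.zpowers_le.2 hW) this)
  have ho : orderOf v = 3 ^ 2 := by
    haveI : Fact (Nat.Prime 3) := ⟨by norm_num⟩
    apply orderOf_eq_prime_pow (n := 1)
    · intro k; exact hvl.2 (mem_Om.2 k)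
    · exact mem_Om.1 hvl.1
  have := Finset.card_le_card sub
  rw [Finset.card_erase_of_mem (by rw [mem_fs]; exact one_mem _), card_fs, Nat.card_zpowers, ho] at this
  exact this

theorem DG.three_cc (d : DG n c α) (h : SR r) {z y : G} (hzy : r z y) (hg : good r c y) :
    3 ≤ cc (cls r z) (hull r c) z := by
  rw [h.cc_eq (h.AS_cls z) (d.RC_hull h) hzy]
  have hc := d.c_hull h
  apply d.three_le (x := y)
  · rw [Finset.mem_filter, mem_cls]; exact ⟨hzy, by simpa using one_mem _⟩
  · rw [Finset.mem_filter, mem_cls]; exact ⟨h.trans hzy hg.1, by simpa using hc⟩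
  · rw [Finset.mem_filter, mem_cls]; exact ⟨h.trans hzy hg.2, by simpa using hc⟩

/-- bad elements of the class of a low element stay low -/
theorem DG.D1_low (d : DG n c α) (h : SR r) {j : ℕ} (hj : 1 ≤ j) {z : G} (hz : z ∈ Om G j) :
    ∀ x ∈ (cls r z).filter (fun x => c * x ∉ cls r z), r z x ∧ x ∈ Om G j ∧ ¬ r z (c * x) := by
  intro x hx
  rw [Finset.mem_filter, mem_cls, mem_cls] at hx
  refine ⟨hx.1, ?_, hx.2⟩
  by_contra k
  exact hx.2 (h.trans hx.1 (d.O2 h hj hz k hx.1).1)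

theorem DG.mixNo (d : DG n c α) (h : SR r) {W : Subgroup G} (hWE : W ≤ Om G 1) (hT : ∀ g, r c g ↔ g ∈ hull r c ∧ g ∉ W)
    {v : G} (hv : v ∈ hull r c) (hvl : Lv 2 v) {z : G} {j : ℕ} (hj : 2 ≤ j) (hz : ¬ good r c z) (hzl : Lv j z)
    (hV : hull r c ≤ Om G (j-1)) : False := by
  obtain ⟨y, hzy, hyj⟩ : ∃ y, r z y ∧ y ∉ Om G j := by
    by_contra! k
    exact d.thinNo h hv hvl ⟨hj, hzl, hz, k⟩
  have hyg := d.O2 h (by omega) hzl.1 hyj hzy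
  have h8 := d.T8 h hWE hT hv hvl
  have hcnt := d.cnt h hT z
  have hov := card_sub_ov (cls r z) c
  set D := (cls r z).filter (fun x => c * x ∉ cls r z) with hD
  have hDl := d.D1_low h (show 1 ≤ j by omega) hzl.1
  have h6 : D.card ≤ 6 := d.card_six h hj hz hzl D (fun x hx => ⟨(hDl x hx).1, (hDl x hx).2.1⟩)
  have hm3 : cc (cls r z) (hull r c) z ≤ 3 := by
    have key : ∀ x ∈ (cls r z).filter (fun x => x⁻¹ * z ∈ hull r c), r z x ∧ x ^ (3 ^ (j-1)) = z ^ (3 ^ (j-1)) ∧ x ∈ Om G j := by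
      intro x hx
      rw [Finset.mem_filter, mem_cls] at hx
      have := hV hx.2
      refine ⟨hx.1, ?_, ?_⟩
      · rw [mem_Om, mul_pow, inv_pow, inv_mul_eq_one] at this; exact this
      · have h1 := Om_mono (show j - 1 ≤ j by omega) this
        have := mul_mem hzl.1 (inv_mem h1)
        simpa using this
    apply d.card_sign h hj hz hzl
    · intro x hx; exact ⟨(key x hx).1, (key x hx).2.2⟩
    · intro x hx y hy; rw [(key x hx).2.1, (key y hy).2.1]
  have hD3 : D.card + 3 ≤ (cls r z).card := by
    have sub : 3 ≤ ((cls r z) \ D).card := by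
      have h1 : r z (c * y) := h.trans hzy hyg.1
      have h2 : r z (c⁻¹ * y) := h.trans hzy hyg.2
      apply d.three_le (x := y)
      · rw [Finset.mem_sdiff, hD, Finset.mem_filter, mem_cls, mem_cls]; exact ⟨hzy, fun k => k.2 h1⟩
      · rw [Finset.mem_sdiff, hD, Finset.mem_filter, mem_cls, mem_cls]; exact ⟨h1, fun k => k.2 (by rw [← mul_assoc, d.c2]; exact h2)⟩
      · rw [Finset.mem_sdiff, hD, Finset.mem_filter, mem_cls, mem_cls]; exact ⟨h2, fun k => k.2 (by simpa using hzy)⟩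
    have hsub : D ⊆ cls r z := by rw [hD]; exact Finset.filter_subset _ _
    have := Finset.card_sdiff_add_card_eq_card hsub
    omega
  have a1 : 8 * ov (cls r z) c ≤ (cls r c).card * ov (cls r z) c := Nat.mul_le_mul_right _ h8
  have a2 : (cls r z).card * cc (cls r z) (hull r c) z ≤ (cls r z).card * 3 := Nat.mul_le_mul_left _ hm3
  omega

/-- Case C -/
theorem DG.mainC (d : DG n c α) (h : SR r) {W : Subgroup G} (hWE : W ≤ Om G 1) (hWV : W ≤ hull r c) (hT : ∀ g, r c g ↔ g ∈ hull r c ∧ g ∉ W)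
    {v : G} (hv : v ∈ hull r c) (hvl : Lv 2 v) (hEV : Om G 1 ≤ hull r c)
    {x0 g0 : G} (hx0 : Lv n x0) (hg0 : g0 ∈ Rad r x0) (hg1 : g0 ≠ 1) : Goal r := by
  have hRCV := d.RC_hull h
  have hgood : ∀ z, z ∉ hull r c → good r c z := by
    intro z hz
    by_contra hb
    obtain ⟨j, hj, hjn, hzl⟩ := d.exists_Lv2 (fun k => hz (hEV k))
    apply d.mixNo h hWE hT hv hvl hj hb hzl
    intro w hw
    by_contra k
    have hw1 : w ∉ Om G 1 := fun k' => k (Om_mono (by omega) k')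
    obtain ⟨l, hl, hln, hwl⟩ := d.exists_Lv2 hw1
    have hjl : j ≤ l := by
      by_contra q
      exact k (Om_mono (by omega) hwl.1)
    have hul : Lv j (w ^ (3 ^ (l - j))) := by
      constructor
      · rw [pow_mem_Om, show l - j + j = l by omega]; exact hwl.1
      · rw [pow_mem_Om, show l - j + (j-1) = l - 1 by omega]; exact hwl.2
    obtain ⟨t, ht, hta⟩ := d.ext
    obtain ⟨s, k, -, e⟩ := d.adj hj (mem_Om1.2 ht) hta hul hzl
    apply hz
    rw [e]
    exact mul_mem (pow_mem (hEV (mem_Om1.2 ht)) s) (pow_mem (pow_mem hw _) k)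
  have hRad : ∀ z, z ∉ hull r c → hull r c ≤ Rad r z := by
    intro z hz
    apply d.good_Rad h
    intro y hy
    exact hgood y (fun k => hz (hRCV _ _ (h.symm hy) k))
  have hcb : ∀ K : Subgroup G, c ∈ K → K ≠ ⊥ := by
    intro K hK k; rw [k, Subgroup.mem_bot] at hK; exact d.c1 hK
  by_cases hVt : hull r c = ⊤
  · have hx0E : x0 ∉ Om G 1 := fun k => hx0.2 (Om_mono (by have := d.n2; omega) k)
    have hcx : r c x0 := (hT x0).2 ⟨by rw [hVt]; trivial, fun k => hx0E (hWE k)⟩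
    rw [← h.Rad_eq hcx] at hg0
    have hRCW : RC r W := by
      intro x y hxy hx
      by_contra k
      have : r c y := (hT y).2 ⟨by rw [hVt]; trivial, k⟩
      exact ((hT x).1 (h.trans this (h.symm hxy))).2 hx
    have hgW : g0 ∈ W := by
      by_contra k
      have : r c g0⁻¹ := (hT _).2 ⟨by rw [hVt]; trivial, fun q => k (by simpa using q)⟩
      have := mem_Rad hg0 this
      rw [mul_inv_cancel] at this
      exact d.c1 (h.one' this)
    refine ⟨W, W, hRCW, hRCW, le_rfl, ?_, ?_, ?_, Or.inl rfl⟩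
    · intro k; rw [k, Subgroup.mem_bot] at hgW; exact hg1 hgW
    · intro k; exact hx0E (hWE (by rw [k]; trivial))
    · intro x hx l hl
      have h1 : r c x := (hT x).2 ⟨by rw [hVt]; trivial, hx⟩
      have h2 : r c (l * x) := (hT _).2 ⟨by rw [hVt]; trivial, fun k => hx ((Subgroup.mul_mem_cancel_left _ hl).1 k)⟩
      exact h.trans (h.symm h1) h2
  · exact ⟨hull r c, hull r c, hRCV, hRCV, le_rfl, hcb _ (d.c_hull h), hVt,
      fun x hx l hl => h.mem_Rad' (hRad x hx hl), Or.inl rfl⟩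
end dg

set_option linter.all false

section dg
variable {G : Type*} [CommGroup G] [Fintype G] {r : G → G → Prop} {n : ℕ} {c : G}
  {α : G →* Multiplicative (ZMod 3)}

theorem coset_card (V : Subgroup G) (g : G) :
    (Finset.univ.filter (fun x => x⁻¹ * g ∈ V)).card = Nat.card V := by
  rw [← card_fs]
  apply Finset.card_bij (fun x _ => x⁻¹ * g)
  · intro x hx; rw [Finset.mem_filter] at hx; rw [mem_fs]; exact hx.2
  · intro x _ y _ e; simpa using e
  · intro b hb
    rw [mem_fs] at hb
    exact ⟨g * b⁻¹, by rw [Finset.mem_filter]; exact ⟨Finset.mem_univ _, by simpa using hb⟩, by simp⟩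

theorem DG.dvd3 (d : DG n c α) (h : SR r) {z g : G} (hg : g ∈ Rad r z) (hg1 : g ≠ 1) :
    3 ∣ (cls r z).card := by
  obtain ⟨k, hk, hk1, hkE⟩ := d.order3 hg hg1
  haveI : Fact (Nat.Prime 3) := ⟨by norm_num⟩
  let f : Function.End {x // x ∈ cls r z} := fun x => ⟨k * x.1, (hk x.1).1 x.2⟩
  have hf : f ^ (3 ^ 1) = 1 := by
    funext x
    apply Subtype.ext
    show k * (k * (k * x.1)) = x.1
    rw [← mul_assoc, ← mul_assoc, show k * k * k = k ^ 3 by rw [pow_succ, pow_two], mem_Om1.1 hkE, one_mul]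
  have := Equiv.Perm.card_fixedPoints_modEq (f := f) hf
  have e : Fintype.card f.fixedPoints = 0 := by
    rw [Fintype.card_eq_zero_iff]
    refine ⟨fun x => hk1 ?_⟩
    have h1 := congrArg Subtype.val x.2
    have h2 : k * x.1.1 = x.1.1 := h1
    simpa using h2
  rw [e, Fintype.card_coe] at this
  exact (Nat.modEq_zero_iff_dvd).1 this

theorem DG.cntB (d : DG n c α) (h : SR r) (hT : ∀ g, r c g ↔ g ∈ hull r c ∧ g ≠ 1) (z : G) :
    (cls r z).card * cc (cls r z) (hull r c) z
      + (Nat.card (hull r c) - 1) * ((cls r z).filter (fun x => c * x ∉ cls r z)).card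
      = (cls r z).card * Nat.card (hull r c) := by
  have h0 : fs (hull r c) = insert 1 (cls r c) := by
    ext g
    rw [mem_fs, Finset.mem_insert, mem_cls, hT]
    constructor
    · intro hg; by_cases k : g = 1
      · exact Or.inl k
      · exact Or.inr ⟨hg, k⟩
    · rintro (k | k)
      · rw [k]; exact one_mem _
      · exact k.1
  have h1T : (1 : G) ∉ cls r c := by
    rw [mem_cls]; intro k; exact d.c1 (h.one' k)
  have hq : Nat.card (hull r c) = (cls r c).card + 1 := by
    rw [← card_fs, h0, Finset.card_insert_of_notMem h1T]
  rw [← h.sum_ov z (d.RC_hull h), h0, Finset.sum_insert h1T]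
  have h1 : ov (cls r z) 1 = (cls r z).card := ov_eq_card.2 (one_mem _)
  rw [Finset.sum_const_nat (m := ov (cls r z) c) (fun g hg => (h.ov_eq (h.AS_cls z) (mem_cls.1 hg)).symm), h1, hq]
  have := card_sub_ov (cls r z) c
  rw [Nat.add_sub_cancel, add_assoc, ← Nat.mul_add, this, Nat.mul_add]
  ring

/-- per coset bound plus counting -/
theorem DG.boundB (d : DG n c α) (h : SR r) (hT : ∀ g, r c g ↔ g ∈ hull r c ∧ g ≠ 1) (z : G) {k : ℕ}
    (hk : ∀ x ∈ cls r z, cc ((cls r z).filter (fun x => c * x ∉ cls r z)) (hull r c) x ≤ k) :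
    cc (cls r z) (hull r c) z * (Nat.card (hull r c)) ≤
      cc (cls r z) (hull r c) z * cc (cls r z) (hull r c) z + k * (Nat.card (hull r c) - 1) := by
  have h1 := d.cntB h hT z
  have h2 := h.sum_sub z (d.RC_hull h) (Finset.filter_subset (fun x => c * x ∉ cls r z) (cls r z))
  have h3 := Finset.sum_le_card_nsmul _ _ _ hk
  rw [h2, smul_eq_mul] at h3
  have hpos : 0 < (cls r z).card := Finset.card_pos.2 ⟨z, h.self_mem z⟩
  generalize (cls r z).card = N at *
  generalize cc (cls r z) (hull r c) z = m at *
  generalize ((cls r z).filter (fun x => c * x ∉ cls r z)).card = D at *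
  generalize Nat.card (hull r c) = q at *
  generalize q - 1 = p at *
  apply Nat.le_of_mul_le_mul_left _ hpos
  calc N * (m * q) = m * (N * q) := by ring
    _ = m * (N * m + p * D) := by rw [h1]
    _ = N * (m * m) + p * (D * m) := by ring
    _ ≤ N * (m * m) + p * (N * k) := by gcongr
    _ = N * (m * m + k * p) := by ring

theorem coset_one (h : SR r) {V : Subgroup G} (hc : c ∈ V) (z x : G) :
    cc ((cls r z).filter (fun x => c * x ∉ cls r z)) V x + cc (cls r z) V x ≤ Nat.card V := by
  rw [← coset_card V x, cc, cc, ← Finset.card_image_of_injective _ (mul_right_injective c), ← Finset.card_union_of_disjoint]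
  · apply Finset.card_le_card
    intro y hy
    rw [Finset.mem_filter]
    refine ⟨Finset.mem_univ _, ?_⟩
    rcases Finset.mem_union.1 hy with k | k
    · obtain ⟨a, ha, rfl⟩ := Finset.mem_image.1 k
      rw [Finset.mem_filter] at ha
      rw [mul_inv, mul_assoc]; exact mul_mem (inv_mem hc) ha.2
    · exact (Finset.mem_filter.1 k).2
  · rw [Finset.disjoint_left]
    intro y hy hy'
    obtain ⟨a, ha, rfl⟩ := Finset.mem_image.1 hy
    rw [Finset.mem_filter, Finset.mem_filter] at ha
    exact ha.1.2 (Finset.mem_filter.1 hy').1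

theorem DG.coset_two (d : DG n c α) (h : SR r) {V : Subgroup G} (hc : c ∈ V) (z x : G)
    (hD : ∀ y, r z y → ¬ r z (c * y) → ¬ r z (c⁻¹ * y)) :
    2 * cc ((cls r z).filter (fun x => c * x ∉ cls r z)) V x + cc (cls r z) V x ≤ Nat.card V := by
  have e1 := Finset.card_image_of_injective ((((cls r z).filter (fun x => c * x ∉ cls r z))).filter (fun y => y⁻¹ * x ∈ V))
    (mul_right_injective c)
  have e2 := Finset.card_image_of_injective ((((cls r z).filter (fun x => c * x ∉ cls r z))).filter (fun y => y⁻¹ * x ∈ V))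
    (mul_right_injective c⁻¹)
  rw [← coset_card V x, two_mul]
  unfold cc
  conv_lhs => enter [1, 1]; rw [← e1]
  conv_lhs => enter [1, 2]; rw [← e2]
  rw [← Finset.card_union_of_disjoint, ← Finset.card_union_of_disjoint]
  · apply Finset.card_le_card
    intro y hy
    rw [Finset.mem_filter]
    refine ⟨Finset.mem_univ _, ?_⟩
    rcases Finset.mem_union.1 hy with k | k
    · rcases Finset.mem_union.1 k with k | k
      · obtain ⟨a, ha, rfl⟩ := Finset.mem_image.1 k
        rw [Finset.mem_filter] at ha
        rw [mul_inv, mul_assoc]; exact mul_mem (inv_mem hc) ha.2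
      · obtain ⟨a, ha, rfl⟩ := Finset.mem_image.1 k
        rw [Finset.mem_filter] at ha
        rw [mul_inv, mul_assoc]; exact mul_mem (inv_mem (inv_mem hc)) ha.2
    · exact (Finset.mem_filter.1 k).2
  · rw [Finset.disjoint_left]
    intro y hy hy'
    have hy' := (Finset.mem_filter.1 hy').1
    rcases Finset.mem_union.1 hy with k | k
    · obtain ⟨a, ha, rfl⟩ := Finset.mem_image.1 k
      rw [Finset.mem_filter, Finset.mem_filter] at ha
      exact ha.1.2 hy'
    · obtain ⟨a, ha, rfl⟩ := Finset.mem_image.1 k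
      rw [Finset.mem_filter, Finset.mem_filter, mem_cls, mem_cls] at ha
      exact hD a ha.1.1 ha.1.2 (mem_cls.1 hy')
  · rw [Finset.disjoint_left]
    intro y hy hy'
    obtain ⟨a, ha, rfl⟩ := Finset.mem_image.1 hy
    obtain ⟨b, hb, e⟩ := Finset.mem_image.1 hy'
    rw [Finset.mem_filter, Finset.mem_filter, mem_cls, mem_cls] at ha hb
    apply hD b hb.1.1 hb.1.2
    have : c⁻¹ * b = c * a := e
    have hb' : b = c⁻¹ * a := by
      rw [inv_mul_eq_iff_eq_mul] at this
      rw [this, ← mul_assoc, d.c2]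
    exfalso
    apply hD a ha.1.1 ha.1.2
    rw [← hb']; exact hb.1.1

theorem le2_of {β : Type*} (D : Finset G) (f : G → β) (a b : β) (hf : ∀ x ∈ D, f x = a ∨ f x = b)
    (hi : ∀ x ∈ D, ∀ y ∈ D, f x = f y → x = y) : D.card ≤ 2 := by
  calc D.card ≤ ({a, b} : Finset β).card :=
        Finset.card_le_card_of_injOn f (fun x hx => by simpa using hf x hx) (fun x hx y hy e => hi x hx y hy e)
    _ ≤ 2 := Finset.card_le_two

/-- B1 -/
theorem DG.B1 (d : DG n c α) (h : SR r) (hT : ∀ g, r c g ↔ g ∈ hull r c ∧ g ≠ 1)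
    (hVE : ∀ y ∈ hull r c, y ∈ Om G 1 → y ∈ Subgroup.zpowers c)
    {v : G} (hv : v ∈ hull r c) (hvl : Lv 2 v) {z : G} {j : ℕ} (hj : 2 ≤ j) (hz : ¬ good r c z) (hzl : Lv j z) : False := by
  have hT' : ∀ g, r c g ↔ g ∈ hull r c ∧ g ∉ (⊥ : Subgroup G) := by
    intro g; rw [Subgroup.mem_bot]; exact hT g
  have h8 := d.T8 h bot_le hT' hv hvl
  have hq9 : 9 ≤ Nat.card (hull r c) := by
    have : insert 1 (cls r c) ⊆ fs (hull r c) := by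
      intro g hg
      rw [mem_fs]
      rcases Finset.mem_insert.1 hg with k | k
      · rw [k]; exact one_mem _
      · exact ((hT g).1 (mem_cls.1 k)).1
    have := Finset.card_le_card this
    rw [card_fs, Finset.card_insert_of_notMem (by rw [mem_cls]; intro k; exact d.c1 (h.one' k))] at this
    omega
  obtain ⟨w, hw, hwj⟩ : ∃ w ∈ hull r c, w ∉ Om G (j-1) := by
    by_contra! k
    exact d.mixNo h bot_le hT' hv hvl hj hz hzl k
  have hα : ∀ u ∈ hull r c, u ∈ Om G (j-1) → α u = 1 := by
    intro u hu huj
    by_cases hu1 : u ∈ Om G 1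
    · exact (d.mem_C'.1 (hVE u hu hu1)).2
    have hw1 : w ∉ Om G 1 := fun k => hwj (Om_mono (by omega) k)
    obtain ⟨l, hl, hln, hul⟩ := d.exists_Lv2 hu1
    obtain ⟨i, hi, hin, hwl⟩ := d.exists_Lv2 hw1
    have hli : l < i := by
      have a1 : l ≤ j - 1 := by
        by_contra q; exact hul.2 (Om_mono (by omega) huj)
      have a2 : j ≤ i := by
        by_contra q; exact hwj (Om_mono (by omega) hwl.1)
      omega
    have hyl : Lv l (w ^ (3 ^ (i - l))) := by
      constructor
      · rw [pow_mem_Om, show i - l + l = i by omega]; exact hwl.1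
      · rw [pow_mem_Om, show i - l + (l-1) = i - 1 by omega]; exact hwl.2
    have hya : α (w ^ (3 ^ (i - l))) = 1 := α_pow3 α w (by omega)
    have hyV := pow_mem hw (3 ^ (i - l))
    generalize w ^ (3 ^ (i - l)) = y at *
    obtain ⟨t, ht, hta⟩ := d.ext
    have main : ∀ u ∈ hull r c, Lv l u → y ^ (3 ^ (l-1)) = u ^ (3 ^ (l-1)) → α u = 1 := by
      intro u hu hul e
      obtain ⟨s, m, e1, e2⟩ := d.adj_same hl (mem_Om1.2 ht) hta hul e
      have h1 : t ^ s * u ∈ hull r c := by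
        rw [e2] at hyV
        exact (d.pow_memi (by omega)).1 hyV
      have h2 : t ^ s ∈ hull r c := by
        have := mul_mem h1 (inv_mem hu)
        simpa using this
      have h3 := (d.mem_C'.1 (hVE _ h2 (pow_mem (mem_Om1.2 ht) s))).2
      rw [map_mul, h3, one_mul, hya] at e1
      exact e1
    rcases d.sgE hl hul hyl with k | k
    · exact main u hu hul k
    · have := main u⁻¹ (inv_mem hu) (Lv_inv hul) k
      rw [map_inv, inv_eq_one] at this; exact this
  have hc := d.c_hull h
  have hDl := d.D1_low h (show 1 ≤ j by omega) hzl.1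
  have hDi : ∀ y, r z y → ¬ r z (c * y) → ¬ r z (c⁻¹ * y) := by
    intro y hy hy' k
    have hyj := (hDl y (by rw [Finset.mem_filter, mem_cls, mem_cls]; exact ⟨hy, hy'⟩)).2.1
    exact d.ci1 (d.bad_c h hj hz hzl hy hyj (inv_mem (Subgroup.mem_zpowers c)) k)
  have h2q : ∀ x, 2 * cc ((cls r z).filter (fun x => c * x ∉ cls r z)) (hull r c) x + cc (cls r z) (hull r c) x ≤ Nat.card (hull r c) :=
    fun x => d.coset_two h hc z x hDi
  have hzD : 1 ≤ cc ((cls r z).filter (fun x => c * x ∉ cls r z)) (hull r c) z := by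
    unfold cc
    rw [Nat.one_le_iff_ne_zero, ← Nat.pos_iff_ne_zero, Finset.card_pos]
    refine ⟨z, ?_⟩
    rw [Finset.mem_filter, Finset.mem_filter, mem_cls, mem_cls]
    refine ⟨⟨h.refl z, fun k => ?_⟩, by simpa using one_mem _⟩
    exact d.c1 (d.bad_c h hj hz hzl (h.refl z) hzl.1 (Subgroup.mem_zpowers c) k)
  have hk2 : ∀ x ∈ cls r z, cc ((cls r z).filter (fun x => c * x ∉ cls r z)) (hull r c) x ≤ 2 := by
    intro x hx
    apply le2_of _ (fun y => y ^ (3 ^ (j-1))) c c⁻¹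
    · intro y hy
      have := hDl y (Finset.mem_filter.1 hy).1
      exact d.sg hj (d.bad_min h hj hz hzl this.1 this.2.1)
    · intro y hy y' hy' e
      have a1 := hDl y (Finset.mem_filter.1 hy).1
      have a2 := hDl y' (Finset.mem_filter.1 hy').1
      have hV : y⁻¹ * y' ∈ hull r c := by
        have := mul_mem (Finset.mem_filter.1 hy).2 (inv_mem (Finset.mem_filter.1 hy').2)
        rw [show y⁻¹ * x * (y'⁻¹ * x)⁻¹ = y⁻¹ * y' by group] at this
        exact this
      have hO : y⁻¹ * y' ∈ Om G (j-1) := by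
        have e' : y ^ (3 ^ (j-1)) = y' ^ (3 ^ (j-1)) := e
        rw [mem_Om, mul_pow, inv_pow, inv_mul_eq_one]; exact e'
      have ha := hα _ hV hO
      rw [map_mul, map_inv, inv_mul_eq_one] at ha
      exact (d.bad_det h hj hz hzl a1.1 a1.2.1 a2.1 e.symm ha).symm
  obtain ⟨y, hzy, hyj⟩ : ∃ y, r z y ∧ y ∉ Om G j := by
    by_contra! k
    exact d.thinNo h hv hvl ⟨hj, hzl, hz, k⟩
  have hyg := d.O2 h (by omega) hzl.1 hyj hzy
  have hm3 := d.three_cc h hzy hyg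
  have hzq := h2q z
  by_cases hbig : Nat.card (hull r c) ≤ cc (cls r z) (hull r c) z + 3
  · have hk1 : ∀ x ∈ cls r z, cc ((cls r z).filter (fun x => c * x ∉ cls r z)) (hull r c) x ≤ 1 := by
      intro x hx
      have := h2q x
      rw [← h.cc_eq (h.AS_cls z) (d.RC_hull h) (mem_cls.1 hx)] at this
      omega
    have hB := d.boundB h hT z hk1
    obtain ⟨p, hp⟩ : ∃ p, Nat.card (hull r c) = cc (cls r z) (hull r c) z + p := ⟨_, (Nat.add_sub_of_le (by omega)).symm⟩
    generalize cc (cls r z) (hull r c) z = m at *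
    generalize Nat.card (hull r c) = q at *
    have hp2 : 2 ≤ p := by omega
    have : q - 1 = m + p - 1 := by omega
    rw [this, hp] at hB
    have : m + p - 1 + 1 = m + p := by omega
    nlinarith
  · have hB := d.boundB h hT z hk2
    obtain ⟨p, hp⟩ : ∃ p, Nat.card (hull r c) = cc (cls r z) (hull r c) z + p := ⟨_, (Nat.add_sub_of_le (by omega)).symm⟩
    generalize cc (cls r z) (hull r c) z = m at *
    generalize Nat.card (hull r c) = q at *
    have hp2 : 4 ≤ p := by omega
    have : q - 1 = m + p - 1 := by omega
    rw [this, hp] at hB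
    have : m + p - 1 + 1 = m + p := by omega
    nlinarith
end dg

set_option linter.all false

section dg
variable {G : Type*} [CommGroup G] [Fintype G] {r : G → G → Prop} {n : ℕ} {c : G}
  {α : G →* Multiplicative (ZMod 3)}

theorem DG.dvdq (d : DG n c α) (h : SR r) : 3 ∣ Nat.card (hull r c) := by
  rw [← d.card_C]
  exact Subgroup.card_dvd_of_le (d.C_le (d.c_hull h))

def QB {G : Type*} [CommGroup G] [Fintype G] (r : G → G → Prop) (c : G) : Set G :=
  {p | (∀ y, r p y → y ∈ Om G 1) ∧ p ∉ hull r c}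

/-- B0 -/
theorem DG.B0 (d : DG n c α) (h : SR r) (hT : ∀ g, r c g ↔ g ∈ hull r c ∧ g ≠ 1)
    (hVE : ∀ y ∈ hull r c, y ∈ Om G 1 → y ∈ Subgroup.zpowers c)
    (hq9 : 9 ≤ Nat.card (hull r c)) {z : G} (hzE : z ∈ Om G 1) (hzV : z ∉ hull r c) :
    hull r c ≤ Rad r z ∨ (∀ y, r z y → y ∈ Om G 1) ∨
    (¬ 3 ∣ (cls r z).card ∧ ∀ y, r z y → ∃ p ∈ QB r c, p⁻¹ * y ∈ hull r c) := by
  have hRCV := d.RC_hull h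
  have hc := d.c_hull h
  by_cases hy : ∀ y, r z y → y ∈ Om G 1
  · exact Or.inr (Or.inl hy)
  push Not at hy
  obtain ⟨y, hzy, hyE⟩ := hy
  have hyg := d.O2 h le_rfl hzE hyE hzy
  have hm3 := d.three_cc h hzy hyg
  have hDl := d.D1_low h le_rfl hzE
  set D := (cls r z).filter (fun x => c * x ∉ cls r z) with hD
  have memD : ∀ x, x ∈ D ↔ r z x ∧ ¬ r z (c * x) := by
    intro x; rw [hD, Finset.mem_filter, mem_cls, mem_cls]
  by_cases hDe : D = ∅
  · left
    apply d.hull_le (h.RC_Rad z)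
    apply mem_Rad_of
    intro x hx
    by_contra k
    have : x ∈ D := (memD x).2 ⟨hx, k⟩
    rw [hDe] at this; simp at this
  right; right
  obtain ⟨x1, hx1⟩ := Finset.nonempty_iff_ne_empty.2 hDe
  have same : ∀ x ∈ D, ∀ y ∈ D, x⁻¹ * y ∈ hull r c → x = y := by
    intro x hx y hy k
    have hC := hVE _ k (mul_mem (inv_mem (hDl x hx).2.1) (hDl y hy).2.1)
    rcases d.mem_C.1 hC with e | e | e
    · rw [inv_mul_eq_one] at e; exact e
    · rw [inv_mul_eq_iff_eq_mul] at e
      exfalso; apply (hDl x hx).2.2; rw [mul_comm, ← e]; exact (hDl y hy).1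
    · rw [inv_mul_eq_iff_eq_mul] at e
      exfalso; apply (hDl y hy).2.2
      rw [e, mul_comm x, mul_inv_cancel_left]; exact (hDl x hx).1
  have hk1 : ∀ x ∈ cls r z, cc D (hull r c) x ≤ 1 := by
    intro x hx
    unfold cc
    rw [Finset.card_le_one]
    intro a ha b hb
    rw [Finset.mem_filter] at ha hb
    apply same a ha.1 b hb.1
    have := mul_mem ha.2 (inv_mem hb.2)
    rw [show a⁻¹ * x * (b⁻¹ * x)⁻¹ = a⁻¹ * b by group] at this
    exact this
  have hB := d.boundB h hT z hk1
  have hlow : cc (cls r z) (hull r c) z + 1 ≤ Nat.card (hull r c) := by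
    have h1 := coset_one h hc z x1
    rw [← h.cc_eq (h.AS_cls z) hRCV (hDl x1 hx1).1, ← hD] at h1
    have : 1 ≤ cc D (hull r c) x1 := by
      unfold cc
      rw [Nat.one_le_iff_ne_zero, ← Nat.pos_iff_ne_zero, Finset.card_pos]
      exact ⟨x1, by rw [Finset.mem_filter]; exact ⟨hx1, by simpa using one_mem _⟩⟩
    omega
  have hmq : cc (cls r z) (hull r c) z + 1 = Nat.card (hull r c) := by
    obtain ⟨p, hp⟩ : ∃ p, Nat.card (hull r c) = cc (cls r z) (hull r c) z + p := ⟨_, (Nat.add_sub_of_le (by omega)).symm⟩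
    by_contra hne
    generalize cc (cls r z) (hull r c) z = m at *
    generalize Nat.card (hull r c) = q at *
    have hp2 : 2 ≤ p := by omega
    have : q - 1 = m + p - 1 := by omega
    rw [this, hp] at hB
    have : m + p - 1 + 1 = m + p := by omega
    nlinarith
  have hN : (cls r z).card = (Nat.card (hull r c) - 1) * D.card := by
    have h1 := d.cntB h hT z
    rw [← hD] at h1
    have : Nat.card (hull r c) - 1 = cc (cls r z) (hull r c) z := by omega
    rw [this] at h1 ⊢
    rw [← hmq] at h1
    rw [Nat.mul_add, mul_one] at h1
    omega
  have hd2 : D.card ≤ 2 := by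
    apply le2_of _ α (Multiplicative.ofAdd 1) (Multiplicative.ofAdd 2)
    · intro x hx
      have hxa : α x ≠ 1 := by
        intro k
        have : x ∈ Subgroup.zpowers c := d.mem_C'.2 ⟨(hDl x hx).2.1, k⟩
        exact hzV (hRCV _ _ (h.symm (hDl x hx).1) (d.C_le hc this))
      have : ∀ a : Multiplicative (ZMod 3), a ≠ 1 → a = Multiplicative.ofAdd 1 ∨ a = Multiplicative.ofAdd 2 := by decide
      exact this _ hxa
    · intro x hx y hy e
      apply same x hx y hy
      apply d.C_le hc
      exact d.mem_C'.2 ⟨mul_mem (inv_mem (hDl x hx).2.1) (hDl y hy).2.1, by rw [map_mul, map_inv, e, inv_mul_cancel]⟩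
  have hd1 : 1 ≤ D.card := Finset.card_pos.2 ⟨x1, hx1⟩
  refine ⟨?_, ?_⟩
  · rw [hN, Nat.Prime.dvd_mul (by norm_num)]
    have := d.dvdq h (r := r)
    omega
  -- each coset contains exactly one element of D
  have hex : ∀ x, r z x → ∃ a ∈ D, a⁻¹ * x ∈ hull r c := by
    have h2 := h.sum_sub z hRCV (Finset.filter_subset (fun x => c * x ∉ cls r z) (cls r z))
    rw [← hD] at h2
    have h3 : ∑ x ∈ cls r z, cc D (hull r c) x = ∑ x ∈ cls r z, 1 := by
      rw [h2, Finset.sum_const, smul_eq_mul, mul_one, hN, mul_comm]; congr 1; omega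
    have h4 := (Finset.sum_eq_sum_iff_of_le hk1).1 h3
    intro x hx
    have h5 := h4 x (mem_cls.2 hx)
    unfold cc at h5
    have : 0 < (D.filter (fun y => y⁻¹ * x ∈ hull r c)).card := by rw [h5]; norm_num
    obtain ⟨a, ha⟩ := Finset.card_pos.1 this
    rw [Finset.mem_filter] at ha
    exact ⟨a, ha.1, ha.2⟩
  have hmiss : ∀ g x, ¬ r z g → r z x → x⁻¹ * g ∈ hull r c → g ∈ Om G 1 := by
    intro g x hg hx hgx
    obtain ⟨a, ha, hax⟩ := hex x hx
    have hgc : g = c * a := by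
      by_contra hne
      have hsub : insert g (insert (c * a) ((cls r z).filter (fun y => y⁻¹ * x ∈ hull r c))) ⊆
          Finset.univ.filter (fun y => y⁻¹ * x ∈ hull r c) := by
        intro y hy
        rw [Finset.mem_filter]
        refine ⟨Finset.mem_univ _, ?_⟩
        rcases Finset.mem_insert.1 hy with k | k
        · rw [k]; have := inv_mem hgx; simpa using this
        rcases Finset.mem_insert.1 k with k | k
        · rw [k, mul_inv, mul_assoc]; exact mul_mem (inv_mem hc) hax
        · exact (Finset.mem_filter.1 k).2
      have := Finset.card_le_card hsub
      rw [coset_card, Finset.card_insert_of_notMem, Finset.card_insert_of_notMem] at this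
      · have e := h.cc_eq (h.AS_cls z) hRCV hx
        unfold cc at e hmq
        omega
      · intro k; exact (hDl a ha).2.2 (mem_cls.1 (Finset.mem_filter.1 k).1)
      · intro k
        rcases Finset.mem_insert.1 k with k | k
        · exact hne k
        · exact hg (mem_cls.1 (Finset.mem_filter.1 k).1)
    rw [hgc]; exact mul_mem d.cE (hDl a ha).2.1
  intro y hy
  obtain ⟨a, ha, hay⟩ := hex y hy
  refine ⟨c * a, ⟨?_, ?_⟩, ?_⟩
  · intro g hg
    obtain ⟨x', hx', u, hu, e⟩ := h.prod (h.AS_cls z) hRCV.AS hg ⟨a, mem_cls.2 (hDl a ha).1, c, mem_fs.2 hc, mul_comm _ _⟩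
    apply hmiss g x'
    · intro k; exact (hDl a ha).2.2 (h.trans k (h.symm hg))
    · exact mem_cls.1 hx'
    · rw [← e]; simpa using hu
  · intro k
    exact hzV (hRCV _ _ (h.symm (hDl a ha).1) ((Subgroup.mul_mem_cancel_left _ hc).1 k))
  · rw [mul_inv, mul_assoc]; exact mul_mem (inv_mem hc) hay

theorem DG.mainB (d : DG n c α) (h : SR r) (hT : ∀ g, r c g ↔ g ∈ hull r c ∧ g ≠ 1)
    (hVE : ∀ y ∈ hull r c, y ∈ Om G 1 → y ∈ Subgroup.zpowers c)
    {v : G} (hv : v ∈ hull r c) (hvl : Lv 2 v)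
    {x0 g0 : G} (hx0 : Lv n x0) (hg0 : g0 ∈ Rad r x0) (hg1 : g0 ≠ 1) : Goal r := by
  have hRCV := d.RC_hull h
  have hc := d.c_hull h
  have hT' : ∀ g, r c g ↔ g ∈ hull r c ∧ g ∉ (⊥ : Subgroup G) := by
    intro g; rw [Subgroup.mem_bot]; exact hT g
  have h8 := d.T8 h bot_le hT' hv hvl
  have hq9 : 9 ≤ Nat.card (hull r c) := by
    have : insert 1 (cls r c) ⊆ fs (hull r c) := by
      intro g hg
      rw [mem_fs]
      rcases Finset.mem_insert.1 hg with k | k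
      · rw [k]; exact one_mem _
      · exact ((hT g).1 (mem_cls.1 k)).1
    have := Finset.card_le_card this
    rw [card_fs, Finset.card_insert_of_notMem (by rw [mem_cls]; intro k; exact d.c1 (h.one' k))] at this
    omega
  have hx0E : x0 ∉ Om G 1 := fun k => hx0.2 (Om_mono (by have := d.n2; omega) k)
  have hQ : ∀ x y, r x y → x ∈ QB r c → y ∈ QB r c := by
    intro x y hxy hx
    exact ⟨fun w hw => hx.1 w (h.trans hxy hw), fun k => hx.2 (hRCV _ _ (h.symm hxy) k)⟩
  set H := Subgroup.closure (QB r c) with hH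
  have hRCH : RC r H := h.RC_closure hQ
  have hHE : H ≤ Om G 1 := by
    rw [hH, Subgroup.closure_le]
    intro p hp; exact hp.1 p (h.refl p)
  have hcH : c ∉ H := by
    intro k
    have := hHE (d.hull_le hRCH k hv)
    exact hvl.2 this
  have hcard : Nat.card H = 1 ∨ Nat.card H = 3 := by
    have h1 : Nat.card H ∣ 3 ^ 2 := by
      have := Subgroup.card_dvd_of_le hHE
      rw [d.card_E] at this; exact this
    obtain ⟨k, hk, e⟩ := (Nat.dvd_prime_pow (by norm_num)).1 h1
    have : k ≠ 2 := by
      rintro rfl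
      apply hcH
      have := Subgroup.eq_of_le_of_card_ge hHE (by rw [d.card_E, e]; norm_num)
      rw [this]; exact d.cE
    have : k = 0 ∨ k = 1 := by omega
    rcases this with k | k
    · left; rw [e, k]; rfl
    · right; rw [e, k]; rfl
  set U := hull r c ⊔ H with hU
  have hRCU : RC r U := by
    have : U = Subgroup.closure ((hull r c : Set G) ∪ (H : Set G)) := by
      rw [Subgroup.closure_union, Subgroup.closure_eq, Subgroup.closure_eq]
    rw [this]
    apply h.RC_closure
    intro x y hxy hx
    rcases hx with hx | hx
    · exact Or.inl (hRCV _ _ hxy hx)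
    · exact Or.inr (hRCH _ _ hxy hx)
  have dich : ∀ z, z ∉ hull r c → hull r c ≤ Rad r z ∨ (z ∈ U ∧ ¬ 3 ∣ (cls r z).card) := by
    intro z hz
    by_cases hg : ∀ y, r z y → good r c y
    · exact Or.inl (d.good_Rad h hg)
    push Not at hg
    obtain ⟨y, hzy, hyb⟩ := hg
    have hyV : y ∉ hull r c := fun k => hz (hRCV _ _ (h.symm hzy) k)
    by_cases hyE : y ∈ Om G 1
    · rw [h.Rad_eq hzy, h.cls_eq hzy]
      rcases d.B0 h hT hVE hq9 hyE hyV with k | k | k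
      · exact Or.inl k
      · right
        have hsub : cls r y ⊆ (fs H).erase 1 := by
          intro x hx
          rw [mem_cls] at hx
          have hyQ : y ∈ QB r c := ⟨k, hyV⟩
          rw [Finset.mem_erase, mem_fs]
          refine ⟨?_, Subgroup.subset_closure (hQ _ _ hx hyQ)⟩
          rintro rfl
          exact hyV (by rw [h.one' hx]; exact one_mem _)
        refine ⟨?_, ?_⟩
        · have := hsub (mem_cls.2 (h.symm hzy))
          rw [Finset.mem_erase, mem_fs] at this
          exact (le_sup_right : H ≤ U) this.2
        · have := Finset.card_le_card hsub
          rw [Finset.card_erase_of_mem (by rw [mem_fs]; exact one_mem _), card_fs] at this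
          have hpos : 0 < (cls r y).card := Finset.card_pos.2 ⟨y, h.self_mem y⟩
          intro k3
          have := Nat.le_of_dvd hpos k3
          omega
      · right
        refine ⟨?_, k.1⟩
        obtain ⟨p, hp, hpz⟩ := k.2 z (h.symm hzy)
        have h1 : p ∈ U := (le_sup_right : H ≤ U) (Subgroup.subset_closure hp)
        have h2 : p⁻¹ * z ∈ U := (le_sup_left : hull r c ≤ U) hpz
        have := mul_mem h1 h2
        simpa using this
    · exfalso
      obtain ⟨j, hj, _, hyl⟩ := d.exists_Lv2 hyE
      exact d.B1 h hT hVE hv hvl hj hyb hyl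
  have hx0V : x0 ∉ hull r c := by
    intro k
    have hcx : r c x0 := (hT x0).2 ⟨k, fun e => hx0E (by rw [e]; exact one_mem _)⟩
    rw [← h.Rad_eq hcx] at hg0
    have hgV : g0 ∈ hull r c := by
      have := ((hT _).1 (mem_Rad hg0 (h.refl c))).1
      exact (Subgroup.mul_mem_cancel_right _ hc).1 this
    have : r c g0⁻¹ := (hT _).2 ⟨inv_mem hgV, by simpa using hg1⟩
    have := mem_Rad hg0 this
    rw [mul_inv_cancel] at this
    exact d.c1 (h.one' this)
  refine ⟨hull r c, U, hRCV, hRCU, le_sup_left, ?_, ?_, ?_, ?_⟩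
  · intro k; rw [k, Subgroup.mem_bot] at hc; exact d.c1 hc
  · intro k
    rcases dich x0 hx0V with q | q
    · have : x0 ∈ U := by rw [k]; trivial
      obtain ⟨a, ha, b, hb, e⟩ := Subgroup.mem_sup.1 this
      have h1 := h.mem_Rad' (q (inv_mem ha))
      rw [← e, inv_mul_cancel_left, e] at h1
      exact hx0E (hHE (hRCH _ _ (h.symm h1) hb))
    · exact q.2 (d.dvd3 h hg0 hg1)
  · intro x hx l hl
    rcases dich x (fun k => hx ((le_sup_left : hull r c ≤ U) k)) with q | q
    · exact h.mem_Rad' (q hl)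
    · exact absurd q.1 hx
  · have h1 := Subgroup.relIndex_mul_relIndex (⊥ : Subgroup G) (hull r c) U bot_le le_sup_left
    rw [Subgroup.relIndex_bot_left, Subgroup.relIndex_bot_left, hU, Subgroup.relIndex_sup_left] at h1
    rw [hU, ← h1]
    have h2 : (hull r c).relIndex H ∣ Nat.card H := Subgroup.relIndex_dvd_card _ _
    have : (hull r c).relIndex H = 1 ∨ (hull r c).relIndex H = 3 := by
      rcases hcard with k | k <;> rw [k] at h2
      · left; exact Nat.dvd_one.1 h2
      · exact (Nat.dvd_prime (by norm_num)).1 h2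
    rcases this with k | k <;> rw [k]
    · left; rw [mul_one]
    · right; left; rw [mul_comm]

theorem DG.main (d : DG n c α) (h : SR r)
    {x0 g0 : G} (hx0 : Lv n x0) (hg0 : g0 ∈ Rad r x0) (hg1 : g0 ≠ 1) : Goal r := by
  by_cases hA : ∀ y, r c y → y ∈ Om G 1
  · exact d.mainA h hA hx0 hg0 hg1
  obtain hA' | ⟨W, hW, hT⟩ := d.hull_cases h
  · exact absurd hA' hA
  push Not at hA
  obtain ⟨y, hcy, hyE⟩ := hA
  have hyV : y ∈ hull r c := ((hT y).1 hcy).1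
  obtain ⟨l, hl, hln, hyl⟩ := d.exists_Lv2 hyE
  have hv := pow_mem hyV (3 ^ (l-2))
  have hvl : Lv 2 (y ^ (3 ^ (l-2))) := by
    constructor
    · rw [pow_mem_Om, show l - 2 + 2 = l by omega]; exact hyl.1
    · rw [pow_mem_Om, show l - 2 + (2-1) = l - 1 by omega]; exact hyl.2
  have hWE : W ≤ Om G 1 := by
    apply hW.trans
    rw [Subgroup.closure_le]
    intro x hx; exact hx.2
  have hWV : W ≤ hull r c := by
    apply hW.trans
    rw [Subgroup.closure_le]
    intro x hx; exact ((hT x).1 hx.1).1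
  have hcW : c ∉ W := ((hT c).1 (h.refl c)).2
  by_cases hq : ∃ q, r c q ∧ q ∈ Om G 1 ∧ α q ≠ 1
  · obtain ⟨q, hcq, hqE, hqa⟩ := hq
    exact d.mainC h hWE hWV hT hv hvl (d.E_le (d.c_hull h) ((hT q).1 hcq).1 hqE hqa) hx0 hg0 hg1
  · push Not at hq
    have hWb : ∀ w ∈ W, w = 1 := by
      intro w hw
      by_contra k
      have : w ∈ Subgroup.zpowers c := by
        have : Subgroup.closure {y | r c y ∧ y ∈ Om G 1} ≤ Subgroup.zpowers c := by
          rw [Subgroup.closure_le]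
          intro x hx
          exact d.mem_C'.2 ⟨hx.2, hq x hx.1 hx.2⟩
        exact this (hW hw)
      exact hcW ((Subgroup.zpowers_le.2 hw) (gen3 d.c3 this k))
    have hT2 : ∀ g, r c g ↔ g ∈ hull r c ∧ g ≠ 1 := by
      intro g
      rw [hT]
      constructor
      · rintro ⟨a, b⟩; exact ⟨a, fun k => b (by rw [k]; exact one_mem _)⟩
      · rintro ⟨a, b⟩; exact ⟨a, fun k => b (hWb _ k)⟩
    apply d.mainB h hT2 _ hv hvl hx0 hg0 hg1
    intro y hy hyE
    by_cases k : y = 1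
    · rw [k]; exact one_mem _
    · exact d.mem_C'.2 ⟨hyE, hq y ((hT2 y).2 ⟨hy, k⟩) hyE⟩
end dg

set_option linter.all false

section glue

def rel {G : Type*} (S : Finset (Finset G)) (x y : G) : Prop := ∃ X ∈ S, x ∈ X ∧ y ∈ X

variable {G : Type*} [CommGroup G] [Fintype G] {S : Finset (Finset G)}

theorem ind_coeff (X : Finset G) (g : G) : (ind X).coeff g = if g ∈ X then 1 else 0 := by
  unfold ind
  rw [MonoidAlgebra.coeff_sum, Finsupp.finset_sum_apply]
  simp only [MonoidAlgebra.coeff_single, Finsupp.single_apply]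
  rw [Finset.sum_ite_eq']

theorem rel_same (hS : IsSRing S) {X Y : Finset G} (hX : X ∈ S) (hY : Y ∈ S) {x : G} (h1 : x ∈ X) (h2 : x ∈ Y) : X = Y := by
  by_contra k
  exact Finset.disjoint_left.1 (hS.disj X hX Y hY k) h1 h2

theorem span_const (hS : IsSRing S) {a : MonoidAlgebra ℤ G} (ha : a ∈ spanA S) :
    ∀ x y, rel S x y → a.coeff x = a.coeff y := by
  intro x y ⟨X, hX, hx, hy⟩
  unfold spanA at ha
  induction ha using Submodule.span_induction with
  | mem a ha =>
    obtain ⟨Y, hY, rfl⟩ := ha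
    rw [ind_coeff, ind_coeff]
    by_cases k : x ∈ Y
    · have := rel_same hS hX hY hx k
      rw [this] at hy
      rw [if_pos k, if_pos hy]
    · have : y ∉ Y := fun q => by
        have := rel_same hS hX hY hy q
        rw [this] at hx; exact k hx
      rw [if_neg k, if_neg this]
  | zero => simp
  | add a b _ _ h1 h2 => rw [MonoidAlgebra.coeff_add, Finsupp.add_apply, Finsupp.add_apply, h1, h2]
  | smul t a _ h1 => rw [MonoidAlgebra.coeff_smul, Finsupp.smul_apply, Finsupp.smul_apply, h1]

theorem const_span (hS : IsSRing S) {a : MonoidAlgebra ℤ G} (ha : ∀ x y, rel S x y → a.coeff x = a.coeff y) :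
    a ∈ spanA S := by
  have hex : ∀ X : Finset G, ∃ t : ℤ, X ∈ S → ∀ x ∈ X, a.coeff x = t := by
    intro X
    by_cases hX : X ∈ S
    · obtain ⟨x0, hx0⟩ := hS.nonempty X hX
      exact ⟨a.coeff x0, fun _ x hx => ha _ _ ⟨X, hX, hx, hx0⟩⟩
    · exact ⟨0, fun k => absurd k hX⟩
  choose t ht using hex
  have : a = ∑ X ∈ S, t X • ind X := by
    apply MonoidAlgebra.coeff_injective
    ext g
    rw [MonoidAlgebra.coeff_sum, Finsupp.finset_sum_apply]
    obtain ⟨X, hX, hg⟩ := hS.cover g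
    rw [Finset.sum_eq_single X]
    · rw [MonoidAlgebra.coeff_smul, Finsupp.smul_apply, ind_coeff, if_pos hg, smul_eq_mul, mul_one]
      exact ht X hX g hg
    · intro Y hY hne
      rw [MonoidAlgebra.coeff_smul, Finsupp.smul_apply, ind_coeff, if_neg, smul_zero]
      intro k; exact hne (rel_same hS hY hX k hg)
    · intro k; exact absurd hX k
  rw [this]
  exact Submodule.sum_mem _ (fun X hX => Submodule.smul_mem _ _ (Submodule.subset_span ⟨X, hX, rfl⟩))

noncomputable def ofFun (a : G → ℤ) : MonoidAlgebra ℤ G := MonoidAlgebra.ofCoeff (Finsupp.equivFunOnFinite.symm a)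

theorem ofFun_coeff (a : G → ℤ) (x : G) : (ofFun a).coeff x = a x := rfl

theorem mul_coeff (a b : G → ℤ) (g : G) : (ofFun a * ofFun b).coeff g = ∑ x, a x * b (x⁻¹ * g) := by
  rw [MonoidAlgebra.coeff_mul_apply_left, Finsupp.sum_fintype]
  · rfl
  · intro i; simp

theorem rel_SR (hS : IsSRing S) : SR (rel S) where
  refl x := by obtain ⟨X, hX, hx⟩ := hS.cover x; exact ⟨X, hX, hx, hx⟩
  symm := by rintro x y ⟨X, hX, hx, hy⟩; exact ⟨X, hX, hy, hx⟩
  trans := by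
    rintro x y z ⟨X, hX, hx, hy⟩ ⟨Y, hY, hy', hz⟩
    have := rel_same hS hX hY hy hy'
    subst this
    exact ⟨X, hX, hx, hz⟩
  one := by
    rintro y ⟨X, hX, hx, hy⟩
    have := rel_same hS hX hS.one_mem hx (Finset.mem_singleton_self 1)
    rw [this] at hy
    exact Finset.mem_singleton.1 hy
  inv := by
    rintro x y ⟨X, hX, hx, hy⟩
    exact ⟨_, hS.inv_mem X hX, Finset.mem_image_of_mem _ hx, Finset.mem_image_of_mem _ hy⟩
  mul := by
    intro a b ha hb g g' hg
    rw [← mul_coeff, ← mul_coeff]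
    exact span_const hS (hS.mul_closed _ (const_span hS ha) _ (const_span hS hb)) g g' hg

theorem RC_ASub (hS : IsSRing S) {H : Subgroup G} (hH : RC (rel S) H) : IsASubgroup S H := by
  apply const_span hS
  intro x y hxy
  rw [ind_coeff, ind_coeff]
  have : x ∈ subgroupFinset H ↔ y ∈ subgroupFinset H := by
    simp only [subgroupFinset, Finset.mem_filter, Finset.mem_univ, true_and]
    exact ⟨fun k => hH _ _ hxy k, fun k => hH _ _ ((rel_SR hS).symm hxy) k⟩
  simp only [this]

theorem mem_rel (hS : IsSRing S) {X : Finset G} (hX : X ∈ S) {x y : G} (hx : x ∈ X) : rel S x y ↔ y ∈ X := by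
  constructor
  · rintro ⟨Y, hY, h1, h2⟩
    rw [rel_same hS hX hY hx h1]; exact h2
  · intro hy; exact ⟨X, hX, hx, hy⟩

theorem image_Rad (hS : IsSRing S) (inst : DecidableEq G) {X : Finset G} (hX : X ∈ S) {x g : G} (hx : x ∈ X)
    (e : X.image (g * ·) = X) : g ∈ Rad (rel S) x := by
  apply mem_Rad_of
  intro y hy
  rw [mem_rel hS hX hx] at hy ⊢
  have := Finset.mem_image_of_mem (g * ·) hy
  rw [e] at this; exact this

theorem e3case {r : G → G → Prop} (h : SR r) (he : ∀ g : G, g ^ 3 = 1) (hcard : Nat.card G = 9)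
    {x0 g0 : G} (hx1 : x0 ≠ 1) (hg0 : g0 ∈ Rad r x0) (hg1 : g0 ≠ 1) : Goal r := by
  have hxR : x0 ∉ Rad r x0 := by
    intro k
    have := h.mem_Rad' (inv_mem k)
    rw [inv_mul_cancel] at this
    exact hx1 (h.one' this)
  have h3 : ∀ K : Subgroup G, Nat.card K = 1 ∨ Nat.card K = 3 ∨ Nat.card K = 9 := by
    intro K
    have h1 : Nat.card K ∣ 3 ^ 2 := by
      have := Subgroup.card_subgroup_dvd_card K
      rw [hcard] at this; exact this
    obtain ⟨k, hk, e⟩ := (Nat.dvd_prime_pow (by norm_num)).1 h1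
    rw [e]
    interval_cases k <;> simp
  have hne1 : Nat.card (Rad r x0) ≠ 1 := by
    intro k
    have := Subgroup.card_eq_one.1 k
    rw [this, Subgroup.mem_bot] at hg0; exact hg1 hg0
  have hne9 : Nat.card (Rad r x0) ≠ 9 := by
    intro k
    rw [← hcard, Subgroup.card_eq_iff_eq_top] at k
    apply hxR; rw [k]; trivial
  have hR3 : Nat.card (Rad r x0) = 3 := by
    rcases h3 (Rad r x0) with k | k | k
    · exact absurd k hne1
    · exact k
    · exact absurd k hne9
  have htop : Rad r x0 ⊔ Subgroup.zpowers x0 = ⊤ := by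
    rw [← Subgroup.card_eq_iff_eq_top, hcard]
    have hd : Nat.card (Rad r x0) ∣ Nat.card ↥(Rad r x0 ⊔ Subgroup.zpowers x0) := Subgroup.card_dvd_of_le le_sup_left
    rcases h3 (Rad r x0 ⊔ Subgroup.zpowers x0) with k | k | k
    · rw [k, hR3] at hd; omega
    · exfalso
      have := Subgroup.eq_of_le_of_card_ge (le_sup_left : Rad r x0 ≤ Rad r x0 ⊔ Subgroup.zpowers x0) (by rw [k, hR3])
      apply hxR
      rw [this]
      exact (le_sup_right : Subgroup.zpowers x0 ≤ _) (Subgroup.mem_zpowers x0)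
    · exact k
  refine ⟨Rad r x0, Rad r x0, h.RC_Rad x0, h.RC_Rad x0, le_rfl, ?_, ?_, ?_, Or.inl rfl⟩
  · intro k; rw [k, Subgroup.mem_bot] at hg0; exact hg1 hg0
  · intro k; apply hxR; rw [k]; trivial
  · intro x hx l hl
    have : x ∈ Rad r x0 ⊔ Subgroup.zpowers x0 := by rw [htop]; trivial
    obtain ⟨a, ha, b, hb, rfl⟩ := Subgroup.mem_sup.1 this
    obtain ⟨m, rfl⟩ := (Submonoid.mem_powers_iff _ _).1 (mem_powers_iff_mem_zpowers.2 hb)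
    have em : x0 ^ m = x0 ^ (m % 3) := by
      conv_lhs => rw [← Nat.div_add_mod m 3, pow_add, pow_mul, he, one_pow, one_mul]
    have key : ∀ a' ∈ Rad r x0, r (a' * x0) (l * (a' * x0)) ∧ r (a' * x0) (l⁻¹ * (a' * x0)) := by
      intro a' ha'
      have e := h.mem_Rad' ha'
      have e2 := h.symm e
      exact ⟨h.trans e2 (mem_Rad hl e), h.trans e2 (mem_Rad (inv_mem hl) e)⟩
    have hm : m % 3 < 3 := Nat.mod_lt _ (by norm_num)
    rw [em] at hx ⊢
    interval_cases hmm : m % 3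
    · exfalso; apply hx; simpa using ha
    · rw [pow_one]; exact (key a ha).1
    · have e : x0 ^ 2 = x0⁻¹ := by
        rw [eq_inv_iff_mul_eq_one, ← pow_succ]; exact he x0
      rw [e]
      have := h.inv (key a⁻¹ (inv_mem ha)).2
      rw [mul_inv, inv_inv, mul_inv, inv_inv, mul_inv, inv_inv] at this
      exact this
end glue

section inst

theorem zdiv {n i : ℕ} (hi : i ≤ n) (w : ZMod (3 ^ n)) (h : (3:ZMod (3^n)) ^ i * w = 0) : ∃ k, w = 3 ^ (n - i) * k := by
  have e : w = ((w.val : ℕ) : ZMod (3 ^ n)) := (ZMod.natCast_zmod_val w).symm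
  have h1 : ((3 ^ i * w.val : ℕ) : ZMod (3 ^ n)) = 0 := by push_cast; rw [← e]; exact h
  rw [ZMod.natCast_eq_zero_iff] at h1
  have h2 : 3 ^ (n - i) ∣ w.val := by
    apply Nat.dvd_of_mul_dvd_mul_left (k := 3 ^ i) (by positivity)
    rw [← pow_add, Nat.add_sub_of_le hi]; exact h1
  obtain ⟨k, hk⟩ := h2
  refine ⟨(k : ZMod (3 ^ n)), ?_⟩
  rw [e, hk]; push_cast; rfl

theorem z3n {n : ℕ} : (3 : ZMod (3 ^ n)) ^ n = 0 := by
  have := ZMod.natCast_self (3 ^ n)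
  push_cast at this; exact this

theorem z3 {n : ℕ} (hn : 1 ≤ n) (w : ZMod (3 ^ n)) (h : 3 * w = 0) : w = 0 ∨ w = 3 ^ (n-1) ∨ w = - 3 ^ (n-1) := by
  obtain ⟨k, hk⟩ := zdiv hn w (by rw [pow_one]; exact h)
  have e : k = ((k.val : ℕ) : ZMod (3 ^ n)) := (ZMod.natCast_zmod_val k).symm
  have e2 : k = 3 * ((k.val / 3 : ℕ) : ZMod (3 ^ n)) + ((k.val % 3 : ℕ) : ZMod (3 ^ n)) := by
    conv_lhs => rw [e, ← Nat.div_add_mod k.val 3]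
    push_cast; rfl
  have hp : (3 : ZMod (3 ^ n)) ^ (n-1) * 3 = 0 := by
    rw [← pow_succ, Nat.sub_add_cancel hn, z3n]
  rw [e2, mul_add, ← mul_assoc, hp, zero_mul, zero_add] at hk
  have hm : k.val % 3 < 3 := Nat.mod_lt _ (by norm_num)
  interval_cases k.val % 3
  · left; rw [hk]; simp
  · right; left; rw [hk]; simp
  · right; right; rw [hk, eq_neg_iff_add_eq_zero]
    push_cast
    rw [← hp]; ring

theorem zorb {n l : ℕ} (hl : 1 ≤ l) (hln : l ≤ n) (b b' : ZMod (3 ^ n)) (ε : ZMod (3 ^ n)) (hε : IsUnit ε)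
    (h1 : 3 ^ (l-1) * b = ε * 3 ^ (n-1)) (h2 : 3 ^ (l-1) * b' = 3 ^ (l-1) * b) : ∃ m : ℕ, b' = b + 3 * m * b := by
  have hb : 3 ^ l * b = 0 := by
    rw [show l = (l-1) + 1 by omega, pow_succ', mul_assoc, h1, mul_left_comm, ← pow_succ',
      show n - 1 + 1 = n by omega, z3n, mul_zero]
  obtain ⟨u, hu⟩ := zdiv hln b hb
  have h3 : 3 ^ (n-1) * (u - ε) = 0 := by
    rw [hu, ← mul_assoc, ← pow_add, show l - 1 + (n - l) = n - 1 by omega] at h1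
    rw [mul_sub, h1]; ring
  obtain ⟨k, hk⟩ := zdiv (show n - 1 ≤ n by omega) _ h3
  rw [show n - (n-1) = 1 by omega, pow_one] at hk
  have huu : IsUnit u := by
    rw [show u = ε + 3 * k by rw [← hk]; ring]
    refine IsNilpotent.isUnit_add_left_of_commute ⟨n, ?_⟩ hε (Commute.all _ _)
    rw [mul_pow, z3n, zero_mul]
  obtain ⟨k', hk'⟩ := zdiv (show l - 1 ≤ n by omega) (b' - b) (by rw [mul_sub, h2, sub_self])
  obtain ⟨u', rfl⟩ := huu
  refine ⟨((↑u'⁻¹ : ZMod (3 ^ n)) * k').val, ?_⟩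
  rw [ZMod.natCast_zmod_val]
  have : b' = b + (b' - b) := by ring
  rw [this, hk']
  congr 1
  conv_rhs => rw [hu]
  rw [show n - (l-1) = (n - l) + 1 by omega, pow_succ]
  calc (3:ZMod (3^n)) ^ (n-l) * 3 * k' = 3 ^ (n-l) * 3 * (((↑u' : ZMod (3 ^ n)) * ↑u'⁻¹) * k') := by rw [Units.mul_inv, one_mul]
    _ = _ := by ring

def cD (n : ℕ) : Dgrp n := (1, Multiplicative.ofAdd (3 ^ (n-1) : ZMod (3 ^ n)))

theorem D_pow_eq {n : ℕ} (g : Dgrp n) (k : ℕ) : (g ^ k).2 = Multiplicative.ofAdd ((k : ZMod (3 ^ n)) * Multiplicative.toAdd g.2) := by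
  rw [Prod.pow_snd, ← nsmul_eq_mul, ofAdd_nsmul, ofAdd_toAdd]

theorem mz3p (a : Multiplicative (ZMod 3)) {k : ℕ} (hk : 1 ≤ k) : a ^ (3 ^ k) = 1 := by
  rw [show 3 ^ k = 3 * 3 ^ (k-1) by rw [← pow_succ']; congr 1; omega, pow_mul, mz3, one_pow]

theorem D_ext {n : ℕ} {g h : Dgrp n} (h1 : g.1 = h.1) (h2 : Multiplicative.toAdd g.2 = Multiplicative.toAdd h.2) : g = h :=
  Prod.ext h1 (Multiplicative.toAdd.injective h2)

theorem cD_ne {n : ℕ} (hn : 1 ≤ n) : (3 : ZMod (3 ^ n)) ^ (n-1) ≠ 0 := by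
  intro k
  have : ((3 ^ (n-1) : ℕ) : ZMod (3 ^ n)) = 0 := by push_cast; exact k
  rw [ZMod.natCast_eq_zero_iff] at this
  have := Nat.le_of_dvd (by positivity) this
  have h2 : 3 ^ (n-1) < 3 ^ n := Nat.pow_lt_pow_right (by norm_num) (by omega)
  omega

theorem toAdd_pow' {n : ℕ} (g : Dgrp n) (k : ℕ) :
    Multiplicative.toAdd (g ^ (3 ^ k)).2 = 3 ^ k * Multiplicative.toAdd g.2 := by
  rw [D_pow_eq, toAdd_ofAdd]; push_cast; rfl

theorem c_cases {n : ℕ} (hn : 1 ≤ n) (w : Dgrp n) (h1 : w.1 = 1) (h : 3 * Multiplicative.toAdd w.2 = 0) :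
    w = 1 ∨ w = cD n ∨ w = (cD n)⁻¹ := by
  rcases z3 hn _ h with k | k | k
  · left; exact D_ext h1 k
  · right; left; exact D_ext h1 k
  · right; right; refine D_ext ?_ k
    rw [h1]; simp [cD]

theorem DG_inst {n : ℕ} (hn : 2 ≤ n) : DG n (cD n) (MonoidHom.fst (Multiplicative (ZMod 3)) (Multiplicative (ZMod (3 ^ n)))) where
  n2 := hn
  c3 := by
    apply D_ext
    · exact mz3 _
    · have := toAdd_pow' (cD n) 1
      rw [pow_one] at this
      rw [this]
      show (3 : ZMod (3 ^ n)) ^ 1 * 3 ^ (n-1) = 0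
      rw [← pow_add, show 1 + (n-1) = n by omega, z3n]
  c1 := by
    intro k
    have := congrArg (fun g : Dgrp n => Multiplicative.toAdd g.2) k
    exact cD_ne (by omega) this
  exp := by
    intro g
    apply D_ext
    · exact mz3p _ (by omega)
    · rw [toAdd_pow', z3n, zero_mul]; rfl
  sgn := by
    intro l hl g hg
    apply c_cases (by omega)
    · exact mz3p _ (by omega)
    · rw [toAdd_pow', ← mul_assoc, ← pow_succ', show l - 1 + 1 = l by omega, ← toAdd_pow', hg]; rfl
  αc := rfl
  ker := by
    intro g hg ha
    apply c_cases (by omega) g ha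
    have := toAdd_pow' g 1
    rw [pow_one, hg, pow_one] at this
    rw [← this]; rfl
  ext := by
    refine ⟨(Multiplicative.ofAdd 1, 1), ?_, ?_⟩
    · apply Prod.ext
      · exact mz3 _
      · simp
    · show (Multiplicative.ofAdd 1 : Multiplicative (ZMod 3)) ≠ 1
      decide
  orb := by
    intro l hl x y hx hy ha
    have hx2 : 3 ^ (l-1) * Multiplicative.toAdd x.2 = (3:ZMod (3^n)) ^ (n-1) ∨
        3 ^ (l-1) * Multiplicative.toAdd x.2 = -(3:ZMod (3^n)) ^ (n-1) := by
      rw [← toAdd_pow']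
      rcases hx with k | k
      · left; rw [k]; rfl
      · right; rw [k]; rfl
    have hln : l ≤ n := by
      by_contra k
      have h0 : (3 : ZMod (3 ^ n)) ^ (l-1) = 0 := by
        rw [show l - 1 = n + (l - 1 - n) by omega, pow_add, z3n, zero_mul]
      rw [h0, zero_mul] at hx2
      rcases hx2 with q | q
      · exact cD_ne (by omega) q.symm
      · exact cD_ne (by omega) (neg_eq_zero.1 q.symm)
    have hy2 : 3 ^ (l-1) * Multiplicative.toAdd y.2 = 3 ^ (l-1) * Multiplicative.toAdd x.2 := by
      rw [← toAdd_pow', ← toAdd_pow', hy]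
    obtain ⟨m, hm⟩ : ∃ m : ℕ, Multiplicative.toAdd y.2 = Multiplicative.toAdd x.2 + 3 * m * Multiplicative.toAdd x.2 := by
      rcases hx2 with k | k
      · exact zorb (by omega) hln _ _ 1 isUnit_one (by rw [one_mul]; exact k) hy2
      · exact zorb (by omega) hln _ _ (-1) isUnit_one.neg (by rw [neg_one_mul]; exact k) hy2
    refine ⟨m, D_ext ?_ ?_⟩
    · have h1 : x.1 = y.1 := ha
      rw [Prod.pow_fst, pow_add, pow_one, pow_mul, mz3, one_pow, mul_one, h1]
    · rw [D_pow_eq, toAdd_ofAdd, hm]; push_cast; ring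
end inst

/-- if `rad(A) > e` then `A` is a proper `U/L`-wreath product:
there are `A`-subgroups `L ≤ U`, `L ≠ e`, `U ≠ D`, with every basic set
outside `U` a union of `L`-cosets; moreover one can choose them so that
`|U/L| = 1`, or `|U/L| = 3`, or `rad(A_U) = e` and `|L| = 3`. -/
theorem stmt18 (n : ℕ) (hn : 1 ≤ n) (S : Finset (Finset (Dgrp n)))
    (hS : IsSRing S)
    (hrad : ∃ X ∈ S, (∃ x ∈ X, orderOf x = 3 ^ n) ∧
      ∃ g : Dgrp n, g ≠ 1 ∧ X.image (g * ·) = X) :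
    ∃ L U : Subgroup (Dgrp n),
      IsASubgroup S L ∧ IsASubgroup S U ∧ L ≤ U ∧ L ≠ ⊥ ∧ U ≠ ⊤ ∧
      (∀ X ∈ S, ¬ (X : Set (Dgrp n)) ⊆ (U : Set (Dgrp n)) →
        ∀ x ∈ X, ∀ l ∈ L, l * x ∈ X) ∧
      (Nat.card U = Nat.card L ∨ Nat.card U = 3 * Nat.card L ∨
        ((∀ X ∈ S, (X : Set (Dgrp n)) ⊆ (U : Set (Dgrp n)) →
            (∃ x ∈ X, orderOf x = Monoid.exponent U) →
            ∀ g : Dgrp n, X.image (g * ·) = X → g = 1) ∧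
          Nat.card L = 3)) := by
  obtain ⟨X, hX, ⟨x, hx, ho⟩, g, hg1, hgX⟩ := hrad
  have hSR := rel_SR hS
  have hgR : g ∈ Rad (rel S) x := image_Rad hS _ hX hx hgX
  have hGoal : Goal (rel S) := by
    rcases Nat.lt_or_ge n 2 with hn2 | hn2
    · obtain rfl : n = 1 := by omega
      apply e3case hSR _ _ _ hgR hg1
      · intro g
        apply Prod.ext
        · exact mz3 _
        · exact mz3 g.2
      · rw [Nat.card_eq_fintype_card]; rfl
      · rintro rfl
        rw [orderOf_one] at ho; omega
    · have hxl : Lv n x := by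
        refine ⟨(DG_inst hn2).exp x, fun k => ?_⟩
        have h1 := orderOf_dvd_of_pow_eq_one (mem_Om.1 k)
        rw [ho] at h1
        have h2 := Nat.le_of_dvd (by positivity) h1
        have h3 : 3 ^ (n-1) < 3 ^ n := Nat.pow_lt_pow_right (by norm_num) (by omega)
        omega
      exact (DG_inst hn2).main hSR hxl hgR hg1
  obtain ⟨L, U, hL, hU, hLU, hLb, hUt, hw, hcard⟩ := hGoal
  refine ⟨L, U, RC_ASub hS hL, RC_ASub hS hU, hLU, hLb, hUt, ?_, ?_⟩
  · intro Y hY hYU y hy l hl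
    have hyU : y ∉ U := by
      intro k
      apply hYU
      intro y' hy'
      exact hU _ _ ((mem_rel hS hY hy).2 hy') k
    exact (mem_rel hS hY hy).1 (hw y hyU l hl)
  · rcases hcard with k | k | ⟨k, k'⟩
    · exact Or.inl k
    · exact Or.inr (Or.inl k)
    · refine Or.inr (Or.inr ⟨?_, k'⟩)
      rintro Y hY hYU ⟨y, hy, hyo⟩ g' hg'
      exact k y (hYU hy) hyo g' (image_Rad hS _ hY hy hg')
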